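/- Let M be a simple non-regular binary matroid of rank r ≥ 6 with no AG(3,2)-minor. Then the number of elements of M is at most (r choose 2) + 4. -/

import Mathlib

open Matroid Set

variable {α : Type*}

/-- Deletion of a set of elements from a matroid. -/
def Matroid.del (M : Matroid α) (D : Set α) : Matroid α := M ↾ (M.E \ D)

/-- Contraction of a set of elements in a matroid, defined by duality. -/
def Matroid.con (M : Matroid α) (C : Set α) : Matroid α := ((M✶).del C)✶

/-- `N` is a minor of `M` if it is obtained from `M` by a contraction followed by a deletion. -/
def Matroid.IsMinorOf (N M : Matroid α) : Prop := ∃ C D : Set α, N = (M.con C).del D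

/-- `C` is a circuit of `M`: a dependent set all of whose proper subsets are independent. -/
def Matroid.IsCircuitSet (M : Matroid α) (C : Set α) : Prop :=
  M.Dep C ∧ ∀ D ⊂ C, M.Indep D

/-- A matroid is simple if it has no circuits of size one or two, equivalently every
one- or two-element subset of the ground set is independent. -/
def Matroid.IsSimpleM (M : Matroid α) : Prop := ∀ e ∈ M.E, ∀ f ∈ M.E, M.Indep {e, f}

/-- The rank of a set `X` in a matroid `M`: the supremum of the sizes of independent
subsets of `X`. -/
noncomputable def Matroid.rks (M : Matroid α) (X : Set α) : ℕ :=
  sSup {n : ℕ | ∃ I ⊆ X, M.Indep I ∧ I.ncard = n}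

/-- The rank of a matroid. -/
noncomputable def Matroid.rkM (M : Matroid α) : ℕ := M.rks M.E

/-- `M` is represented over the field `F` by the vector assignment `φ`:
a subset of the ground set is independent iff `φ` is linearly independent on it. -/
def Matroid.IsRepBy (M : Matroid α) (F : Type*) [Field F] {W : Type*} [AddCommGroup W]
    [Module F W] (φ : α → W) : Prop :=
  ∀ I ⊆ M.E, (M.Indep I ↔ LinearIndependent F (I.restrict φ))

/-- `M` is representable over the field `F`. -/
def Matroid.IsRepOver (M : Matroid α) (F : Type) [Field F] : Prop :=
  ∃ (n : ℕ) (φ : α → (Fin n → F)), M.IsRepBy F φ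

/-- A binary matroid is one representable over the two-element field `GF(2)`. -/
def Matroid.IsBinaryM (M : Matroid α) : Prop := M.IsRepOver (ZMod 2)

/-- A regular matroid is one representable over every field. -/
def Matroid.IsRegularM (M : Matroid α) : Prop := ∀ (F : Type) [Field F], M.IsRepOver F

/-- `M` is isomorphic to the binary vector matroid on the set of vectors `V`:
there is a representation of `M` over `GF(2)` mapping the ground set bijectively to `V`. -/
def Matroid.IsBinaryIsoTo (M : Matroid α) {W : Type*} [AddCommGroup W] [Module (ZMod 2) W]
    (V : Set W) : Prop :=
  ∃ φ : α → W, M.IsRepBy (ZMod 2) φ ∧ Set.BijOn φ M.E V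

/-- The eight points of the binary affine cube `AG(3,2)`: the vectors `(1, x)` in `GF(2)⁴`. -/
def agVecs : Set (Fin 4 → ZMod 2) := {x | x 0 = 1}

/-- `M` has a minor isomorphic to `AG(3,2)`. -/
def Matroid.HasAGMinor (M : Matroid α) : Prop :=
  ∃ N : Matroid α, N.IsMinorOf M ∧ N.IsBinaryIsoTo agVecs

/-- The seven points of the Fano plane `F₇`: the nonzero vectors of `GF(2)³`. -/
def fanoVecs : Set (Fin 3 → ZMod 2) := {x | x ≠ 0}

/-- The vectors `eᵢ + eⱼ` (`i ≠ j`) representing the graphic matroid `M(K_n)`. -/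
def kVecs (n : ℕ) : Set (Fin n → ZMod 2) :=
  {x | ∃ i j : Fin n, i ≠ j ∧ x = Pi.single i 1 + Pi.single j 1}

/-- `ℓ` is a line (3-element circuit) of `M` through `x`. -/
def Matroid.IsLineThru (M : Matroid α) (x : α) (ℓ : Set α) : Prop :=
  M.IsCircuitSet ℓ ∧ ℓ.ncard = 3 ∧ x ∈ ℓ

/-- A matroid is connected if it is nonempty and every two distinct elements of the
ground set lie in a common circuit. -/
def Matroid.IsConnectedM (M : Matroid α) : Prop :=
  M.E.Nonempty ∧ ∀ e ∈ M.E, ∀ f ∈ M.E, e ≠ f →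
    ∃ C, M.IsCircuitSet C ∧ e ∈ C ∧ f ∈ C

/-- A matroid is 3-connected if it is connected and has no 2-separation, i.e. no partition
`(A, B)` of the ground set with `|A| ≥ 2`, `|B| ≥ 2` and `r(A) + r(B) - r(M) ≤ 1`. -/
def Matroid.IsThreeConnected (M : Matroid α) : Prop :=
  M.IsConnectedM ∧ ¬ ∃ A B : Set α, A ∪ B = M.E ∧ Disjoint A B ∧
    2 ≤ A.ncard ∧ 2 ≤ B.ncard ∧ M.rks A + M.rks B ≤ M.rkM + 1

set_option linter.all false
namespace NR

abbrev K := ZMod 2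

section basics
variable {V U X : Type} [AddCommGroup V] [Module K V] [AddCommGroup U] [Module K U]
  [AddCommGroup X] [Module K X]

theorem aa (a : V) : a + a = 0 := ZModModule.add_self a
theorem aab (a b : V) : a + (a + b) = b := by rw [← add_assoc, aa, zero_add]
theorem eq_of_add {a b : V} (h : a + b = 0) : a = b := by
  rw [← add_zero a, ← aa b, ← add_assoc, h, zero_add]
theorem add_eq_iff {a b c : V} : a + b = c ↔ a = b + c := by
  constructor
  · rintro rfl; simp only [add_assoc, add_comm, add_left_comm, aa, aab, add_zero, zero_add]
  · rintro rfl; simp only [add_assoc, add_comm, add_left_comm, aa, aab, add_zero, zero_add]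
theorem sub_eq (a b : V) : a - b = a + b := ZModModule.sub_eq_add a b

theorem k01 (c : K) : c = 0 ∨ c = 1 := by
  revert c; decide
theorem kne {c : K} (h : c ≠ 0) : c = 1 := (k01 c).resolve_left h
theorem kne1 {c : K} (h : c ≠ 1) : c = 0 := (k01 c).resolve_right h

/-- `f` is a contraction of the point set `E`. -/
structure IsContr (E : Set V) (f : V →ₗ[K] U) : Prop where
  surj : Function.Surjective f
  ker : ∃ C ⊆ E, LinearMap.ker f = Submodule.span K C

/-- `E` contains an affine cube. -/
def Cube (E : Set V) : Prop :=
  ∃ g : (Fin 4 → K) →ₗ[K] V, Function.Injective g ∧ ∀ x, x 0 = 1 → g x ∈ E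

/-- `E` has no `AG(3,2)`-minor. -/
def AGF (E : Set V) : Prop :=
  ∀ (U : Type) [AddCommGroup U] [Module K U] (f : V →ₗ[K] U), IsContr E f → ¬ Cube (f '' E)

/-- A Fano plane contained in `E` (we always put `0 ∈ E`). -/
def IsPlane (E : Set V) (P : Submodule K V) : Prop :=
  Module.finrank K P = 3 ∧ (P : Set V) ⊆ E

/-- `E` has a Fano minor. -/
def FM (E : Set V) : Prop :=
  ∃ (U : Type) (_ : AddCommGroup U) (_ : Module K U) (f : V →ₗ[K] U),
    IsContr E f ∧ ∃ P, IsPlane (f '' E) P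

theorem IsContr.comp {E : Set V} {f : V →ₗ[K] U} {g : U →ₗ[K] X} (hf : IsContr E f)
    (hg : IsContr (f '' E) g) : IsContr E (g ∘ₗ f) := by
  refine ⟨hg.surj.comp hf.surj, ?_⟩
  obtain ⟨C, hC, hk⟩ := hf.ker
  obtain ⟨C', hC', hk'⟩ := hg.ker
  refine ⟨C ∪ (E ∩ f ⁻¹' C'), union_subset hC inter_subset_left, ?_⟩
  have hC'' : f '' (E ∩ f ⁻¹' C') = C' := by
    rw [image_inter_preimage]; exact inter_eq_right.2 hC'
  have h3 : Submodule.span K C' = (Submodule.span K (E ∩ f ⁻¹' C')).map f := by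
    rw [Submodule.map_span, hC'']
  rw [LinearMap.ker_comp, hk', h3, Submodule.comap_map_eq, hk, Submodule.span_union, sup_comm]

theorem AGF.map {E : Set V} (h : AGF E) {f : V →ₗ[K] U} (hf : IsContr E f) : AGF (f '' E) := by
  intro X _ _ g hg
  have := h X (g ∘ₗ f) (hf.comp hg)
  rwa [LinearMap.coe_comp, image_comp] at this

theorem FM.of_map {E : Set V} {f : V →ₗ[K] U} (hf : IsContr E f) (h : FM (f '' E)) : FM E := by
  obtain ⟨X, _, _, g, hg, P, hP⟩ := h
  refine ⟨X, _, _, g ∘ₗ f, hf.comp hg, P, ?_⟩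
  rwa [LinearMap.coe_comp, image_comp]

theorem isContr_mkQ {E C : Set V} (hC : C ⊆ E) : IsContr E (Submodule.span K C).mkQ :=
  ⟨Submodule.mkQ_surjective _, C, hC, Submodule.ker_mkQ _⟩

theorem isContr_id (E : Set V) : IsContr E (LinearMap.id : V →ₗ[K] V) :=
  ⟨Function.surjective_id, ∅, empty_subset _, by simp [LinearMap.ker_id]⟩

theorem FM.of_plane {E : Set V} {P : Submodule K V} (h : IsPlane E P) : FM E :=
  ⟨V, _, _, LinearMap.id, isContr_id E, P, by simpa using h⟩

/-- linear functionals with prescribed values on a linearly independent family -/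
theorem exists_functional {ι : Type*} {F W : Type*} [Field F] [AddCommGroup W] [Module F W]
    {v : ι → W} (h : LinearIndependent F v) (c : ι → F) :
    ∃ φ : W →ₗ[F] F, ∀ i, φ (v i) = c i := by
  obtain ⟨g, hg⟩ := LinearMap.exists_extend ((Module.Basis.span h).constr F c)
  refine ⟨g, fun i => ?_⟩
  have h1 : ((Module.Basis.span h).constr F c) (Module.Basis.span h i) = c i :=
    Module.Basis.constr_basis _ _ _ _
  rw [← hg] at h1
  simpa [Module.Basis.span_apply] using h1

theorem span_pair_mem {x y v : V} (h : v ∈ Submodule.span K ({x, y} : Set V)) :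
    v = 0 ∨ v = x ∨ v = y ∨ v = x + y := by
  obtain ⟨a, b, rfl⟩ := Submodule.mem_span_pair.1 h
  rcases k01 a with rfl | rfl <;> rcases k01 b with rfl | rfl <;> simp

theorem span_single_mem {x v : V} (h : v ∈ Submodule.span K ({x} : Set V)) :
    v = 0 ∨ v = x := by
  obtain ⟨a, rfl⟩ := Submodule.mem_span_singleton.1 h
  rcases k01 a with rfl | rfl <;> simp

/-- criterion for the presence of an `AG(3,2)`-minor -/
theorem AGF.cert {E : Set V} (h : AGF E) {C : Set V} (hC : C ⊆ E) (a u v w : V)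
    (φ : Fin 4 → V →ₗ[K] K) (hφ : ∀ i, ∀ c ∈ C, φ i c = 0)
    (hind : ∀ c : Fin 4 → K, (∀ i, c 0 * φ i a + c 1 * φ i u + c 2 * φ i v + c 3 * φ i w = 0) →
      c = 0)
    (hE : ∀ i j k : K, ∃ e ∈ E, a + i • u + j • v + k • w + e ∈ Submodule.span K C) : False := by
  apply h _ _ (isContr_mkQ hC)
  set Q := (Submodule.span K C).mkQ
  have hQ : ∀ z, Q z = 0 ↔ z ∈ Submodule.span K C := by
    intro z; rw [← LinearMap.mem_ker, Submodule.ker_mkQ]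
  refine ⟨Fintype.linearCombination K ![Q a, Q u, Q v, Q w], ?_, ?_⟩
  · rw [← LinearMap.ker_eq_bot, LinearMap.ker_eq_bot']
    intro c hc
    rw [Fintype.linearCombination_apply, Fin.sum_univ_four] at hc
    simp only [Matrix.cons_val] at hc
    rw [← map_smul, ← map_smul, ← map_smul, ← map_smul, ← map_add, ← map_add, ← map_add, hQ] at hc
    apply hind
    intro i
    have : Submodule.span K C ≤ LinearMap.ker (φ i) := Submodule.span_le.2 (hφ i)
    have := this hc
    rw [LinearMap.mem_ker] at this
    simpa using this
  · intro x hx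
    obtain ⟨e, he, hs⟩ := hE (x 1) (x 2) (x 3)
    refine ⟨e, he, ?_⟩
    rw [← hQ, map_add] at hs
    rw [← eq_of_add hs, Fintype.linearCombination_apply, Fin.sum_univ_four]
    simp [hx]

end basics
end NR

namespace NR

section words
variable {V U X : Type} [AddCommGroup V] [Module K V] [AddCommGroup U] [Module K U]
  [AddCommGroup X] [Module K X]
variable {ι : Type} [DecidableEq ι]

/-- sum of a set of members of a family -/
def wd (b : ι → V) (A : Finset ι) : V := ∑ i ∈ A, b i

theorem wd_add (b : ι → V) (A B : Finset ι) : wd b A + wd b B = wd b (symmDiff A B) := by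
  unfold wd
  have h1 : ∑ i ∈ A, b i = ∑ i ∈ A \ B, b i + ∑ i ∈ A ∩ B, b i := by
    rw [← Finset.sum_union (Finset.disjoint_sdiff_inter A B), Finset.sdiff_union_inter]
  have h2 : ∑ i ∈ B, b i = ∑ i ∈ B \ A, b i + ∑ i ∈ A ∩ B, b i := by
    rw [Finset.inter_comm, ← Finset.sum_union (Finset.disjoint_sdiff_inter B A),
      Finset.sdiff_union_inter]
  have h3 : ∑ i ∈ symmDiff A B, b i = ∑ i ∈ A \ B, b i + ∑ i ∈ B \ A, b i := by
    rw [← Finset.sum_union]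
    · rfl
    · exact disjoint_sdiff_sdiff
  rw [h1, h2, h3]
  have := aa (∑ i ∈ A ∩ B, b i)
  generalize ∑ i ∈ A ∩ B, b i = z at *
  generalize ∑ i ∈ A \ B, b i = p at *
  generalize ∑ i ∈ B \ A, b i = q at *
  simp only [add_assoc, add_comm, add_left_comm, aa, aab, add_zero, zero_add]

@[simp] theorem wd_empty (b : ι → V) : wd b ∅ = 0 := by simp [wd]
@[simp] theorem wd_single (b : ι → V) (i : ι) : wd b {i} = b i := by simp [wd]
theorem wd_insert (b : ι → V) {i : ι} {A : Finset ι} (h : i ∉ A) :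
    wd b (insert i A) = b i + wd b A := by simp [wd, h]
theorem wd_map (f : V →ₗ[K] U) (b : ι → V) (A : Finset ι) :
    f (wd b A) = wd (fun i => f (b i)) A := by simp [wd]

theorem coord {b : ι → V} (h : LinearIndependent K b) (i : ι) :
    ∃ φ : V →ₗ[K] K, ∀ A, φ (wd b A) = if i ∈ A then 1 else 0 := by
  obtain ⟨φ, hφ⟩ := exists_functional h (Pi.single i 1)
  refine ⟨φ, fun A => ?_⟩
  simp [wd, hφ, Pi.single_apply]

theorem wd_inj {b : ι → V} (h : LinearIndependent K b) {A B : Finset ι}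
    (hAB : wd b A = wd b B) : A = B := by
  ext i
  obtain ⟨φ, hφ⟩ := coord h i
  have h1 := hφ A
  rw [hAB, hφ B] at h1
  by_cases hA : i ∈ A <;> by_cases hB : i ∈ B <;> simp_all

theorem wd_eq_zero {b : ι → V} (h : LinearIndependent K b) {A : Finset ι} :
    wd b A = 0 ↔ A = ∅ := by
  constructor
  · intro h1; apply wd_inj h; simpa using h1
  · rintro rfl; simp

theorem wd_mem_span (b : ι → V) (A : Finset ι) : wd b A ∈ Submodule.span K (range b) :=
  Submodule.sum_mem _ fun i _ => Submodule.subset_span ⟨i, rfl⟩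

theorem exists_wd {b : ι → V} {v : V} (h : v ∈ Submodule.span K (range b)) :
    ∃ A, v = wd b A := by
  induction h using Submodule.span_induction with
  | mem x hx => obtain ⟨i, rfl⟩ := hx; exact ⟨{i}, by simp⟩
  | zero => exact ⟨∅, by simp⟩
  | add x y _ _ hx hy =>
    obtain ⟨A, rfl⟩ := hx; obtain ⟨B, rfl⟩ := hy; exact ⟨_, wd_add b A B⟩
  | smul a x _ hx =>
    obtain ⟨A, rfl⟩ := hx
    rcases k01 a with rfl | rfl
    · exact ⟨∅, by simp⟩
    · exact ⟨A, by simp⟩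

end words

section contr
variable {V U X : Type} [AddCommGroup V] [Module K V] [AddCommGroup U] [Module K U]
  [AddCommGroup X] [Module K X]

/-- `f` is the contraction of the single point `x` -/
structure C1 (E : Set V) (x : V) (f : V →ₗ[K] U) : Prop where
  mem : x ∈ E
  ne : x ≠ 0
  surj : Function.Surjective f
  ker : LinearMap.ker f = Submodule.span K {x}

theorem c1_mkQ {E : Set V} {x : V} (hx : x ∈ E) (h0 : x ≠ 0) :
    C1 E x (Submodule.span K {x}).mkQ :=
  ⟨hx, h0, Submodule.mkQ_surjective _, Submodule.ker_mkQ _⟩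

variable {E : Set V} {x : V} {f : V →ₗ[K] U}

theorem C1.contr (h : C1 E x f) : IsContr E f :=
  ⟨h.surj, {x}, by simpa using h.mem, h.ker⟩

theorem C1.eq_zero_iff (h : C1 E x f) {a : V} : f a = 0 ↔ a = 0 ∨ a = x := by
  rw [← LinearMap.mem_ker, h.ker]
  constructor
  · exact span_single_mem
  · rintro (rfl | rfl)
    · exact Submodule.zero_mem _
    · exact Submodule.mem_span_singleton_self _

theorem C1.apply (h : C1 E x f) : f x = 0 := h.eq_zero_iff.2 (Or.inr rfl)

theorem C1.eq_iff (h : C1 E x f) {a b : V} : f a = f b ↔ a = b ∨ a = b + x := by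
  rw [← sub_eq_zero, ← map_sub, h.eq_zero_iff, sub_eq_zero, sub_eq_iff_eq_add']

theorem C1.finrank [Finite V] (h : C1 E x f) :
    Module.finrank K V = Module.finrank K U + 1 := by
  have h1 := LinearMap.finrank_range_add_finrank_ker f
  rw [LinearMap.range_eq_top.2 h.surj, finrank_top, h.ker, finrank_span_singleton h.ne] at h1
  exact h1.symm

/-- points of the contraction whose whole fibre lies in `E` -/
def T (E : Set V) (f : V →ₗ[K] U) : Set U := {u | u ≠ 0 ∧ ∀ e, f e = u → e ∈ E}

theorem C1.mem_T (h : C1 E x f) {e : V} :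
    f e ∈ T E f ↔ e ≠ 0 ∧ e ≠ x ∧ e ∈ E ∧ e + x ∈ E := by
  constructor
  · rintro ⟨h0, h1⟩
    refine ⟨?_, ?_, h1 e rfl, h1 _ ?_⟩
    · rintro rfl; simp at h0
    · rintro rfl; exact h0 h.apply
    · rw [map_add, h.apply, add_zero]
  · rintro ⟨h1, h2, h3, h4⟩
    refine ⟨?_, ?_⟩
    · rw [Ne, h.eq_zero_iff]; tauto
    · intro e' he'
      rcases h.eq_iff.1 he' with rfl | rfl <;> assumption

theorem T_subset (hf : Function.Surjective f) : T E f ⊆ f '' E := by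
  rintro u ⟨_, h⟩
  obtain ⟨e, rfl⟩ := hf u
  exact ⟨e, h e rfl, rfl⟩

theorem C1.count [Finite V] (h : C1 E x f) (h0 : (0:V) ∈ E) :
    E.ncard = (f '' E).ncard + ((T E f).ncard + 1) := by
  classical
  have hU : Finite U := Finite.of_surjective f h.surj
  have : ∀ u : U, ∃ v : V, f v = u ∧ (u ∈ f '' E → v ∈ E) := by
    intro u
    by_cases hu : u ∈ f '' E
    · obtain ⟨e, he, rfl⟩ := hu
      exact ⟨e, rfl, fun _ => he⟩
    · obtain ⟨v, rfl⟩ := h.surj u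
      exact ⟨v, rfl, fun h => absurd h hu⟩
  choose s hs hs' using this
  have hinj : Function.Injective s := fun a b hab => by rw [← hs a, hab, hs]
  have hinj2 : Function.Injective (fun u => s u + x) := fun a b hab => hinj (add_right_cancel hab)
  have hE : E = s '' (f '' E) ∪ (fun u => s u + x) '' (insert 0 (T E f)) := by
    ext e
    constructor
    · intro he
      rcases h.eq_iff.1 (hs (f e)).symm with h1 | h1
      · left; exact ⟨f e, ⟨e, he, rfl⟩, h1.symm⟩
      · right
        refine ⟨f e, ?_, h1.symm⟩
        by_cases hz : f e = 0
        · left; exact hz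
        · right
          refine ⟨hz, fun e' he' => ?_⟩
          rcases h.eq_iff.1 he' with rfl | rfl
          · exact he
          · rw [h1, add_assoc, aa, add_zero]; exact hs' _ ⟨e, he, rfl⟩
    · rintro (⟨u, hu, rfl⟩ | ⟨u, hu, rfl⟩)
      · exact hs' u hu
      · rcases hu with rfl | hu
        · rcases h.eq_zero_iff.1 (hs 0) with h1 | h1
          · simpa [h1] using h.mem
          · simpa [h1, aa] using h0
        · apply hu.2
          simp only [map_add, hs, h.apply, add_zero]
  have hdisj : Disjoint (s '' (f '' E)) ((fun u => s u + x) '' (insert 0 (T E f))) := by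
    rw [Set.disjoint_left]
    rintro _ ⟨u, hu, rfl⟩ ⟨v, hv, h1⟩
    simp only at h1
    have h2 := congrArg f h1
    rw [map_add, hs, hs, h.apply, add_zero] at h2
    subst h2
    exact h.ne (by simpa using h1)
  conv_lhs => rw [hE]
  rw [ncard_union_eq hdisj, ncard_image_of_injective _ hinj, ncard_image_of_injective _ hinj2,
    ncard_insert_of_notMem]
  intro h1; exact h1.1 rfl

end contr
end NR

namespace NR

section w4
variable {V U X : Type} [AddCommGroup V] [Module K V] [AddCommGroup U] [Module K U]
  [AddCommGroup X] [Module K X]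
variable {E : Set V} {x : V} {f : V →ₗ[K] U}

theorem core4 (hE : AGF E) (hx : C1 E x f) {C : Set V} (hC : C ⊆ E) (l₁ l₂ l₃ l₄ : V)
    (h₁ : f l₁ ∈ T E f) (h₂ : f l₂ ∈ T E f) (h₃ : f l₃ ∈ T E f) (h₄ : f l₄ ∈ T E f)
    (hs : l₁ + l₂ + l₃ + l₄ ∈ Submodule.span K C)
    (χ : V →ₗ[K] K) (hχx : χ x = 1) (hχ : ∀ c ∈ C, χ c = 0)
    (ψ₁ ψ₂ ψ₃ : U →ₗ[K] K) (hψ₁ : ∀ c ∈ C, ψ₁ (f c) = 0) (hψ₂ : ∀ c ∈ C, ψ₂ (f c) = 0)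
    (hψ₃ : ∀ c ∈ C, ψ₃ (f c) = 0)
    (h11 : ψ₁ (f l₁) = 1) (h12 : ψ₁ (f l₂) = 0) (h13 : ψ₁ (f l₃) = 0)
    (h21 : ψ₂ (f l₁) = 0) (h22 : ψ₂ (f l₂) = 1) (h23 : ψ₂ (f l₃) = 0)
    (h31 : ψ₃ (f l₁) = 0) (h32 : ψ₃ (f l₂) = 0) (h33 : ψ₃ (f l₃) = 1) : False := by
  have hfx := hx.apply
  have m := fun {l : V} (h : f l ∈ T E f) => hx.mem_T.1 h
  refine hE.cert hC l₁ x (l₁ + l₂) (l₁ + l₃) ![χ, ψ₁ ∘ₗ f, ψ₂ ∘ₗ f, ψ₃ ∘ₗ f] ?_ ?_ ?_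
  · intro i c hc
    fin_cases i
    · exact hχ c hc
    · exact hψ₁ c hc
    · exact hψ₂ c hc
    · exact hψ₃ c hc
  · intro c hc
    have e0 := hc 0
    have e1 := hc 1
    have e2 := hc 2
    have e3 := hc 3
    simp [hfx, h11, h12, h13, h21, h22, h23, h31, h32, h33] at e1 e2 e3
    simp [e2, e3] at e1
    simp [e1, e2, e3, hχx] at e0
    ext i; fin_cases i <;> simp [*]
  · have key : ∀ i : K, ∀ l, f l ∈ T E f → l + i • x ∈ E := by
      intro i l hl
      rcases k01 i with rfl | rfl
      · simpa using (m hl).2.2.1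
      · simpa using (m hl).2.2.2
    intro i j k
    rcases k01 j with rfl | rfl <;> rcases k01 k with rfl | rfl
    · refine ⟨_, key i l₁ h₁, ?_⟩
      simp [aa]
    · refine ⟨_, key i l₃ h₃, ?_⟩
      convert Submodule.zero_mem _ using 1
      have := aa l₁; have := aa l₃; have := aa (i • x)
      simp only [zero_smul, one_smul]
      grind
    · refine ⟨_, key i l₂ h₂, ?_⟩
      convert Submodule.zero_mem _ using 1
      have := aa l₁; have := aa l₂; have := aa (i • x)
      simp only [zero_smul, one_smul]
      grind
    · refine ⟨_, key i l₄ h₄, ?_⟩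
      convert hs using 1
      have := aa l₁; have := aa l₂; have := aa (i • x)
      simp only [zero_smul, one_smul]
      grind

variable {ι : Type} [DecidableEq ι]

theorem lift_fun (hx : C1 E x f) {b : ι → U} (hb : LinearIndependent K b) {l : ι → V}
    (hl : ∀ i, f (l i) = b i) (c : ι → K) : ∃ χ : V →ₗ[K] K, χ x = 1 ∧ ∀ i, χ (l i) = c i := by
  obtain ⟨χ₀, h0⟩ : ∃ χ : V →ₗ[K] K, χ x = 1 := by
    have : LinearIndependent K (fun _ : Unit => x) := by
      rw [linearIndependent_unique_iff]; exact hx.ne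
    obtain ⟨φ, hφ⟩ := exists_functional this (fun _ => 1)
    exact ⟨φ, hφ ()⟩
  obtain ⟨ψ, hψ⟩ := exists_functional hb (fun i => χ₀ (l i) + c i)
  refine ⟨χ₀ + ψ ∘ₗ f, ?_, ?_⟩
  · simp [h0, hx.apply]
  · intro i
    simp [hl, hψ, ← add_assoc, aa]

theorem exists_lift (hx : C1 E x f) (b : ι → U) {A : Finset ι} {p : V} (i₀ : ι) (hi : i₀ ∈ A)
    (hp : f p = wd b A) (l₀ : ι → V) (hl₀ : ∀ i, f (l₀ i) = b i) :
    ∃ l : ι → V, (∀ i, f (l i) = b i) ∧ p = wd l A ∧ ∀ i, i ≠ i₀ → l i = l₀ i := by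
  classical
  have h1 : f p = f (wd l₀ A) := by rw [hp, wd_map]; simp [hl₀]
  rcases hx.eq_iff.1 h1 with h2 | h2
  · exact ⟨l₀, hl₀, h2, fun _ _ => rfl⟩
  · refine ⟨Function.update l₀ i₀ (l₀ i₀ + x), ?_, ?_, ?_⟩
    · intro i
      by_cases h : i = i₀
      · subst h; simp [hl₀, hx.apply]
      · simp [h, hl₀]
    · rw [h2]
      unfold wd
      rw [Finset.sum_update_of_mem hi, ← Finset.sum_erase_add _ _ hi, Finset.sdiff_singleton_eq_erase]
      abel
    · intro i h; simp [h]

theorem exists_lift0 (hx : C1 E x f) (b : ι → U) : ∃ l : ι → V, ∀ i, f (l i) = b i :=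
  ⟨fun i => (hx.surj (b i)).choose, fun i => (hx.surj (b i)).choose_spec⟩

theorem W4 (hE : AGF E) (hx : C1 E x f) {b : ι → U} (hb : LinearIndependent K b)
    (hT : ∀ i, b i ∈ T E f) {A : Finset ι} (hA : 4 ≤ A.card) : wd b A ∉ f '' E := by
  rintro ⟨p, hpE, hp⟩
  obtain ⟨A₄, hA₄, hc⟩ := Finset.exists_subset_card_eq hA
  obtain ⟨i₁, i₂, i₃, i₄, h12, h13, h14, h23, h24, h34, rfl⟩ := Finset.card_eq_four.1 hc
  obtain ⟨l₀, hl₀⟩ := exists_lift0 hx b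
  have hi : i₁ ∈ A := hA₄ (by simp)
  obtain ⟨l, hl, hpl, -⟩ := exists_lift hx b i₁ hi hp l₀ hl₀
  obtain ⟨χ, hχx, hχ⟩ := lift_fun hx hb hl (fun _ => 0)
  set R := A \ {i₁, i₂, i₃, i₄} with hR
  have hsum : ∀ φ : ι → K, ∑ i ∈ A, φ i = φ i₁ + φ i₂ + φ i₃ + φ i₄ + ∑ i ∈ R, φ i := by
    intro φ
    rw [← Finset.sum_sdiff hA₄, ← hR]
    rw [Finset.sum_insert (by simp [*]), Finset.sum_insert (by simp [*]),
      Finset.sum_insert (by simp [*]), Finset.sum_singleton]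
    ring
  have hsumV : p = l i₁ + l i₂ + l i₃ + l i₄ + ∑ i ∈ R, l i := by
    rw [hpl, wd, ← Finset.sum_sdiff hA₄, ← hR]
    rw [Finset.sum_insert (by simp [*]), Finset.sum_insert (by simp [*]),
      Finset.sum_insert (by simp [*]), Finset.sum_singleton]
    abel
  have lE : ∀ i, l i ∈ E := fun i => (hT i).2 _ (hl i)
  have hψ : ∀ j, j ≠ i₄ → j ∈ ({i₁, i₂, i₃, i₄} : Finset ι) → ∃ ψ : U →ₗ[K] K,
      ∀ i, ψ (b i) = if i = j ∨ i = i₄ then 1 else 0 := fun j _ _ => exists_functional hb _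
  obtain ⟨ψ₁, hψ₁⟩ := hψ i₁ h14 (by simp)
  obtain ⟨ψ₂, hψ₂⟩ := hψ i₂ h24 (by simp)
  obtain ⟨ψ₃, hψ₃⟩ := hψ i₃ h34 (by simp)
  have van : ∀ ψ : U →ₗ[K] K, ∀ j ∈ ({i₁, i₂, i₃} : Finset ι),
      (∀ i, ψ (b i) = if i = j ∨ i = i₄ then 1 else 0) →
      ∀ c ∈ insert p (l '' (R : Set ι)), ψ (f c) = 0 := by
    intro ψ j hj hψ c hc
    have hRz : ∀ i ∈ R, ψ (b i) = 0 := by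
      intro i hi
      rw [hψ, if_neg]
      simp only [hR, Finset.mem_sdiff, Finset.mem_insert, Finset.mem_singleton, not_or] at hi hj
      rintro (rfl | rfl)
      · tauto
      · tauto
    rcases hc with rfl | ⟨i, hi, rfl⟩
    · rw [hp, wd, map_sum, hsum (fun i => ψ (b i)), Finset.sum_eq_zero hRz]
      simp only [hψ]
      simp only [Finset.mem_insert, Finset.mem_singleton] at hj
      rcases hj with rfl | rfl | rfl
      · simp [h12.symm, h13.symm, h24, h34]; decide
      · simp [h12, h14, h23.symm, h34]; decide
      · simp [h13, h14, h23, h24]; decide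
    · rw [hl]; exact hRz i hi
  refine core4 hE hx (C := insert p (l '' (R : Set ι))) ?_ (l i₁) (l i₂) (l i₃) (l i₄)
    (by rw [hl]; exact hT _) (by rw [hl]; exact hT _) (by rw [hl]; exact hT _)
    (by rw [hl]; exact hT _) ?_ χ hχx ?_ ψ₁ ψ₂ ψ₃ (van ψ₁ i₁ (by simp) hψ₁)
    (van ψ₂ i₂ (by simp) hψ₂) (van ψ₃ i₃ (by simp) hψ₃) ?_ ?_ ?_ ?_ ?_ ?_ ?_ ?_ ?_
  · rintro _ (rfl | ⟨i, _, rfl⟩)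
    · exact hpE
    · exact lE i
  · have h1 : l i₁ + l i₂ + l i₃ + l i₄ = p + ∑ i ∈ R, l i := by
      rw [hsumV, add_assoc _ (∑ i ∈ R, l i), aa, add_zero]
    rw [h1]
    refine Submodule.add_mem _ (Submodule.subset_span (Or.inl rfl)) (Submodule.sum_mem _ ?_)
    intro i hi
    exact Submodule.subset_span (Or.inr ⟨i, hi, rfl⟩)
  · rintro _ (rfl | ⟨i, _, rfl⟩)
    · rw [hpl, wd, map_sum]; simp [hχ]
    · exact hχ i
  all_goals simp [hl, hψ₁, hψ₂, hψ₃, *, Ne.symm h12, Ne.symm h13, Ne.symm h23]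

theorem W3 (hE : AGF E) (hx : C1 E x f) {b : ι → U} (hb : LinearIndependent K b)
    (hT : ∀ i, b i ∈ T E f) {A : Finset ι} (hA : A.card = 3) : wd b A ∉ T E f := by
  intro hp
  obtain ⟨i₁, i₂, i₃, h12, h13, h23, rfl⟩ := Finset.card_eq_three.1 hA
  obtain ⟨l, hl⟩ := exists_lift0 hx b
  obtain ⟨χ, hχx, hχ⟩ := lift_fun hx hb hl (fun _ => 0)
  obtain ⟨ψ₁, hψ₁⟩ := exists_functional hb (fun i => if i = i₁ then 1 else 0)
  obtain ⟨ψ₂, hψ₂⟩ := exists_functional hb (fun i => if i = i₂ then 1 else 0)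
  obtain ⟨ψ₃, hψ₃⟩ := exists_functional hb (fun i => if i = i₃ then 1 else 0)
  refine core4 hE hx (C := ∅) (empty_subset _) (l i₁) (l i₂) (l i₃) (l i₁ + l i₂ + l i₃)
    (by rw [hl]; exact hT _) (by rw [hl]; exact hT _) (by rw [hl]; exact hT _)
    ?_ ?_ χ hχx (by simp) ψ₁ ψ₂ ψ₃ (by simp) (by simp) (by simp) ?_ ?_ ?_ ?_ ?_ ?_ ?_ ?_ ?_
  · simp only [map_add, hl]
    rw [wd_insert _ (by simp [*]), wd_insert _ (by simp [*]), wd_single, ← add_assoc] at hp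
    exact hp
  · rw [aa]; exact Submodule.zero_mem _
  all_goals simp [hl, hψ₁, hψ₂, hψ₃, *, Ne.symm h12, Ne.symm h13, Ne.symm h23]

theorem Meet (hE : AGF E) (hx : C1 E x f) {b : ι → U} (hb : LinearIndependent K b)
    (hT : ∀ i, b i ∈ T E f) {i₁ i₂ i₃ i₄ i₅ : ι} (hA : [i₁, i₂, i₃, i₄, i₅].Nodup)
    (hp : b i₁ + b i₂ + b i₃ ∈ f '' E) (hq : b i₁ + b i₄ + b i₅ ∈ f '' E) : False := by
  simp only [List.nodup_cons, List.mem_cons, not_or, List.not_mem_nil, not_false_eq_true,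
    List.nodup_nil, and_true] at hA
  obtain ⟨⟨h12, h13, h14, h15⟩, ⟨h23, h24, h25⟩, ⟨h34, h35⟩, h45⟩ := hA
  obtain ⟨p, hpE, hp⟩ := hp
  obtain ⟨q, hqE, hq⟩ := hq
  obtain ⟨l₀, hl₀⟩ := exists_lift0 hx b
  have hw : ∀ {j k : ι} {W : Type} [AddCommGroup W] [Module K W] (b : ι → W), i₁ ≠ j → i₁ ≠ k →
      j ≠ k → wd b {i₁, j, k} = b i₁ + b j + b k := by
    intro j k W _ _ b h1 h2 h3
    rw [wd_insert _ (by simp [*]), wd_insert _ (by simp [*]), wd_single, ← add_assoc]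
  obtain ⟨l', hl', hpl', hu'⟩ := exists_lift hx b (A := {i₁, i₂, i₃}) i₂ (by simp)
    (by rw [hp, hw b h12 h13 h23]) l₀ hl₀
  obtain ⟨l, hl, hql, hu⟩ := exists_lift hx b (A := {i₁, i₄, i₅}) i₄ (by simp)
    (by rw [hq, hw b h14 h15 h45]) l' hl'
  rw [hw _ h12 h13 h23, ← hu i₁ (by assumption), ← hu i₂ (by assumption),
    ← hu i₃ (by assumption)] at hpl'
  rw [hw _ h14 h15 h45] at hql
  obtain ⟨χ, hχx, hχ⟩ := lift_fun hx hb hl (fun _ => 0)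
  obtain ⟨ψ₁, hψ₁⟩ := exists_functional hb (fun i => if i = i₂ ∨ i = i₁ ∨ i = i₅ then 1 else 0)
  obtain ⟨ψ₂, hψ₂⟩ := exists_functional hb (fun i => if i = i₃ ∨ i = i₁ ∨ i = i₅ then 1 else 0)
  obtain ⟨ψ₃, hψ₃⟩ := exists_functional hb (fun i => if i = i₄ ∨ i = i₅ then 1 else 0)
  refine core4 hE hx (C := {p, q}) ?_ (l i₂) (l i₃) (l i₄) (l i₅)
    (by rw [hl]; exact hT _) (by rw [hl]; exact hT _) (by rw [hl]; exact hT _)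
    (by rw [hl]; exact hT _) ?_ χ hχx ?_ ψ₁ ψ₂ ψ₃ ?_ ?_ ?_ ?_ ?_ ?_ ?_ ?_ ?_ ?_ ?_ ?_
  · rintro _ (rfl | rfl) <;> assumption
  · have : l i₂ + l i₃ + l i₄ + l i₅ = p + q := by
      rw [hpl', hql]
      simp only [add_assoc, add_comm, add_left_comm, aa, aab, add_zero, zero_add]
    rw [this]
    exact Submodule.add_mem _ (Submodule.subset_span (by simp)) (Submodule.subset_span (by simp))
  · rintro _ (rfl | rfl)
    · rw [hpl']; simp [hχ]
    · rw [hql]; simp [hχ]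
  · rintro _ (rfl | rfl)
    · rw [hp]; simp [hψ₁, h12, h13, h23, h35, Ne.symm h12, Ne.symm h13, Ne.symm h23]; 
      try decide
    · rw [hq]; simp [hψ₁, h12, h15, h24, h25, h45, Ne.symm h12, Ne.symm h14, Ne.symm h24, Ne.symm h25, Ne.symm h15]
      try decide
  · rintro _ (rfl | rfl)
    · rw [hp]; simp [hψ₂, h12, h13, h23, h35, h25, Ne.symm h12, Ne.symm h13, Ne.symm h23]; try decide
    · rw [hq]; simp [hψ₂, h12, h13, h15, h24, h25, h45, Ne.symm h12, Ne.symm h14, Ne.symm h24, Ne.symm h25, Ne.symm h15, Ne.symm h34]; try decide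
  · rintro _ (rfl | rfl)
    · rw [hp]; simp [hψ₃, h12, h13, h23, h35, h25, h14, h15, h24, h34]
    · rw [hq]; simp [hψ₃, h14, h15]; try decide
  all_goals simp [hl, hψ₁, hψ₂, hψ₃, *, Ne.symm h12, Ne.symm h13, Ne.symm h23, Ne.symm h14, Ne.symm h24, Ne.symm h34]

end w4
end NR

namespace NR

section gen
variable {V U X : Type} [AddCommGroup V] [Module K V] [AddCommGroup U] [Module K U]
  [AddCommGroup X] [Module K X]

theorem finrank_map_ker [Finite V] (f : V →ₗ[K] U) (P : Submodule K V) :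
    Module.finrank K (P.map f) + Module.finrank K (P ⊓ LinearMap.ker f : Submodule K V)
      = Module.finrank K P := by
  have h := LinearMap.finrank_range_add_finrank_ker (f.domRestrict P)
  rw [LinearMap.range_domRestrict, LinearMap.ker_domRestrict] at h
  rw [← h]
  congr 1
  rw [← Submodule.map_comap_subtype]
  exact Submodule.finrank_map_subtype_eq P (Submodule.comap P.subtype f.ker)

theorem ncard_sub [Finite V] (P : Submodule K V) :
    (P : Set V).ncard = 2 ^ Module.finrank K P := by
  have h := Module.natCard_eq_pow_finrank (K := K) (V := P)
  rw [Nat.card_eq_fintype_card (α := K), ZMod.card] at h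
  rw [← h]; rfl

theorem C1.finrank_comap [Finite V] {E : Set V} {x : V} {f : V →ₗ[K] U} (h : C1 E x f)
    (S : Submodule K U) : Module.finrank K (S.comap f) = Module.finrank K S + 1 := by
  have h1 := finrank_map_ker f (S.comap f)
  have h2 : S.comap f ⊓ LinearMap.ker f = LinearMap.ker f :=
    inf_eq_right.2 (LinearMap.ker_le_comap f)
  rw [Submodule.map_comap_eq_of_surjective h.surj, h2, h.ker, finrank_span_singleton h.ne] at h1
  exact h1.symm

theorem C1.map_inj {E : Set V} {x : V} {f : V →ₗ[K] U} (h : C1 E x f)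
    {P : Submodule K V} (hP : x ∉ P) : P ⊓ LinearMap.ker f = ⊥ := by
  rw [eq_bot_iff]
  rintro v ⟨h1, h2⟩
  rcases h.eq_zero_iff.1 h2 with rfl | rfl
  · exact Submodule.zero_mem _
  · exact absurd h1 hP

theorem C1.finrank_map [Finite V] {E : Set V} {x : V} {f : V →ₗ[K] U} (h : C1 E x f)
    {P : Submodule K V} (hP : x ∉ P) : Module.finrank K (P.map f) = Module.finrank K P := by
  have h1 := finrank_map_ker f P
  rw [h.map_inj hP, finrank_bot] at h1
  exact h1

theorem C1.finrank_map' [Finite V] {E : Set V} {x : V} {f : V →ₗ[K] U} (h : C1 E x f)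
    {P : Submodule K V} (hP : x ∈ P) : Module.finrank K (P.map f) + 1 = Module.finrank K P := by
  have h1 := finrank_map_ker f P
  have h2 : P ⊓ LinearMap.ker f = LinearMap.ker f := by
    rw [h.ker]; apply inf_eq_right.2; rw [Submodule.span_le]; simpa using hP
  rw [h2, h.ker, finrank_span_singleton h.ne] at h1
  exact h1

theorem IsPlane.map [Finite V] {E : Set V} {x : V} {f : V →ₗ[K] U} (h : C1 E x f)
    {P : Submodule K V} (hP : IsPlane E P) (hx : x ∉ P) : IsPlane (f '' E) (P.map f) := by
  refine ⟨by rw [h.finrank_map hx, hP.1], ?_⟩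
  rw [Submodule.map_coe]
  exact image_mono hP.2

theorem IsPlane.ncard [Finite V] {E : Set V} {P : Submodule K V} (hP : IsPlane E P) :
    (P : Set V).ncard = 8 := by rw [ncard_sub, hP.1]; rfl

theorem Cube.mono {E E' : Set V} (h : E ⊆ E') : Cube E → Cube E' := by
  rintro ⟨g, hg, h1⟩; exact ⟨g, hg, fun x hx => h (h1 x hx)⟩

theorem AGF.mono {E E' : Set V} (h : E ⊆ E') (hE : AGF E') : AGF E := by
  intro U _ _ f hf hc
  obtain ⟨C, hC, hk⟩ := hf.ker
  exact hE U f ⟨hf.surj, C, hC.trans h, hk⟩ (hc.mono (image_mono h))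

theorem AGF.comap {E : Set V} (hE : AGF E) (j : U →ₗ[K] V) (hj : Function.Injective j) :
    AGF (j ⁻¹' E) := by
  intro X _ _ f hf hc
  obtain ⟨C, hC, hk⟩ := hf.ker
  have hC' : j '' C ⊆ E := by rintro _ ⟨c, hc, rfl⟩; exact hC hc
  apply hE _ _ (isContr_mkQ hC')
  set Q := (Submodule.span K (j '' C)).mkQ
  have hQ : LinearMap.ker (Q ∘ₗ j) = LinearMap.ker f := by
    rw [LinearMap.ker_comp, Submodule.ker_mkQ, hk, ← Submodule.map_span,
      Submodule.comap_map_eq_of_injective hj]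
  have key : ∃ h : X →ₗ[K] (V ⧸ Submodule.span K (j '' C)), Function.Injective h ∧
      ∀ v, h (f v) = Q (j v) := by
    refine ⟨(LinearMap.ker f).liftQ (Q ∘ₗ j) hQ.ge ∘ₗ
      (LinearMap.quotKerEquivOfSurjective f hf.surj).symm.toLinearMap, ?_, ?_⟩
    · rw [LinearMap.coe_comp]
      refine Function.Injective.comp ?_ (LinearEquiv.injective _)
      rw [← LinearMap.ker_eq_bot, Submodule.ker_liftQ_eq_bot]
      exact hQ.le
    · intro v
      have : (LinearMap.quotKerEquivOfSurjective f hf.surj).symm (f v)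
          = Submodule.Quotient.mk v := by
        rw [LinearEquiv.symm_apply_eq]; rfl
      simp [this]
  obtain ⟨h, hi, hh⟩ := key
  obtain ⟨g, hg, h1⟩ := hc
  refine ⟨h ∘ₗ g, hi.comp hg, fun x hx => ?_⟩
  obtain ⟨v, hv, hv'⟩ := h1 x hx
  refine ⟨j v, hv, ?_⟩
  rw [LinearMap.comp_apply, ← hv', hh]

theorem cube_of_LI {E : Set V} {a u v w : V} (h : LinearIndependent K ![a, u, v, w])
    (hE : ∀ i j k : K, a + i • u + j • v + k • w ∈ E) : Cube E := by
  refine ⟨Fintype.linearCombination K ![a, u, v, w], ?_, ?_⟩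
  · rw [← LinearMap.ker_eq_bot]
    exact Fintype.linearIndependent_iff'.1 h
  · intro x hx
    rw [Fintype.linearCombination_apply, Fin.sum_univ_four]
    simpa [hx] using hE (x 1) (x 2) (x 3)

theorem AGF.not_cube {E : Set V} (h : AGF E) : ¬ Cube E := by
  have := h V LinearMap.id (isContr_id E)
  simpa using this

/-- In rank four, the complement of `E` is not contained in a hyperplane. -/
theorem rank4 [Finite V] (hV : Module.finrank K V = 4) {E : Set V} (hE : AGF E)
    (φ : V →ₗ[K] K) (hφ : φ ≠ 0) : ∃ v, φ v = 1 ∧ v ∉ E := by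
  by_contra hcon
  push Not at hcon
  apply hE.not_cube
  obtain ⟨a, ha⟩ : ∃ a, φ a = 1 := by
    by_contra h
    push Not at h
    exact hφ (LinearMap.ext fun v => kne1 (h v))
  have hker : Module.finrank K (LinearMap.ker φ) = 3 := by
    have h1 := LinearMap.finrank_range_add_finrank_ker φ
    have h2 : LinearMap.range φ = ⊤ := by
      rw [LinearMap.range_eq_top]; intro c
      exact ⟨c • a, by simp [ha]⟩
    rw [h2, finrank_top, Module.finrank_self, hV] at h1
    omega
  let b := Module.finBasisOfFinrankEq K (LinearMap.ker φ) hker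
  have hb : ∀ i, φ (b i) = 0 := fun i => (b i).2
  refine cube_of_LI (a := a) (u := b 0) (v := b 1) (w := b 2) ?_ ?_
  · rw [Fintype.linearIndependent_iff]
    intro c hc
    rw [Fin.sum_univ_four] at hc
    simp only [Matrix.cons_val] at hc
    have h0 := congrArg φ hc
    simp [hb, ha] at h0
    rw [h0, zero_smul, zero_add] at hc
    have := Fintype.linearIndependent_iff.1 b.linearIndependent ![c 1, c 2, c 3] (by
      apply Subtype.ext
      rw [Fin.sum_univ_three]
      simpa using hc)
    have e1 := this 0
    have e2 := this 1
    have e3 := this 2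
    intro i; fin_cases i
    · exact h0
    · exact e1
    · exact e2
    · exact e3
  · intro i j k
    apply hcon
    simp [ha, hb]

theorem rank4_basis [Finite V] (hV : Module.finrank K V = 4) {E : Set V} (hE : AGF E) :
    ∃ b : Module.Basis (Fin 4) K V, ∀ i, b i ∉ E := by
  have hs : Submodule.span K Eᶜ = ⊤ := by
    by_contra h
    obtain ⟨φ, hφ, hle⟩ := Submodule.exists_le_ker_of_lt_top _ (lt_top_iff_ne_top.2 h)
    obtain ⟨v, hv, hv'⟩ := rank4 hV hE φ hφ
    have := hle (Submodule.subset_span hv')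
    rw [LinearMap.mem_ker, hv] at this
    exact one_ne_zero this
  obtain ⟨B, hB, hsp, hLI⟩ := exists_linearIndependent K Eᶜ
  let b0 := Module.Basis.mk hLI (by rw [Subtype.range_val, hsp, hs])
  have : Fintype B := Fintype.ofFinite B
  have hc : Fintype.card B = 4 := by rw [← hV, Module.finrank_eq_card_basis b0]
  refine ⟨b0.reindex (Fintype.equivFinOfCardEq hc), fun i => ?_⟩
  rw [Module.Basis.reindex_apply, Module.Basis.mk_apply]
  exact hB (Subtype.property _)

theorem rank4_le [Finite V] (hV : Module.finrank K V = 4) {E : Set V} (hE : AGF E) :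
    E.ncard ≤ 12 := by
  obtain ⟨b, hb⟩ := rank4_basis hV hE
  have h1 : (range b).ncard = 4 := by
    rw [← image_univ, ncard_image_of_injective _ b.injective, ncard_univ, Nat.card_eq_fintype_card,
      Fintype.card_fin]
  have h2 : (range b).ncard ≤ Eᶜ.ncard := by
    apply ncard_le_ncard _ (toFinite _)
    rintro _ ⟨i, rfl⟩; exact hb i
  have h3 := ncard_add_ncard_compl E
  have h4 := ncard_sub (⊤ : Submodule K V)
  rw [finrank_top, hV, Submodule.top_coe, ncard_univ] at h4
  omega

theorem rank4_plane [Finite V] (hV : Module.finrank K V = 4) {E : Set V} (hE : AGF E)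
    (h12 : 12 ≤ E.ncard) : ∃ P, IsPlane E P := by
  obtain ⟨b, hb⟩ := rank4_basis hV hE
  have h1 : (range b).ncard = 4 := by
    rw [← image_univ, ncard_image_of_injective _ b.injective, ncard_univ, Nat.card_eq_fintype_card,
      Fintype.card_fin]
  have h2 : range b ⊆ Eᶜ := by
    rintro _ ⟨i, rfl⟩; exact hb i
  have h3 := ncard_add_ncard_compl E
  have h4 := ncard_sub (⊤ : Submodule K V)
  rw [finrank_top, hV, Submodule.top_coe, ncard_univ] at h4
  have h5 : range b = Eᶜ := eq_of_subset_of_ncard_le h2 (by omega) (toFinite _)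
  obtain ⟨φ, hφ⟩ := exists_functional b.linearIndependent (fun _ => (1 : K))
  refine ⟨LinearMap.ker φ, ?_, ?_⟩
  · have h1 := LinearMap.finrank_range_add_finrank_ker φ
    have h2 : LinearMap.range φ = ⊤ := by
      rw [LinearMap.range_eq_top]; intro c
      exact ⟨c • b 0, by simp [hφ]⟩
    rw [h2, finrank_top, Module.finrank_self, hV] at h1
    omega
  · intro v hv
    by_contra h
    have : v ∈ range b := by rw [h5]; exact h
    obtain ⟨i, rfl⟩ := this
    have hv : φ (b i) = 0 := hv
    rw [hφ] at hv
    exact one_ne_zero hv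

theorem IsPlane.finite {E : Set V} {P : Submodule K V} (hP : IsPlane E P) : Module.Finite K P :=
  Module.finite_of_finrank_pos (by rw [hP.1]; norm_num)

/-- Two distinct planes share at most a point. -/
theorem planes_meet [Finite V] {E : Set V} (hE : AGF E) {P Q : Submodule K V} (hP : IsPlane E P)
    (hQ : IsPlane E Q) (hne : P ≠ Q) : Module.finrank K (P ⊓ Q : Submodule K V) ≤ 1 := by
  by_contra hcon
  push Not at hcon
  have hab : ∀ {P Q : Submodule K V}, IsPlane E P → IsPlane E Q → P ≠ Q → ∃ a ∈ P, a ∉ Q := by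
    intro P Q hP hQ hne
    by_contra h
    push Not at h
    exact hne (Submodule.eq_of_le_of_finrank_le h (by rw [hP.1, hQ.1]))
  obtain ⟨a, haP, haQ⟩ := hab hP hQ hne
  obtain ⟨b, hbQ, hbP⟩ := hab hQ hP hne.symm
  have h4 : 2 < ((P ⊓ Q : Submodule K V) : Set V).ncard := by
    rw [ncard_sub]
    calc 2 < 2 ^ 2 := by norm_num
      _ ≤ _ := Nat.pow_le_pow_right (by norm_num) hcon
  obtain ⟨l, hl, hl0⟩ : ∃ l ∈ (P ⊓ Q : Submodule K V), l ≠ 0 := by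
    by_contra h
    push Not at h
    have : ((P ⊓ Q : Submodule K V) : Set V) ⊆ {0} := h
    have := ncard_le_ncard this
    rw [ncard_singleton] at this; omega
  obtain ⟨m, hm, hm0, hml⟩ : ∃ l' ∈ (P ⊓ Q : Submodule K V), l' ≠ 0 ∧ l' ≠ l := by
    by_contra h
    push Not at h
    have h6 : ((P ⊓ Q : Submodule K V) : Set V) ⊆ {0, l} := by
      intro l' h'
      by_cases h5 : l' = 0
      · left; exact h5
      · right; exact h l' h' h5
    have := ncard_le_ncard h6
    have := ncard_insert_le (0:V) {l}
    rw [ncard_singleton] at this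
    omega
  have hin : ∀ i j : K, i • l + j • m ∈ P ∧ i • l + j • m ∈ Q := fun i j =>
    ⟨P.add_mem (P.smul_mem _ hl.1) (P.smul_mem _ hm.1),
      Q.add_mem (Q.smul_mem _ hl.2) (Q.smul_mem _ hm.2)⟩
  apply hE.not_cube
  refine cube_of_LI (a := a) (u := l) (v := m) (w := a + b) ?_ ?_
  · rw [Fintype.linearIndependent_iff]
    intro c hc
    rw [Fin.sum_univ_four] at hc
    simp only [Matrix.cons_val] at hc
    have h3 : c 3 = 0 := by
      by_contra h
      rw [kne h] at hc
      have : b = c 0 • a + (c 1 • l + c 2 • m) + a := by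
        have := aa b
        rw [one_smul] at hc
        grind
      exact hbP (this ▸ P.add_mem (P.add_mem (P.smul_mem _ haP) (hin _ _).1) haP)
    rw [h3, zero_smul, add_zero] at hc
    have h0 : c 0 = 0 := by
      by_contra h
      rw [kne h, one_smul, add_assoc] at hc
      rw [eq_of_add hc] at haQ
      exact haQ (hin _ _).2
    rw [h0, zero_smul, zero_add] at hc
    have h1 : c 1 = 0 := by
      by_contra h
      rw [kne h, one_smul] at hc
      rcases k01 (c 2) with h2 | h2
      · simp [h2] at hc; exact hl0 hc
      · rw [h2, one_smul] at hc; exact hml (eq_of_add hc).symm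
    rw [h1, zero_smul, zero_add] at hc
    have h2 : c 2 = 0 := (smul_eq_zero.1 hc).resolve_right hm0
    intro i; fin_cases i <;> assumption
  · intro i j k
    rcases k01 k with rfl | rfl
    · rw [zero_smul, add_zero, add_assoc]
      exact hP.2 (P.add_mem haP (hin i j).1)
    · have : a + i • l + j • m + (1:K) • (a + b) = b + (i • l + j • m) := by
        have := aa a
        rw [one_smul]; grind
      rw [this]
      exact hQ.2 (Q.add_mem hbQ (hin i j).2)

theorem exists_ne_zero {P : Submodule K V} (h : 0 < Module.finrank K P) : ∃ e ∈ P, e ≠ 0 := by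
  by_contra hcon
  push Not at hcon
  have : P = ⊥ := by rw [eq_bot_iff]; intro v hv; exact hcon v hv
  rw [this, finrank_bot] at h
  exact lt_irrefl _ h

/-- If two planes share exactly one point then their span contains no other point. -/
theorem planes_span [Finite V] {E : Set V} (hE : AGF E) {P Q : Submodule K V} (hP : IsPlane E P)
    (hQ : IsPlane E Q) (hPQ : Module.finrank K (P ⊓ Q : Submodule K V) = 1) {z : V} (hz : z ∈ E)
    (hzs : z ∈ P ⊔ Q) : z ∈ P ∨ z ∈ Q := by
  by_contra hcon
  push Not at hcon
  obtain ⟨hzP, hzQ⟩ := hcon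
  have hz0 : z ≠ 0 := by rintro rfl; exact hzP P.zero_mem
  have hc := c1_mkQ (E := E) hz hz0
  set f := (Submodule.span K {z}).mkQ
  have h5 : Module.finrank K (P ⊔ Q : Submodule K V) = 5 := by
    have := Submodule.finrank_sup_add_finrank_inf_eq P Q
    rw [hPQ, hP.1, hQ.1] at this; omega
  have hsup : Module.finrank K ((P ⊔ Q).map f) + 1 = 5 := by
    rw [hc.finrank_map' hzs, h5]
  rw [Submodule.map_sup] at hsup
  have hP' := hP.map hc hzP
  have hQ' := hQ.map hc hzQ
  have h6 := Submodule.finrank_sup_add_finrank_inf_eq (P.map f) (Q.map f)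
  rw [hP'.1, hQ'.1] at h6
  have hne : P.map f ≠ Q.map f := by
    intro h
    rw [← h, sup_idem, hP'.1] at hsup
    omega
  have : Finite (V ⧸ Submodule.span K {z}) := Finite.of_surjective f hc.surj
  have := planes_meet (hE.map hc.contr) hP' hQ' hne
  omega

end gen

section lines
variable {V U X : Type} [AddCommGroup V] [Module K V] [AddCommGroup U] [Module K U]
  [AddCommGroup X] [Module K X]
variable {E : Set V} {x : V} {f : V →ₗ[K] U}

theorem finrank_pair {u v : U} (hu : u ≠ 0) (hv : v ≠ 0) (huv : u ≠ v) :
    Module.finrank K (Submodule.span K ({u, v} : Set U)) = 2 := by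
  have hLI : LinearIndependent K ![u, v] := by
    rw [LinearIndependent.pair_iff]
    intro s t h
    rcases k01 s with rfl | rfl <;> rcases k01 t with rfl | rfl
    · simp
    · simp at h; exact absurd h hv
    · simp at h; exact absurd h hu
    · simp at h; exact absurd (eq_of_add h) huv
  have := finrank_span_eq_card hLI
  rwa [Matrix.range_cons, Matrix.range_cons, Matrix.range_empty, union_empty,
    singleton_union] at this

theorem plane_of_line [Finite V] (hx : C1 E x f) (h0 : (0:V) ∈ E) {u v : U} (hu : u ∈ T E f)
    (hv : v ∈ T E f) (huv : u ≠ v) (hs : u + v ∈ T E f) :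
    IsPlane E ((Submodule.span K ({u, v} : Set U)).comap f) := by
  refine ⟨?_, ?_⟩
  · rw [hx.finrank_comap, finrank_pair hu.1 hv.1 huv]
  · intro e he
    rcases span_pair_mem (Submodule.mem_comap.1 he) with h | h | h | h
    · rcases hx.eq_zero_iff.1 h with rfl | rfl
      · exact h0
      · exact hx.mem
    · exact hu.2 _ h
    · exact hv.2 _ h
    · exact hs.2 _ h

theorem T_struct [Finite V] (hE : AGF E) (hx : C1 E x f) : ∃ B ⊆ T E f,
    Submodule.span K B = Submodule.span K (T E f) ∧ LinearIndependent K ((↑) : B → U) ∧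
    ∀ t ∈ T E f, t ∉ B → ∃ u ∈ B, ∃ v ∈ B, u ≠ v ∧ t = u + v := by
  classical
  obtain ⟨B, hB, hs, hLI⟩ := exists_linearIndependent K (T E f)
  refine ⟨B, hB, hs, hLI, fun t ht htB => ?_⟩
  have h1 : t ∈ Submodule.span K (range ((↑) : B → U)) := by
    rw [Subtype.range_val, hs]; exact Submodule.subset_span ht
  obtain ⟨A, hA⟩ := exists_wd h1
  have hT : ∀ i : B, (i : U) ∈ T E f := fun i => hB i.2
  have c4 : A.card < 4 := by
    by_contra h
    push Not at h
    exact W4 hE hx hLI hT h (hA ▸ T_subset hx.surj ht)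
  have c3 : A.card ≠ 3 := fun h => W3 hE hx hLI hT h (hA ▸ ht)
  have c0 : A.card ≠ 0 := by
    intro h; rw [Finset.card_eq_zero] at h; subst h; simp at hA; exact ht.1 hA
  have c1 : A.card ≠ 1 := by
    intro h; obtain ⟨i, rfl⟩ := Finset.card_eq_one.1 h
    rw [wd_single] at hA; exact htB (hA ▸ i.2)
  have c2 : A.card = 2 := by omega
  obtain ⟨i, j, hij, rfl⟩ := Finset.card_eq_two.1 c2
  refine ⟨i, i.2, j, j.2, fun h => hij (Subtype.ext h), ?_⟩
  rw [hA, wd_insert _ (by simpa using hij), wd_single]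

theorem T_LI [Finite V] (hE : AGF E) (hx : C1 E x f) (h0 : (0:V) ∈ E)
    (hk : ∀ P, IsPlane E P → x ∉ P) : LinearIndependent K ((↑) : T E f → U) := by
  obtain ⟨B, hB, hs, hLI, h⟩ := T_struct hE hx
  have : B = T E f := by
    refine hB.antisymm fun t ht => ?_
    by_contra htB
    obtain ⟨u, hu, v, hv, huv, rfl⟩ := h t ht htB
    refine hk _ (plane_of_line hx h0 (hB hu) (hB hv) huv ht) ?_
    rw [Submodule.mem_comap, hx.apply]; exact Submodule.zero_mem _
  rw [← this]; exact hLI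

theorem ncard_LI [Finite U] {B : Set U} (hLI : LinearIndependent K ((↑) : B → U)) :
    B.ncard = Module.finrank K (Submodule.span K B) := by
  have : Fintype B := Fintype.ofFinite B
  have h := finrank_span_eq_card hLI
  rw [Subtype.range_val] at h
  rw [h, ← Nat.card_eq_fintype_card]; rfl

theorem lines_bound [Finite V] (hE : AGF E) (hx : C1 E x f) (h0 : (0:V) ∈ E) :
    (T E f).ncard ≤ Module.finrank K (Submodule.span K (T E f)) +
      {P | IsPlane E P ∧ x ∈ P}.ncard := by
  classical
  have hU : Finite U := Finite.of_surjective f hx.surj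
  obtain ⟨B, hB, hs, hLI, h⟩ := T_struct hE hx
  rw [← hs, ← ncard_LI hLI]
  have h1 := ncard_sdiff_add_ncard_of_subset hB
  have h2 : (T E f \ B).ncard ≤ {P | IsPlane E P ∧ x ∈ P}.ncard := by
    have : ∀ t : U, ∃ P : Submodule K U, t ∈ T E f \ B → ∃ u ∈ B, ∃ v ∈ B, u ≠ v ∧ t = u + v ∧
        P = Submodule.span K {u, v} := by
      intro t
      by_cases ht : t ∈ T E f \ B
      · obtain ⟨u, hu, v, hv, huv, h3⟩ := h t ht.1 ht.2
        exact ⟨_, fun _ => ⟨u, hu, v, hv, huv, h3, rfl⟩⟩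
      · exact ⟨⊥, fun h => absurd h ht⟩
    choose g hg using this
    have hfin : Finite (Submodule K V) := Finite.of_injective (fun P => (P : Set V)) SetLike.coe_injective
    refine ncard_le_ncard_of_injOn (fun t => (g t).comap f) ?_ ?_ (toFinite _)
    · intro t ht
      obtain ⟨u, hu, v, hv, huv, rfl, hP⟩ := hg t ht
      simp only [hP]
      refine ⟨plane_of_line hx h0 (hB hu) (hB hv) huv ht.1, ?_⟩
      rw [Submodule.mem_comap, hx.apply]; exact Submodule.zero_mem _
    · intro t ht t' ht' heq
      have heq := Submodule.comap_injective_of_surjective hx.surj heq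
      obtain ⟨u, hu, v, hv, huv, h3, hP⟩ := hg t ht
      obtain ⟨u', hu', v', hv', huv', h3', hP'⟩ := hg t' ht'
      have hmem : t' ∈ Submodule.span K {u, v} := by
        rw [← hP, heq, hP', h3']
        exact Submodule.add_mem _ (Submodule.subset_span (by simp)) (Submodule.subset_span (by simp))
      rcases span_pair_mem hmem with h | h | h | h
      · exact absurd h ht'.1.1
      · exact absurd (h ▸ hu) ht'.2
      · exact absurd (h ▸ hv) ht'.2
      · rw [h3, h]
  omega

end lines
end NR

namespace NR

section full
variable {V U X : Type} [AddCommGroup V] [Module K V] [AddCommGroup U] [Module K U]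
  [AddCommGroup X] [Module K X]
variable {E : Set V} {x : V} {f : V →ₗ[K] U}

theorem core4' (hE : AGF E) (hfx : f x = 0) {C : Set V} (hC : C ⊆ E) (l₁ l₂ l₃ l₄ : V)
    (h : ∀ l ∈ ({l₁, l₂, l₃, l₄} : Set V), ∀ i : K, ∃ e ∈ E, l + i • x + e ∈ Submodule.span K C)
    (hs : l₁ + l₂ + l₃ + l₄ = 0)
    (χ : V →ₗ[K] K) (hχx : χ x = 1) (hχ : ∀ c ∈ C, χ c = 0)
    (ψ₁ ψ₂ ψ₃ : U →ₗ[K] K) (hψ₁ : ∀ c ∈ C, ψ₁ (f c) = 0) (hψ₂ : ∀ c ∈ C, ψ₂ (f c) = 0)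
    (hψ₃ : ∀ c ∈ C, ψ₃ (f c) = 0)
    (h11 : ψ₁ (f l₁) = 1) (h12 : ψ₁ (f l₂) = 0) (h13 : ψ₁ (f l₃) = 0)
    (h21 : ψ₂ (f l₁) = 0) (h22 : ψ₂ (f l₂) = 1) (h23 : ψ₂ (f l₃) = 0)
    (h31 : ψ₃ (f l₁) = 0) (h32 : ψ₃ (f l₂) = 0) (h33 : ψ₃ (f l₃) = 1) : False := by
  refine hE.cert hC l₁ x (l₁ + l₂) (l₁ + l₃) ![χ, ψ₁ ∘ₗ f, ψ₂ ∘ₗ f, ψ₃ ∘ₗ f] ?_ ?_ ?_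
  · intro i c hc
    fin_cases i
    · exact hχ c hc
    · exact hψ₁ c hc
    · exact hψ₂ c hc
    · exact hψ₃ c hc
  · intro c hc
    have e0 := hc 0
    have e1 := hc 1
    have e2 := hc 2
    have e3 := hc 3
    simp [hfx, h11, h12, h13, h21, h22, h23, h31, h32, h33] at e1 e2 e3
    simp [e2, e3] at e1
    simp [e1, e2, e3, hχx] at e0
    ext i; fin_cases i <;> simp [*]
  · intro i j k
    have h4 : l₄ = l₁ + l₂ + l₃ := (eq_of_add hs).symm
    rcases k01 j with rfl | rfl <;> rcases k01 k with rfl | rfl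
    · obtain ⟨e, he, h1⟩ := h l₁ (by simp) i
      refine ⟨e, he, ?_⟩
      simpa using h1
    · obtain ⟨e, he, h1⟩ := h l₃ (by simp) i
      refine ⟨e, he, ?_⟩
      convert h1 using 1
      have := aa l₁
      simp only [zero_smul, one_smul]
      grind
    · obtain ⟨e, he, h1⟩ := h l₂ (by simp) i
      refine ⟨e, he, ?_⟩
      convert h1 using 1
      have := aa l₁
      simp only [zero_smul, one_smul]
      grind
    · obtain ⟨e, he, h1⟩ := h l₄ (by simp) i
      refine ⟨e, he, ?_⟩
      convert h1 using 1
      have := aa l₁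
      simp only [one_smul, h4]
      grind

variable {ι : Type} [DecidableEq ι]

theorem bad_core (hE : AGF E) (hx : C1 E x f) {b : ι → U} (hb : LinearIndependent K b)
    (hT : ∀ i, b i ∈ T E f) {i j k d : ι} (hij : i ≠ j) (hik : i ≠ k) (hjk : j ≠ k)
    (hid : i ≠ d) (hjd : j ≠ d) (hkd : k ≠ d) {e e' t t' : V} (he : e ∈ E) (he' : e' ∈ E)
    (ht : t ∈ E) (ht' : t' ∈ E) (fe : f e = b i + b j) (fe' : f e' = b i + b k)
    (ft : f t = b i + b j + b d) (h : e + t = e' + t') : False := by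
  classical
  obtain ⟨l₀, hl₀⟩ := exists_lift0 hx b
  set s := e + t + x with hs
  have fs : f s = b d := by
    rw [hs, map_add, map_add, fe, ft, hx.apply]
    have := aa (b i); have := aa (b j); grind
  have sE : s ∈ E := (hT d).2 _ fs
  set l := Function.update l₀ d s with hl
  have hld : l d = s := by simp [hl]
  have hl' : ∀ i, f (l i) = b i := by
    intro i
    by_cases hi : i = d
    · subst hi; rw [hld, fs]
    · simp [hl, hi, hl₀]
  obtain ⟨χ, hχx, hχ⟩ := lift_fun hx hb hl' (fun _ => 0)
  obtain ⟨ψ₁, hψ₁⟩ := exists_functional hb (fun q => if q = i ∨ q = j then 1 else 0)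
  obtain ⟨ψ₂, hψ₂⟩ := exists_functional hb (fun q => if q = k then 1 else 0)
  obtain ⟨ψ₃, hψ₃⟩ := exists_functional hb (fun q => if q = i then 1 else 0)
  have hls : ∀ q, q ≠ d → ∀ ε : K, ∃ e ∈ E, l q + ε • x + e ∈ Submodule.span K {s} := by
    intro q hq ε
    refine ⟨l q + ε • x, (hT q).2 _ ?_, ?_⟩
    · rw [map_add, map_smul, hx.apply, smul_zero, add_zero, hl']
    · rw [aa]; exact Submodule.zero_mem _
  have hes : ∀ ε : K, ∃ e₁ ∈ E, e + ε • x + e₁ ∈ Submodule.span K {s} := by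
    intro ε
    rcases k01 ε with rfl | rfl
    · refine ⟨e, he, ?_⟩
      simp [aa]
    · refine ⟨t, ht, ?_⟩
      convert Submodule.mem_span_singleton_self s using 1
      rw [hs, one_smul]; abel
  have hes' : ∀ ε : K, ∃ e₁ ∈ E, e' + ε • x + e₁ ∈ Submodule.span K {s} := by
    intro ε
    rcases k01 ε with rfl | rfl
    · refine ⟨e', he', ?_⟩
      simp [aa]
    · refine ⟨t', ht', ?_⟩
      convert Submodule.mem_span_singleton_self s using 1
      rw [hs, one_smul, h]; abel
  have hsum : ∃ ε : K, l j + l k + e + (e' + ε • x) = 0 := by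
    have : f (l j + l k + e + e') = 0 := by
      simp only [map_add, hl', fe, fe']
      have := aa (b i); have := aa (b j); have := aa (b k); grind
    rcases hx.eq_zero_iff.1 this with h | h
    · exact ⟨0, by simpa using h⟩
    · refine ⟨1, ?_⟩
      rw [one_smul, ← add_assoc, h, aa]
  obtain ⟨ε, hε⟩ := hsum
  refine core4' hE hx.apply (C := {s}) (by simpa using sE) (l j) (l k) e (e' + ε • x) ?_ hε χ hχx ?_
    ψ₁ ψ₂ ψ₃ ?_ ?_ ?_ ?_ ?_ ?_ ?_ ?_ ?_ ?_ ?_ ?_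
  · rintro _ (rfl | rfl | rfl | rfl)
    · exact hls j hjd
    · exact hls k hkd
    · exact hes
    · intro δ
      obtain ⟨e₁, h1, h2⟩ := hes' (ε + δ)
      refine ⟨e₁, h1, ?_⟩
      convert h2 using 1
      rw [add_smul]; abel
  · rintro _ rfl; rw [← hld, hχ]
  · rintro _ rfl; rw [fs, hψ₁]; simp [hid.symm, hjd.symm]
  · rintro _ rfl; rw [fs, hψ₂]; simp [hkd.symm]
  · rintro _ rfl; rw [fs, hψ₃]; simp [hid.symm]
  all_goals simp [hl', hψ₁, hψ₂, hψ₃, fe, fe', *, hij.symm, hik.symm, hjk.symm, hid.symm, hjd.symm,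
    hkd.symm]
  all_goals decide

theorem bad_case (hE : AGF E) (hx : C1 E x f) {b : ι → U} (hb : LinearIndependent K b)
    (hT : ∀ i, b i ∈ T E f) {i j k d : ι} (hij : i ≠ j) (hik : i ≠ k) (hjk : j ≠ k)
    (hid : i ≠ d) (hjd : j ≠ d) (hkd : k ≠ d) {P : Submodule K U} (hP : (P : Set U) ⊆ f '' E)
    (h1 : b i + b j ∈ P) (h2 : b i + b k ∈ P) (h3 : b d ∈ P) : False := by
  have h4 : b j + b k ∈ P := by
    have := P.add_mem h1 h2
    convert this using 1
    have := aa (b i); grind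
  obtain ⟨e₁, E₁, he₁⟩ := hP h1
  obtain ⟨e₂, E₂, he₂⟩ := hP h2
  obtain ⟨e₃, E₃, he₃⟩ := hP h4
  obtain ⟨t₁, T₁, ht₁⟩ := hP (P.add_mem h1 h3)
  obtain ⟨t₂, T₂, ht₂⟩ := hP (P.add_mem h2 h3)
  obtain ⟨t₃, T₃, ht₃⟩ := hP (P.add_mem h4 h3)
  have s1 : f (e₁ + t₁) = b d := by
    rw [map_add, he₁, ht₁]; have := aa (b i); have := aa (b j); grind
  have s2 : f (e₂ + t₂) = b d := by
    rw [map_add, he₂, ht₂]; have := aa (b i); have := aa (b k); grind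
  have s3 : f (e₃ + t₃) = b d := by
    rw [map_add, he₃, ht₃]; have := aa (b k); have := aa (b j); grind
  rcases hx.eq_iff.1 (s1.trans s2.symm) with h | h
  · exact bad_core hE hx hb hT hij hik hjk hid hjd hkd E₁ E₂ T₁ T₂ he₁ he₂ ht₁ h
  rcases hx.eq_iff.1 (s1.trans s3.symm) with h' | h'
  · exact bad_core hE hx hb hT (i := j) (j := i) (k := k) hij.symm hjk hik hjd hid hkd E₁ E₃ T₁ T₃
      (by rw [he₁, add_comm]) he₃ (by rw [ht₁, add_comm (b i)]) h'
  have h'' : e₂ + t₂ = e₃ + t₃ := add_right_cancel (h.symm.trans h')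
  exact bad_core hE hx hb hT (i := k) (j := i) (k := j) hik.symm hjk.symm hij hkd hid hjd E₂ E₃ T₂ T₃
      (by rw [he₂, add_comm]) (by rw [he₃, add_comm]) (by rw [ht₂, add_comm (b i)]) h''

theorem finrank_inf_ker [Finite U] {P : Submodule K U} {φ : U →ₗ[K] K} {p : U} (hp : p ∈ P)
    (h : φ p = 1) : Module.finrank K (P ⊓ LinearMap.ker φ : Submodule K U) + 1
      = Module.finrank K P := by
  have h1 := finrank_map_ker φ P
  have h2 : P.map φ = ⊤ := by
    rw [eq_top_iff]; intro c _
    exact ⟨c • p, P.smul_mem _ hp, by simp [h]⟩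
  rw [h2, finrank_top, Module.finrank_self] at h1
  omega

theorem three_coords [Finite U] {P : Submodule K U} (hP : Module.finrank K P = 3)
    {φ : ι → U →ₗ[K] K} (hφ : ∀ u, (∀ i, φ i u = 0) → u = 0) :
    ∃ i₁ i₂ i₃, ∃ p₁ ∈ P, ∃ p₂ ∈ P, ∃ p₃ ∈ P,
      φ i₁ p₁ = 1 ∧ φ i₂ p₁ = 0 ∧ φ i₃ p₁ = 0 ∧ φ i₁ p₂ = 0 ∧ φ i₂ p₂ = 1 ∧ φ i₃ p₂ = 0 ∧
      φ i₁ p₃ = 0 ∧ φ i₂ p₃ = 0 ∧ φ i₃ p₃ = 1 := by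
  have key : ∀ Q : Submodule K U, 0 < Module.finrank K Q → ∃ q ∈ Q, ∃ i, φ i q = 1 := by
    intro Q hQ
    obtain ⟨e, he, h0⟩ := exists_ne_zero hQ
    by_contra h
    push Not at h
    exact h0 (hφ e fun i => kne1 (h e he i))
  obtain ⟨p₁, hp₁, i₁, h1⟩ := key P (by omega)
  have f1 := finrank_inf_ker hp₁ h1
  obtain ⟨p₂, hp₂, i₂, h2⟩ := key (P ⊓ LinearMap.ker (φ i₁)) (by omega)
  have f2 := finrank_inf_ker hp₂ h2
  obtain ⟨p₃, hp₃, i₃, h3⟩ := key (P ⊓ LinearMap.ker (φ i₁) ⊓ LinearMap.ker (φ i₂)) (by omega)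
  obtain ⟨hp₂, h4⟩ := hp₂
  obtain ⟨⟨hp₃, h5⟩, h6⟩ := hp₃
  have h4 : φ i₁ p₂ = 0 := h4
  have h5 : φ i₁ p₃ = 0 := h5
  have h6 : φ i₂ p₃ = 0 := h6
  set q₂ := p₂ + φ i₃ p₂ • p₃ with hq₂
  have hq₂P : q₂ ∈ P := P.add_mem hp₂ (P.smul_mem _ hp₃)
  have a1 : φ i₁ q₂ = 0 := by simp [hq₂, h4, h5]
  have a2 : φ i₂ q₂ = 1 := by simp [hq₂, h2, h6]
  have a3 : φ i₃ q₂ = 0 := by simp [hq₂, h3, aa]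
  set q₁ := p₁ + φ i₂ p₁ • q₂ + φ i₃ p₁ • p₃ with hq₁
  have hq₁P : q₁ ∈ P := P.add_mem (P.add_mem hp₁ (P.smul_mem _ hq₂P)) (P.smul_mem _ hp₃)
  refine ⟨i₁, i₂, i₃, q₁, hq₁P, q₂, hq₂P, p₃, hp₃, ?_, ?_, ?_, a1, a2, a3, h5, h6, h3⟩
  · simp [hq₁, h1, a1, h5]
  · simp [hq₁, a2, h6, aa]
  · simp [hq₁, a3, h3, aa]

set_option maxHeartbeats 1000000 in
/-- Planes of a full contraction are coordinate planes. -/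
theorem full_plane [Finite V] (hE : AGF E) (hx : C1 E x f) {b : ι → U} (hb : LinearIndependent K b)
    (hT : ∀ i, b i ∈ T E f) {P : Submodule K U} (hP : IsPlane (f '' E) P)
    (hspan : P ≤ Submodule.span K (range b)) :
    ∃ i j k, i ≠ j ∧ i ≠ k ∧ j ≠ k ∧ b i ∈ P ∧ b j ∈ P ∧ b k ∈ P := by
  classical
  have hU : Finite U := Finite.of_surjective f hx.surj
  choose φ hφ using fun i => coord hb i
  let φ' : ι → P →ₗ[K] K := fun i => (φ i).domRestrict P
  have hfull : Module.finrank K (⊤ : Submodule K P) = 3 := by rw [finrank_top, hP.1]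
  obtain ⟨i₁, i₂, i₃, p₁, -, p₂, -, p₃, -, h11, h21, h31, h12, h22, h32, h13, h23, h33⟩ :=
    three_coords (φ := φ') hfull (by
      rintro ⟨u, hu⟩ h
      obtain ⟨A, rfl⟩ := exists_wd (hspan hu)
      have : A = ∅ := by
        rw [Finset.eq_empty_iff_forall_notMem]
        intro i hi
        have := h i
        simp [φ', hφ, hi] at this
      subst this; simp)
  obtain ⟨p₁, hp₁⟩ := p₁
  obtain ⟨p₂, hp₂⟩ := p₂
  obtain ⟨p₃, hp₃⟩ := p₃
  obtain ⟨A₁, rfl⟩ := exists_wd (hspan hp₁)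
  obtain ⟨A₂, rfl⟩ := exists_wd (hspan hp₂)
  obtain ⟨A₃, rfl⟩ := exists_wd (hspan hp₃)
  simp [φ', hφ] at h11 h21 h31 h12 h22 h32 h13 h23 h33
  have n12 : i₁ ≠ i₂ := by rintro rfl; exact h21 h11
  have n13 : i₁ ≠ i₃ := by rintro rfl; exact h31 h11
  have n23 : i₂ ≠ i₃ := by rintro rfl; exact h32 h22
  have wle : ∀ A, wd b A ∈ P → A.card ≤ 3 := by
    intro A hA
    by_contra h
    push Not at h
    exact W4 hE hx hb hT h (hP.2 hA)
  have m12 : wd b (symmDiff A₁ A₂) ∈ P := by rw [← wd_add]; exact P.add_mem hp₁ hp₂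
  have m13 : wd b (symmDiff A₁ A₃) ∈ P := by rw [← wd_add]; exact P.add_mem hp₁ hp₃
  have m23 : wd b (symmDiff A₂ A₃) ∈ P := by rw [← wd_add]; exact P.add_mem hp₂ hp₃
  have m123 : wd b (symmDiff (symmDiff A₁ A₂) A₃) ∈ P := by
    rw [← wd_add]; exact P.add_mem m12 hp₃
  have e123 : ({i₁, i₂, i₃} : Finset ι) = symmDiff (symmDiff A₁ A₂) A₃ := by
    apply Finset.eq_of_subset_of_card_le
    · intro i hi
      simp only [Finset.mem_insert, Finset.mem_singleton] at hi
      simp only [Finset.mem_symmDiff]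
      rcases hi with rfl | rfl | rfl <;> tauto
    · rw [Finset.card_eq_three.2 ⟨i₁, i₂, i₃, n12, n13, n23, rfl⟩]; exact wle _ m123
  have hpar : ∀ i, i ≠ i₁ → i ≠ i₂ → i ≠ i₃ → (i ∈ A₁ ↔ ¬ (i ∈ A₂ ↔ i ∈ A₃)) := by
    intro i g1 g2 g3
    have : i ∉ ({i₁, i₂, i₃} : Finset ι) := by simp [g1, g2, g3]
    rw [e123] at this
    simp only [Finset.mem_symmDiff] at this
    tauto
  -- two members outside of the triangle force a word of weight four
  have one : ∀ (A B : Finset ι) (i j : ι), i ≠ j → wd b (symmDiff A B) ∈ P → i ∈ A → i ∉ B →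
      j ∈ B → j ∉ A → ∀ d d', d ≠ i → d ≠ j → d' ≠ i → d' ≠ j → (¬ (d ∈ A ↔ d ∈ B)) →
      (¬ (d' ∈ A ↔ d' ∈ B)) → d = d' := by
    intro A B i j hij hm hiA hiB hjB hjA d d' d1 d2 d3 d4 hd hd'
    by_contra hne
    have hsub : ({i, j, d, d'} : Finset ι) ⊆ symmDiff A B := by
      intro q hq
      simp only [Finset.mem_insert, Finset.mem_singleton] at hq
      have aux : ∀ d, (¬ (d ∈ A ↔ d ∈ B)) → d ∈ symmDiff A B := by
        intro d hd
        rw [Finset.mem_symmDiff]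
        clear * - hd
        tauto
      rcases hq with h | h | h | h <;> rw [h]
      · exact Finset.mem_symmDiff.2 (Or.inl ⟨hiA, hiB⟩)
      · exact Finset.mem_symmDiff.2 (Or.inr ⟨hjB, hjA⟩)
      · exact aux d hd
      · exact aux d' hd'
    have := Finset.card_le_card hsub
    rw [Finset.card_eq_four.2 ⟨i, j, d, d', hij, d1.symm, d3.symm, d2.symm, d4.symm, hne, rfl⟩]
      at this
    have := wle _ hm
    omega
  have bad : ∀ (i j k : ι) (A B C : Finset ι), i ≠ j → i ≠ k → j ≠ k → wd b A ∈ P →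
      wd b B ∈ P → wd b C ∈ P → wd b (symmDiff A B) ∈ P → wd b (symmDiff A C) ∈ P →
      wd b (symmDiff B C) ∈ P → i ∈ A → j ∉ A → k ∉ A → i ∉ B → j ∈ B → k ∉ B → i ∉ C → j ∉ C →
      k ∈ C → (∀ q, q ≠ i → q ≠ j → q ≠ k → (q ∈ A ↔ ¬ (q ∈ B ↔ q ∈ C))) →
      ∀ d, d ≠ i → d ≠ j → d ≠ k → d ∈ A → d ∈ B → False := by
    intro i j k A B C hij hik hjk hA hB hC hAB hAC hBC iA jA kA iB jB kB iC jC kC hpar d di dj dk dA dB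
    have dC : d ∉ C := by have := hpar d di dj dk; tauto
    -- all other elements
    have uA : ∀ q, q ≠ i → q ≠ j → q ≠ k → q ∈ A → q = d := by
      intro q q1 q2 q3 qA
      by_cases qC : q ∈ C
      · have hqB : q ∉ B := by have := hpar q q1 q2 q3; tauto
        exact one B C j k hjk hBC jB jC kC kB q d q2 q3 dj dk (by tauto) (by tauto)
      · exact one A C i k hik hAC iA iC kC kA q d q1 q3 di dk (by tauto) (by tauto)
    have uB : ∀ q, q ≠ i → q ≠ j → q ≠ k → q ∈ B → q = d := by
      intro q q1 q2 q3 qB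
      by_cases qC : q ∈ C
      · have hqA : q ∉ A := by have := hpar q q1 q2 q3; tauto
        exact one A C i k hik hAC iA iC kC kA q d q1 q3 di dk (by tauto) (by tauto)
      · exact one B C j k hjk hBC jB jC kC kB q d q2 q3 dj dk (by tauto) (by tauto)
    have eA : A = {i, d} := by
      ext q
      simp only [Finset.mem_insert, Finset.mem_singleton]
      constructor
      · intro hq
        by_cases q1 : q = i
        · exact Or.inl q1
        · right; apply uA q q1 _ _ hq
          · rintro rfl; exact jA hq
          · rintro rfl; exact kA hq
      · rintro (rfl | rfl) <;> assumption
    have eB : B = {j, d} := by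
      ext q
      simp only [Finset.mem_insert, Finset.mem_singleton]
      constructor
      · intro hq
        by_cases q1 : q = j
        · exact Or.inl q1
        · right; apply uB q _ q1 _ hq
          · rintro rfl; exact iB hq
          · rintro rfl; exact kB hq
      · rintro (rfl | rfl) <;> assumption
    have eC : C = {k} := by
      ext q
      simp only [Finset.mem_singleton]
      constructor
      · intro hq
        by_contra q3
        have q1 : q ≠ i := by rintro rfl; exact iC hq
        have q2 : q ≠ j := by rintro rfl; exact jC hq
        have h1 := hpar q q1 q2 q3
        have h2 := uA q q1 q2 q3
        have h3 := uB q q1 q2 q3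
        by_cases qd : q = d
        · exact dC (qd ▸ hq)
        · tauto
      · rintro rfl; assumption
    subst eA; subst eB; subst eC
    rw [wd_insert _ (by simpa using di.symm), wd_single] at hA
    rw [wd_insert _ (by simpa using dj.symm), wd_single] at hB
    rw [wd_single] at hC
    exact bad_case hE hx hb hT (i := d) (j := i) (k := j) (d := k) di dj hij dk hik hjk hP.2
      (by rwa [add_comm]) (by rwa [add_comm]) hC
  have no12 : ∀ d, d ≠ i₁ → d ≠ i₂ → d ≠ i₃ → d ∈ A₁ → d ∈ A₂ → False :=
    bad i₁ i₂ i₃ A₁ A₂ A₃ n12 n13 n23 hp₁ hp₂ hp₃ m12 m13 m23 h11 h21 h31 h12 h22 h32 h13 h23 h33 hpar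
  have no13 : ∀ d, d ≠ i₁ → d ≠ i₃ → d ≠ i₂ → d ∈ A₁ → d ∈ A₃ → False :=
    bad i₁ i₃ i₂ A₁ A₃ A₂ n13 n12 n23.symm hp₁ hp₃ hp₂ m13 m12 (by rwa [symmDiff_comm]) h11 h31 h21
      h13 h33 h23 h12 h32 h22 (fun q q1 q3 q2 => by have := hpar q q1 q2 q3; tauto)
  have no23 : ∀ d, d ≠ i₂ → d ≠ i₃ → d ≠ i₁ → d ∈ A₂ → d ∈ A₃ → False :=
    bad i₂ i₃ i₁ A₂ A₃ A₁ n23 n12.symm n13.symm hp₂ hp₃ hp₁ m23 (by rwa [symmDiff_comm])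
      (by rwa [symmDiff_comm]) h22 h32 h12 h23 h33 h13 h21 h31 h11
      (fun q q2 q3 q1 => by have := hpar q q1 q2 q3; tauto)
  have none : ∀ d, d ≠ i₁ → d ≠ i₂ → d ≠ i₃ → d ∉ A₁ ∧ d ∉ A₂ ∧ d ∉ A₃ := by
    intro d d1 d2 d3
    have a1 := hpar d d1 d2 d3
    have a2 := no12 d d1 d2 d3
    have a3 := no13 d d1 d3 d2
    have a4 := no23 d d2 d3 d1
    tauto
  have sing : ∀ (A : Finset ι) (i j k : ι), i ∈ A → j ∉ A → k ∉ A →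
      (∀ d, d ≠ i → d ≠ j → d ≠ k → d ∉ A) → A = {i} := by
    intro A i j k hi hj hk h
    ext q
    simp only [Finset.mem_singleton]
    constructor
    · intro hq
      by_contra h1
      refine h q h1 ?_ ?_ hq
      · rintro rfl; exact hj hq
      · rintro rfl; exact hk hq
    · rintro rfl; exact hi
  have s1 := sing A₁ i₁ i₂ i₃ h11 h21 h31 (fun d a b c => (none d a b c).1)
  have s2 := sing A₂ i₂ i₁ i₃ h22 h12 h32 (fun d a b c => (none d b a c).2.1)
  have s3 := sing A₃ i₃ i₁ i₂ h33 h13 h23 (fun d a b c => (none d b c a).2.2)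
  subst s1; subst s2; subst s3
  rw [wd_single] at hp₁ hp₂ hp₃
  exact ⟨i₁, i₂, i₃, n12, n13, n23, hp₁, hp₂, hp₃⟩

end full
end NR

namespace NR

section mask

/-- kernel friendly version of `List.any` -/
def anyL {β : Type} (l : List β) (p : β → Bool) : Bool :=
  List.rec false (fun a _ ih => or (p a) ih) l
theorem anyL_eq {β : Type} (l : List β) (p : β → Bool) : anyL l p = l.any p := by
  induction l with
  | nil => rfl
  | cons a l ih => show or (p a) (anyL l p) = _; rw [ih]; rfl

def tb (m n : ℕ) : Bool := not (Nat.beq (Nat.land m (Nat.shiftLeft 1 n)) 0)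

def cntL (l : List ℕ) (p : ℕ → Bool) : ℕ :=
  List.rec 0 (fun a _ ih => cond (p a) (Nat.succ ih) ih) l
theorem cntL_eq (l : List ℕ) (p : ℕ → Bool) : cntL l p = l.countP p := by
  induction l with
  | nil => rfl
  | cons a l ih =>
    show cond (p a) (Nat.succ (cntL l p)) (cntL l p) = _
    rw [ih, List.countP_cons]; cases p a <;> rfl

/-- force evaluation -/
def frc (n : ℕ) (k : ℕ → Bool) : Bool := Nat.rec (k 0) (fun p _ => k (p+1)) n
theorem frc_eq (n : ℕ) (k : ℕ → Bool) : frc n k = k n := by cases n <;> rfl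

def sw (M d m : ℕ) : ℕ :=
  Nat.lor (Nat.shiftRight (Nat.land m M) d) (Nat.land (Nat.shiftLeft m d) M)

def tr (m x : ℕ) (k : ℕ → Bool) : Bool :=
  frc (cond (tb x 0) (sw 2863311530 1 m) m) fun m =>
  frc (cond (tb x 1) (sw 3435973836 2 m) m) fun m =>
  frc (cond (tb x 2) (sw 4042322160 4 m) m) fun m =>
  frc (cond (tb x 3) (sw 4278255360 8 m) m) fun m =>
  frc (cond (tb x 4) (sw 4294901760 16 m) m) k

def codes : List ℕ := [1,2,3,4,5,6,7,8,9,10,11,12,13,14,15,16,17,18,19,20,21,22,23,24,25,26,27,28,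
  29,30,31]

def tab : List (ℕ × List ℕ) := [(25, [1010580540, 2573637990, 2576967270, 1431677610, 
1771465110]), (24, [1010580540, 1520805210, 2863311530, 2857719210, 1721342310, 2523490710]), 
(21, [1019462460, 1771465110, 2576967270, 869020620, 2526451350, 2774181210, 1515870810, 
2857719210]), (20, [1019462460, 2779077210, 2523490710, 1768527510, 1520805210, 869020620]), 
(3, [2526451350, 2573637990, 2576967270, 2523490710, 1721342310, 1768527510, 1771465110, 
1717986918, 16776960, 267390960, 252702960]), (4, [1437226410, 16776960, 869020620, 
859032780]), (5, [2779077210, 1520805210, 1515870810, 1768527510, 1771465110, 2526451350, 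
2523490710, 2774181210, 16776960, 869020620, 859032780]), (9, [2774181210, 2857719210, 
2573637990, 2523490710, 1520805210, 1771465110, 859032780, 252702960, 1010580540]), (8, 
[2863311530, 2576967270, 859032780, 252702960, 1010580540]), (22, [3275539260, 2526451350, 
1771465110, 2576967270, 1520805210, 2779077210, 1721342310, 2863311530, 1437226410]), (23, 
[3275539260, 1768527510, 2523490710, 1515870810, 2573637990, 1717986918, 2857719210, 
2774181210, 1431677610]), (15, [2523490710, 1771465110, 2576967270, 1515870810, 2857719210, 
2779077210, 1717986918, 1437226410]), (26, [2573637990, 2576967270, 1771465110, 1520805210, 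
2857719210, 1768527510, 2863311530, 1515870810, 4027518960]), (27, [2523490710, 2774181210, 
2526451350, 1721342310, 1717986918, 1431677610, 2779077210, 1437226410, 4027518960]), (14, 
[2526451350, 1768527510, 2573637990, 1520805210, 2863311530, 2774181210, 1431677610, 
1721342310]), (19, [1019462460, 2857719210, 2779077210, 1431677610, 1520805210, 2573637990, 
267390960, 2526451350]), (18, [1019462460, 2576967270, 1768527510, 2863311530, 1721342310, 
267390960, 1437226410, 1515870810]), (2, [2857719210, 2863311530, 16776960, 267390960, 
252702960]), (28, [1771465110, 2774181210, 2779077210, 2857719210, 1768527510, 2863311530, 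
3284352060, 1721342310, 1717986918]), (29, [1520805210, 2523490710, 2576967270, 2573637990, 
1515870810, 2526451350, 3284352060, 1431677610, 1437226410]), (13, [1019462460, 1515870810, 
859032780, 2573637990, 2526451350, 2779077210, 1768527510]), (12, [1019462460, 1520805210, 
2863311530, 2774181210, 2523490710, 1771465110, 859032780]), (17, [2857719210, 1010580540, 
869020620, 267390960, 1431677610]), (10, [2863311530, 2573637990, 1771465110, 2523490710, 
252702960, 1431677610, 1721342310, 1515870810]), (16, [1010580540, 869020620, 267390960, 
1717986918, 1515870810, 1771465110, 2774181210, 2573637990, 2526451350]), (11, [1520805210, 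
252702960, 2576967270, 2857719210, 2774181210]), (6, [2526451350, 1771465110, 2863311530, 
16776960, 1768527510, 2523490710]), (7, [1515870810, 1520805210, 16776960, 2774181210, 
2779077210, 2573637990])]

def ag (m : ℕ) : Bool := anyL tab fun p =>
  and (tb m p.1) (tr m p.1 fun t => frc (Nat.lor m t) fun mm =>
    anyL p.2 fun h => Nat.beq (Nat.land h mm) h)

def fm (m : ℕ) : Bool := anyL codes fun x => and (tb m x) (anyL codes fun y =>
  and (tb m y) (and (not (Nat.beq x y)) (tr m x fun a => frc (Nat.lor m a) fun a =>
    tr a y fun b => Nat.beq (Nat.land (Nat.lor a b) 4294967295) 4294967295)))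

def leaf (m c : ℕ) : Bool := or (Nat.ble c 5) (and (Nat.ble c 6) (or
  (anyL [1,3,5,7,9,11,13,15,17,19,21,23,25,27,29,31] fun d =>
    and (tb m d) (Nat.ble (cntL (0 :: codes) fun n => and (tb m n) (tb m (Nat.xor n d))) 8))
  (not (fm m))))

def srch : List ℕ → ℕ → ℕ → Bool
  | [], m, c => leaf m c
  | w :: ws, m, c => or (Nat.ble (c + ws.length + 1) 5) (and (srch ws m c)
      (and (frc (Nat.lor m (Nat.shiftLeft 1 w)) fun m' => frc (c+1) fun c => or (ag m') (srch ws m' c))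
        (frc (Nat.lor m (Nat.shiftLeft 2 w)) fun m' => frc (c+1) fun c => or (ag m') (srch ws m' c))))

def wds : List ℕ := [14, 22, 26, 28, 6, 10, 12, 18, 20, 24]

theorem tab_ok : ∀ p ∈ tab, p.1 < 32 ∧ p.1 ≠ 0 ∧ ∀ h ∈ p.2, Nat.testBit h p.1 = false ∧
    (∃ n < 32, Nat.testBit h n = true) ∧ ∀ n < 32, Nat.testBit h n = (((Nat.testBit n 0 && Nat.testBit h 1) ^^
      (Nat.testBit n 1 && Nat.testBit h 2)) ^^ ((Nat.testBit n 2 && Nat.testBit h 4) ^^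
      ((Nat.testBit n 3 && Nat.testBit h 8) ^^ (Nat.testBit n 4 && Nat.testBit h 16)))) := by
  decide +kernel

theorem srch_ok : srch wds 197439 0 = true := by decide +kernel
end mask
end NR

namespace NR

section mask

theorem tb_eq (m n : ℕ) : tb m n = Nat.testBit m n := by
  have h1 : Nat.land m (Nat.shiftLeft 1 n) = m &&& 2 ^ n := by
    show m &&& (1 <<< n) = _
    rw [Nat.one_shiftLeft]
  unfold tb
  rw [h1, Nat.and_two_pow]
  cases Nat.testBit m n
  · simp
  · have : Nat.beq (2 ^ n) 0 = false := by
      rw [Bool.eq_false_iff]; intro h; have := Nat.eq_of_beq_eq_true h; simp at this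
    simp [this]

theorem sw_eq {M d : ℕ} (hd : d ≠ 0) (hM : ∀ n < 32, (M.testBit n = (n ^^^ d < n : Bool)) ∧ (n ^^^ d < 32) ∧
    (n ^^^ d < n → d ≤ n ∧ n - d = n ^^^ d ∧ M.testBit (n + d) = false) ∧
    (¬ n ^^^ d < n → n + d = n ^^^ d)) (m : ℕ) :
    ∀ n < 32, (sw M d m).testBit n = m.testBit (n ^^^ d) := by
  intro n hn
  have e : sw M d m = ((m &&& M) >>> d) ||| ((m <<< d) &&& M) := rfl
  obtain ⟨h1, h2, h3, h4⟩ := hM n hn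
  rw [e, Nat.testBit_or, Nat.testBit_shiftRight, Nat.testBit_and, Nat.testBit_and,
    Nat.testBit_shiftLeft, add_comm d n, h1]
  by_cases h : n ^^^ d < n
  · obtain ⟨h5, h6, h7⟩ := h3 h
    rw [h6, h7]; simp [h, h5]
  · rw [h4 h]
    have := (hM (n ^^^ d) h2).1
    rw [this, Nat.xor_assoc, Nat.xor_self, Nat.xor_zero]
    have h5 : n < n ^^^ d ∨ d = 0 := by
      rcases lt_trichotomy n (n ^^^ d) with h6 | h6 | h6
      · exact Or.inl h6
      · right
        have := congrArg (fun t => n ^^^ t) h6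
        simpa [← Nat.xor_assoc] using this.symm
      · exact absurd h6 h
    rcases h5 with h5 | h5
    · simp [h, h5]
    · exact absurd h5 hd

theorem sw_eq' {M d : ℕ} {x : ℕ} {b : ℕ} (hd : d < 32) (hM : ∀ m, ∀ n < 32, (sw M d m).testBit n = m.testBit (n ^^^ d))
    (m : ℕ) : ∀ n < 32, (cond (tb x b) (sw M d m) m).testBit n
      = m.testBit (n ^^^ (if x.testBit b then d else 0)) := by
  intro n hn
  rw [tb_eq]
  cases h : x.testBit b
  · simp
  · simpa using hM m n hn

theorem s0 : ∀ m, ∀ n < 32, (sw 2863311530 1 m).testBit n = m.testBit (n ^^^ 1) := sw_eq (by decide) (by decide)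
theorem s1 : ∀ m, ∀ n < 32, (sw 3435973836 2 m).testBit n = m.testBit (n ^^^ 2) := sw_eq (by decide) (by decide)
theorem s2 : ∀ m, ∀ n < 32, (sw 4042322160 4 m).testBit n = m.testBit (n ^^^ 4) := sw_eq (by decide) (by decide)
theorem s3 : ∀ m, ∀ n < 32, (sw 4278255360 8 m).testBit n = m.testBit (n ^^^ 8) := sw_eq (by decide) (by decide)
theorem s4 : ∀ m, ∀ n < 32, (sw 4294901760 16 m).testBit n = m.testBit (n ^^^ 16) :=
  sw_eq (by decide) (by decide)

theorem xor32 {a b : ℕ} (ha : a < 32) (hb : b < 32) : a ^^^ b < 32 :=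
  Nat.xor_lt_two_pow (n := 5) ha hb

theorem tr_eq {m x : ℕ} (hx : x < 32) (k : ℕ → Bool) :
    ∃ t, tr m x k = k t ∧ ∀ n < 32, t.testBit n = m.testBit (n ^^^ x) := by
  unfold tr
  simp only [frc_eq]
  refine ⟨_, rfl, fun n hn => ?_⟩
  have key : ∀ x < 32, x = (if x.testBit 4 then 16 else 0) ^^^ (if x.testBit 3 then 8 else 0) ^^^
      (if x.testBit 2 then 4 else 0) ^^^ (if x.testBit 1 then 2 else 0) ^^^
      (if x.testBit 0 then 1 else 0) := by decide
  have i32 : ∀ (p : Bool) (d : ℕ), d < 32 → (if p then d else 0) < 32 := by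
    intro p d hd; cases p <;> simp [hd]
  have q4 := i32 (x.testBit 4) 16 (by norm_num)
  have q3 := i32 (x.testBit 3) 8 (by norm_num)
  have q2 := i32 (x.testBit 2) 4 (by norm_num)
  have q1 := i32 (x.testBit 1) 2 (by norm_num)
  have n4 := xor32 hn q4
  have n3 := xor32 n4 q3
  have n2 := xor32 n3 q2
  have n1 := xor32 n2 q1
  rw [sw_eq' (by norm_num) s4 _ _ hn, sw_eq' (by norm_num) s3 _ _ n4,
    sw_eq' (by norm_num) s2 _ _ n3, sw_eq' (by norm_num) s1 _ _ n2,
    sw_eq' (by norm_num) s0 _ _ n1]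
  conv_rhs => rw [key x hx]
  simp only [Nat.xor_assoc]

theorem ag_sound {m : ℕ} (h : ag m = true) : ∃ x < 32, x ≠ 0 ∧ m.testBit x = true ∧ ∃ h : ℕ,
    h.testBit x = false ∧ (∃ n < 32, h.testBit n = true) ∧
    (∀ n < 32, Nat.testBit h n = (((Nat.testBit n 0 && Nat.testBit h 1) ^^
      (Nat.testBit n 1 && Nat.testBit h 2)) ^^ ((Nat.testBit n 2 && Nat.testBit h 4) ^^
      ((Nat.testBit n 3 && Nat.testBit h 8) ^^ (Nat.testBit n 4 && Nat.testBit h 16))))) ∧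
    ∀ n < 32, h.testBit n = true → m.testBit n = true ∨ m.testBit (n ^^^ x) = true := by
  unfold ag at h
  rw [anyL_eq, List.any_eq_true] at h
  obtain ⟨p, hp, h⟩ := h
  obtain ⟨h1, h2, h3⟩ := tab_ok p hp
  rw [Bool.and_eq_true, tb_eq] at h
  obtain ⟨t, ht, ht'⟩ := tr_eq (m := m) h1 (fun t => frc (Nat.lor m t) fun mm =>
    anyL p.2 fun h => Nat.beq (Nat.land h mm) h)
  rw [ht, frc_eq, anyL_eq, List.any_eq_true] at h
  obtain ⟨h4, g, hg, hb⟩ := h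
  obtain ⟨h5, h6, h7⟩ := h3 g hg
  have hb' : g &&& (m ||| t) = g := Nat.eq_of_beq_eq_true hb
  refine ⟨p.1, h1, h2, h4, g, h5, h6, h7, ?_⟩
  intro n hn hgn
  rw [← hb', Nat.testBit_and, Nat.testBit_or, ht' n hn] at hgn
  simp at hgn
  exact hgn.2

theorem fm_sound {m : ℕ} {x y : ℕ} (hx : x < 32) (hy : y < 32) (hx0 : x ≠ 0) (hy0 : y ≠ 0)
    (hxy : x ≠ y) (hmx : m.testBit x = true) (hmy : m.testBit y = true)
    (h : ∀ n < 32, m.testBit n = true ∨ m.testBit (n ^^^ x) = true ∨ m.testBit (n ^^^ y) = true ∨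
      m.testBit (n ^^^ y ^^^ x) = true) : fm m = true := by
  have hc : ∀ x < 32, x ≠ 0 → x ∈ codes := by decide
  unfold fm
  rw [anyL_eq, List.any_eq_true]
  refine ⟨x, hc x hx hx0, ?_⟩
  rw [tb_eq, hmx, Bool.true_and, anyL_eq, List.any_eq_true]
  refine ⟨y, hc y hy hy0, ?_⟩
  rw [tb_eq, hmy, Bool.true_and]
  have hb : Nat.beq x y = false := by
    rw [Bool.eq_false_iff]; intro h; exact hxy (Nat.eq_of_beq_eq_true h)
  rw [hb, Bool.not_false, Bool.true_and]
  obtain ⟨t, ht, ht'⟩ := tr_eq (m := m) hx (fun a => frc (Nat.lor m a) fun a =>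
    tr a y fun b => Nat.beq (Nat.land (Nat.lor a b) 4294967295) 4294967295)
  rw [ht, frc_eq]
  obtain ⟨t2, ht2, ht2'⟩ := tr_eq (m := m.lor t) hy (fun b =>
    Nat.beq (Nat.land (Nat.lor (m.lor t) b) 4294967295) 4294967295)
  rw [ht2]
  have : ((m ||| t) ||| t2) &&& (2 ^ 32 - 1) = 2 ^ 32 - 1 := by
    apply Nat.eq_of_testBit_eq
    intro n
    rw [Nat.testBit_and, Nat.testBit_two_pow_sub_one]
    by_cases hn : n < 32
    · have h1 := ht' n hn
      have h2 := ht2' n hn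
      have h3 := ht' _ (xor32 hn hy)
      change t2.testBit n = (m ||| t).testBit (n ^^^ y) at h2
      rw [Nat.testBit_or] at h2
      have h4 := h n hn
      rw [Nat.testBit_or, Nat.testBit_or, h2, h3, h1]
      rcases h4 with h4 | h4 | h4 | h4 <;> simp [h4, hn]
    · simp [hn]
  change (((m ||| t) ||| t2) &&& 4294967295).beq 4294967295 = true
  norm_num at this
  rw [this]; rfl

/-- soundness of the search -/
theorem srch_sound (P : ℕ → Prop) [DecidablePred P]
    (hag : ∀ m, (∀ n < 32, m.testBit n = true → P n) → ag m = false) :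
    ∀ (ws : List ℕ) (m c N : ℕ), srch ws m c = true →
      (∀ n < 32, m.testBit n = true → P n) →
      (∀ n < 32, P n → m.testBit n = true ∨ ∃ w ∈ ws, n = w ∨ n = w + 1) →
      (∀ w ∈ ws, ¬ (P w ∧ P (w+1))) →
      N = c + ws.countP (fun w => P w ∨ P (w+1)) → 6 ≤ N →
      ∃ m, leaf m N = true ∧ ∀ n < 32, (m.testBit n = true ↔ P n) := by
  intro ws
  induction ws with
  | nil =>
    intro m c N h1 h2 h3 h4 h5 h6
    simp at h5; subst h5
    refine ⟨m, h1, fun n hn => ⟨h2 n hn, fun h => ?_⟩⟩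
    simpa using h3 n hn h
  | cons w ws ih =>
    intro m c N h1 h2 h3 h4 h5 h6
    rw [List.countP_cons] at h5
    have hle := List.countP_le_length (p := fun w => decide (P w ∨ P (w+1))) (l := ws)
    unfold srch at h1
    simp only [frc_eq, Bool.or_eq_true, Bool.and_eq_true] at h1
    rcases h1 with h1 | ⟨ha, hb, hc⟩
    · have := Nat.le_of_ble_eq_true h1
      split at h5 <;> omega
    · have bit : ∀ k (hk : k = w ∨ k = w + 1) n, n < 32 → P k →
          (Nat.lor m (Nat.shiftLeft 1 k)).testBit n = true → P n := by
        intro k hk n hn hPk hb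
        change (m ||| (1 <<< k)).testBit n = true at hb
        rw [Nat.testBit_or, Nat.one_shiftLeft, Nat.testBit_two_pow] at hb
        simp at hb
        rcases hb with hb | rfl
        · exact h2 n hn hb
        · exact hPk
      have bit2 : ∀ k n, m.testBit n = true ∨ n = k → (Nat.lor m (Nat.shiftLeft 1 k)).testBit n = true := by
        intro k n hb
        change (m ||| (1 <<< k)).testBit n = true
        rw [Nat.testBit_or, Nat.one_shiftLeft, Nat.testBit_two_pow]
        simp; tauto
      have e2 : Nat.shiftLeft 2 w = Nat.shiftLeft 1 (w+1) := by
        show 2 <<< w = 1 <<< (w+1)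
        rw [Nat.one_shiftLeft, Nat.shiftLeft_eq, pow_succ, mul_comm]
      rw [e2] at hc
      have h4' := fun w' hw' => h4 w' (List.mem_cons_of_mem _ hw')
      have h4w := h4 w List.mem_cons_self
      by_cases hw : P w
      · have hw' : ¬ P (w+1) := fun h => h4w ⟨hw, h⟩
        have hm := bit w (Or.inl rfl)
        rw [hag _ (fun n hn h => hm n hn hw h)] at hb
        refine ih _ _ N (by simpa using hb) (fun n hn h => hm n hn hw h) ?_ h4' ?_ h6
        · intro n hn hP
          rcases h3 n hn hP with h | ⟨w', hw1, hw2⟩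
          · exact Or.inl (bit2 _ _ (Or.inl h))
          · rcases List.mem_cons.1 hw1 with rfl | hw1
            · rcases hw2 with rfl | rfl
              · exact Or.inl (bit2 _ _ (Or.inr rfl))
              · exact absurd hP hw'
            · exact Or.inr ⟨w', hw1, hw2⟩
        · simp [hw] at h5; simp; omega
      · by_cases hw' : P (w+1)
        · have hm := bit (w+1) (Or.inr rfl)
          rw [hag _ (fun n hn h => hm n hn hw' h)] at hc
          refine ih _ _ N (by simpa using hc) (fun n hn h => hm n hn hw' h) ?_ h4' ?_ h6
          · intro n hn hP
            rcases h3 n hn hP with h | ⟨w', hw1, hw2⟩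
            · exact Or.inl (bit2 _ _ (Or.inl h))
            · rcases List.mem_cons.1 hw1 with rfl | hw1
              · rcases hw2 with rfl | rfl
                · exact absurd hP hw
                · exact Or.inl (bit2 _ _ (Or.inr rfl))
              · exact Or.inr ⟨w', hw1, hw2⟩
          · simp [hw, hw'] at h5; simp; omega
        · refine ih _ _ N ha h2 ?_ h4' ?_ h6
          · intro n hn hP
            rcases h3 n hn hP with h | ⟨w', hw1, hw2⟩
            · exact Or.inl h
            · rcases List.mem_cons.1 hw1 with rfl | hw1
              · rcases hw2 with rfl | rfl
                · exact absurd hP hw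
                · exact absurd hP hw'
              · exact Or.inr ⟨w', hw1, hw2⟩
          · simpa [hw, hw'] using h5

end mask

section geo
variable {V U : Type} [AddCommGroup V] [Module K V] [AddCommGroup U] [Module K U]

/-- the vector with a given code -/
noncomputable def vec (B : Module.Basis (Fin 5) K V) (n : ℕ) : V :=
  ∑ i : Fin 5, (if n.testBit i then (1:K) else 0) • B i

theorem vec_xor (B : Module.Basis (Fin 5) K V) (m n : ℕ) :
    vec B (m ^^^ n) = vec B m + vec B n := by
  unfold vec
  rw [← Finset.sum_add_distrib]
  refine Finset.sum_congr rfl fun i _ => ?_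
  rw [← add_smul, Nat.testBit_xor]
  congr 1
  cases m.testBit i <;> cases n.testBit i <;> simp
  exact (ZModModule.add_self (1:K)).symm

theorem vec_fun (B : Module.Basis (Fin 5) K V) (φ : V →ₗ[K] K) (n : ℕ) :
    φ (vec B n) = ∑ i : Fin 5, if n.testBit i then φ (B i) else 0 := by
  unfold vec; rw [map_sum]
  refine Finset.sum_congr rfl fun i _ => ?_
  split <;> simp

theorem vec_inj (B : Module.Basis (Fin 5) K V) {m n : ℕ} (hm : m < 32) (hn : n < 32)
    (h : vec B m = vec B n) : m = n := by
  apply Nat.eq_of_testBit_eq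
  intro i
  by_cases hi : i < 5
  · have h1 : ∀ m, B.repr (vec B m) ⟨i, hi⟩ = if m.testBit i then (1:K) else 0 := by
      intro m; unfold vec
      rw [B.repr_sum_self]
    have h2 := h1 m
    rw [h, h1 n] at h2
    by_contra hne
    have : ∀ p q : Bool, p ≠ q → (if q then (1:K) else 0) ≠ if p then (1:K) else 0 := by decide
    exact this _ _ hne h2
  · have : 2 ^ 5 ≤ 2 ^ i := Nat.pow_le_pow_right (by norm_num) (by omega)
    rw [Nat.testBit_lt_two_pow (by omega), Nat.testBit_lt_two_pow (by omega)]

theorem vec_surj (B : Module.Basis (Fin 5) K V) (v : V) : ∃ n < 32, vec B n = v := by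
  have h : ∀ c : Fin 5 → K, ∃ n < 32, ∀ i : Fin 5, (if n.testBit i then (1:K) else 0) = c i := by
    decide
  obtain ⟨n, hn, h⟩ := h (fun i => B.repr v i)
  refine ⟨n, hn, ?_⟩
  unfold vec
  rw [← B.sum_repr v]
  exact Finset.sum_congr rfl fun i _ => by rw [h i]

theorem vec_count (B : Module.Basis (Fin 5) K V) (E : Set V) [DecidablePred fun n => vec B n ∈ E] :
    E.ncard = (List.range 32).countP (fun n => vec B n ∈ E) := by
  have h1 : E = vec B '' (((Finset.range 32).filter (fun n => vec B n ∈ E) : Finset ℕ) : Set ℕ) := by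
    ext v
    constructor
    · intro hv
      obtain ⟨n, hn, rfl⟩ := vec_surj B v
      exact ⟨n, by simp [hn, hv], rfl⟩
    · rintro ⟨n, hn, rfl⟩
      simp at hn; exact hn.2
  conv_lhs => rw [h1]
  rw [ncard_image_of_injOn, ncard_coe_finset]
  · rw [List.countP_eq_length_filter]
    rfl
  · intro a ha b hb hab
    simp at ha hb
    exact vec_inj B ha.1 hb.1 hab

theorem vec_ag [Finite V] (B : Module.Basis (Fin 5) K V) {E : Set V} (hE : AGF E) {m : ℕ}
    (hm : ∀ n < 32, m.testBit n = true → vec B n ∈ E) : ag m = false := by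
  rw [Bool.eq_false_iff]
  intro h
  obtain ⟨x, hx, hx0, hmx, g, hgx, ⟨n₀, hn₀, hgn₀⟩, hg, hcov⟩ := ag_sound h
  have hxv : vec B x ≠ 0 := by
    intro h
    apply hx0; apply vec_inj B hx (by norm_num)
    rw [h]; simp [vec]
  have hc := c1_mkQ (hm x hx hmx) hxv
  set f := (Submodule.span K {vec B x}).mkQ
  have hU : Finite (V ⧸ Submodule.span K {vec B x}) := Finite.of_surjective f hc.surj
  have hr := hc.finrank
  have h5 : Module.finrank K V = 5 := by rw [Module.finrank_eq_card_basis B]; rfl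
  let φ : V →ₗ[K] K := B.constr K (fun i => if g.testBit (2 ^ (i:ℕ)) then (1:K) else 0)
  have hφ : ∀ n < 32, φ (vec B n) = if g.testBit n then 1 else 0 := by
    intro n hn
    rw [vec_fun, hg n hn, Fin.sum_univ_five]
    simp only [φ, Module.Basis.constr_basis]
    have e1 : ∀ a c : Bool, (if a = true then (if c = true then (1:K) else 0) else 0) =
      if (a && c) = true then 1 else 0 := by decide
    have e2 : ∀ a c : Bool, (if a = true then (1:K) else 0) + (if c = true then (1:K) else 0) =
      if (a ^^ c) = true then 1 else 0 := by decide
    simp only [e1, e2, Bool.xor_assoc]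
    rfl
  have hle : Submodule.span K {vec B x} ≤ LinearMap.ker φ := by
    rw [Submodule.span_le]; rintro _ rfl
    show φ _ = 0
    rw [hφ x hx, hgx]; simp
  let ψ := Submodule.liftQ _ φ hle
  have hψ : ∀ v, ψ (f v) = φ v := fun v => Submodule.liftQ_apply _ _ _
  obtain ⟨u, hu, huE⟩ := rank4 (by omega) (hE.map hc.contr) ψ (by
    intro h0
    have := hψ (vec B n₀)
    rw [hφ n₀ hn₀, hgn₀, h0] at this; simp at this)
  obtain ⟨v, rfl⟩ := hc.surj u
  obtain ⟨n, hn, rfl⟩ := vec_surj B v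
  rw [hψ, hφ n hn] at hu
  have hgn : g.testBit n = true := by by_contra h; simp [h] at hu
  apply huE
  rcases hcov n hn hgn with h | h
  · exact ⟨_, hm n hn h, rfl⟩
  · refine ⟨_, hm _ (xor32 hn hx) h, ?_⟩
    rw [vec_xor, map_add, hc.apply, add_zero]

theorem mask5 [Finite V] (hV : Module.finrank K V = 5) {E : Set V} (hE : AGF E) (h0 : (0:V) ∈ E)
    {x : V} {f : V →ₗ[K] U} (hx : C1 E x f) (hk : ∀ P, IsPlane E P → x ∉ P) {b : Fin 4 → U}
    (hb : LinearIndependent K b) (hT : ∀ i, b i ∈ T E f) (lam : V →ₗ[K] K) (hlam : lam x = 1)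
    (h16 : 16 ≤ E.ncard) :
    E.ncard = 16 ∧ ((∃ u ∈ E, ∃ v ∈ E, u ≠ 0 ∧ v ≠ 0 ∧ u ≠ v ∧
      ∀ z, z ∈ E ∨ z + u ∈ E ∨ z + v ∈ E ∨ z + u + v ∈ E) →
      ∃ d ∈ E, lam d = 1 ∧ {e | e ∈ E ∧ e + d ∈ E}.ncard ≤ 8) := by
  classical
  have hU : Finite U := Finite.of_surjective f hx.surj
  obtain ⟨l, hl, hl0⟩ : ∃ l : Fin 4 → V, (∀ i, f (l i) = b i) ∧ ∀ i, lam (l i) = 0 := by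
    have : ∀ i, ∃ v, f v = b i ∧ lam v = 0 := by
      intro i
      obtain ⟨v, hv⟩ := hx.surj (b i)
      rcases k01 (lam v) with h | h
      · exact ⟨v, hv, h⟩
      · exact ⟨v + x, by rw [map_add, hx.apply, add_zero, hv], by
          rw [map_add, h, hlam]; exact aa 1⟩
    choose l hl using this
    exact ⟨l, fun i => (hl i).1, fun i => (hl i).2⟩
  have hLI : LinearIndependent K (Fin.cons x l : Fin 5 → V) := by
    rw [linearIndependent_finCons]
    constructor
    · apply LinearIndependent.of_comp f
      convert hb using 1
      exact funext hl
    · intro hm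
      have : Submodule.span K (range l) ≤ LinearMap.ker lam := by
        rw [Submodule.span_le]; rintro _ ⟨i, rfl⟩; exact hl0 i
      have := this hm
      rw [LinearMap.mem_ker, hlam] at this
      exact one_ne_zero this
  let B : Module.Basis (Fin 5) K V := basisOfLinearIndependentOfCardEqFinrank hLI (by simp [hV])
  have hB0 : B 0 = x := by simp [B]
  have hBs : ∀ i : Fin 4, B i.succ = l i := by intro i; simp [B]
  have hf : ∀ n, f (vec B n) = wd b (Finset.univ.filter (fun i : Fin 4 => n.testBit (i+1))) := by
    intro n
    unfold vec wd
    rw [map_sum, Fin.sum_univ_succ, hB0, map_smul, hx.apply, smul_zero, zero_add,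
      Finset.sum_filter]
    refine Finset.sum_congr rfl fun i _ => ?_
    rw [hBs, map_smul, hl]
    simp only [Fin.val_succ]
    split <;> simp
  have hlamv : ∀ n, lam (vec B n) = if n.testBit 0 then 1 else 0 := by
    intro n
    rw [vec_fun, Fin.sum_univ_succ, hB0, hlam]
    simp [hBs, hl0]
  have hTb : ∀ u ∈ T E f, ∃ i, u = b i := by
    have hTL := T_LI hE hx h0 hk
    have h1 := ncard_LI hTL
    have h2 : Module.finrank K (Submodule.span K (T E f)) ≤ Module.finrank K U :=
      Submodule.finrank_le _
    have h3 := hx.finrank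
    have h4 : (range b).ncard = 4 := by
      rw [← image_univ, ncard_image_of_injective _ hb.injective, ncard_univ,
        Nat.card_eq_fintype_card, Fintype.card_fin]
    have h5 : range b = T E f := by
      apply eq_of_subset_of_ncard_le
      · rintro _ ⟨i, rfl⟩; exact hT i
      · omega
      · exact Set.toFinite _
    intro u hu
    rw [← h5] at hu
    obtain ⟨i, rfl⟩ := hu
    exact ⟨i, rfl⟩
  have vx : vec B 1 = x := by
    unfold vec; rw [Fin.sum_univ_succ, hB0]; simp [Fin.sum_univ_succ, Nat.testBit, Nat.shiftRight_succ]
  have v0 : vec B 0 = 0 := by simp [vec]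
  have hbase : ∀ n ∈ [0,1,2,3,4,5,8,9,16,17], vec B n ∈ E := by
    have q : ∀ n ∈ [2,3,4,5,8,9,16,17], ∃ j : Fin 4,
      (Finset.univ.filter (fun i : Fin 4 => n.testBit (i+1))) = {j} := by decide
    intro n hn
    by_cases h2 : n ∈ [2,3,4,5,8,9,16,17]
    · obtain ⟨j, hj⟩ := q n h2
      have := hf n
      rw [hj, wd_single] at this
      exact (hT j).2 _ this
    · have : n = 0 ∨ n = 1 := by simp at hn h2; omega
      rcases this with rfl | rfl
      · rw [v0]; exact h0
      · rw [vx]; exact hx.mem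
  have h30 : ∀ n ∈ [30, 31], vec B n ∉ E := by
    have q : ∀ n ∈ [30,31], 4 ≤ (Finset.univ.filter (fun i : Fin 4 => n.testBit (i+1))).card := by
      decide
    intro n hn hh
    exact W4 hE hx hb hT (q n hn) ⟨_, hh, hf n⟩
  have hw : ∀ w ∈ wds, ¬ (vec B w ∈ E ∧ vec B (w+1) ∈ E) := by
    have q : ∀ w ∈ wds, (∀ j, (Finset.univ.filter (fun i : Fin 4 => w.testBit (i+1))) ≠ {j}) ∧
      (Finset.univ.filter (fun i : Fin 4 => w.testBit (i+1))) ≠ ∅ ∧ w + 1 = w ^^^ 1 := by decide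
    rintro w hw ⟨h1, h2⟩
    obtain ⟨q1, q2, q3⟩ := q w hw
    rw [q3, vec_xor, vx] at h2
    have h3 : f (vec B w) ≠ 0 := by rw [hf, Ne, wd_eq_zero hb]; exact q2
    have : f (vec B w) ∈ T E f := by
      rw [hx.mem_T]
      refine ⟨?_, ?_, h1, h2⟩
      · intro h; apply h3; rw [h, map_zero]
      · intro h; apply h3; rw [h, hx.apply]
    obtain ⟨j, hj⟩ := hTb _ this
    rw [hf, ← wd_single b j] at hj
    exact q1 j (wd_inj hb hj)
  have hcount : E.ncard = 10 + wds.countP (fun w => vec B w ∈ E ∨ vec B (w+1) ∈ E) := by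
    rw [vec_count B E]
    have e : ∀ w ∈ wds, (if (vec B w ∈ E ∨ vec B (w+1) ∈ E) then 1 else 0) =
        (if vec B w ∈ E then 1 else 0) + (if vec B (w+1) ∈ E then 1 else 0) := by
      intro w hw'
      have := hw w hw'
      by_cases h1 : vec B w ∈ E <;> by_cases h2 : vec B (w+1) ∈ E <;> simp_all
    simp only [wds, List.mem_cons, List.not_mem_nil, or_false, forall_eq_or_imp, forall_eq] at e hbase h30
    have er : List.range 32 = [0,1,2,3,4,5,6,7,8,9,10,11,12,13,14,15,16,17,18,19,20,21,22,23,24,25,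
      26,27,28,29,30,31] := rfl
    rw [er]
    simp only [wds, List.countP_cons, List.countP_nil, hbase, h30, decide_eq_true_eq, e, if_true, if_false]
    simp only [Nat.reduceAdd]
    omega
  have hs := srch_sound (fun n => vec B n ∈ E) (fun m hm => vec_ag B hE hm) wds 197439 0
    (E.ncard - 10) srch_ok ?_ ?_ hw (by rw [hcount]; simp) (by omega)
  · obtain ⟨m, hm, hmE⟩ := hs
    unfold leaf at hm
    have n5 : Nat.ble (E.ncard - 10) 5 = false := by
      rw [Bool.eq_false_iff]; intro h; have := Nat.le_of_ble_eq_true h; omega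
    rw [n5, Bool.false_or, Bool.and_eq_true] at hm
    have n6 := Nat.le_of_ble_eq_true hm.1
    refine ⟨by omega, ?_⟩
    rintro ⟨u, hu, v, hv, hu0, hv0, huv, hcov⟩
    obtain ⟨p, hp, rfl⟩ := vec_surj B u
    obtain ⟨q, hq, rfl⟩ := vec_surj B v
    have hfm : fm m = true := by
      apply fm_sound hp hq
      · rintro rfl; exact hu0 v0
      · rintro rfl; exact hv0 v0
      · rintro rfl; exact huv rfl
      · rw [hmE p hp]; exact hu
      · rw [hmE q hq]; exact hv
      · intro n hn
        rw [hmE n hn, hmE _ (xor32 hn hp), hmE _ (xor32 hn hq), hmE _ (xor32 (xor32 hn hq) hp),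
          vec_xor, vec_xor, vec_xor, vec_xor, add_right_comm]
        exact hcov _
    rw [hfm, Bool.not_true, Bool.or_false, anyL_eq, List.any_eq_true] at hm
    obtain ⟨d, hd, hd2⟩ := hm.2
    have hd' : ∀ d ∈ [1,3,5,7,9,11,13,15,17,19,21,23,25,27,29,31], d < 32 ∧ d.testBit 0 = true := by
      decide
    obtain ⟨hd32, hdo⟩ := hd' d hd
    rw [Bool.and_eq_true, tb_eq, hmE d hd32, cntL_eq] at hd2
    refine ⟨_, hd2.1, by rw [hlamv, hdo]; rfl, ?_⟩
    rw [vec_count B]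
    refine le_trans (le_of_eq ?_) (Nat.le_of_ble_eq_true hd2.2)
    have : 0 :: codes = List.range 32 := rfl
    rw [this]
    apply List.countP_congr
    intro n hn
    have hn := List.mem_range.1 hn
    have e : n.xor d = n ^^^ d := rfl
    rw [decide_eq_true_iff, mem_setOf_eq, Bool.and_eq_true, tb_eq, tb_eq, hmE n hn, e,
      hmE _ (xor32 hn hd32), vec_xor]
  · have q : ∀ n < 32, Nat.testBit 197439 n = true → n ∈ [0,1,2,3,4,5,8,9,16,17] := by decide
    intro n hn h
    exact hbase n (q n hn h)
  · have q : ∀ n < 32, Nat.testBit 197439 n = true ∨ n ∈ [30, 31] ∨ 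
      ∃ w ∈ wds, n = w ∨ n = w + 1 := by decide
    intro n hn h
    rcases q n hn with h1 | h1 | h1
    · exact Or.inl h1
    · exact absurd h (h30 n h1)
    · exact Or.inr h1
end geo
end NR

namespace NR

section r5
variable {V U X : Type} [AddCommGroup V] [Module K V] [AddCommGroup U] [Module K U]
variable {E : Set V} {x : V} {f : V →ₗ[K] U}

theorem sub4 [Finite V] (hE : AGF E) (S : Submodule K V) (hS : Module.finrank K S = 4) :
    (E ∩ S).ncard ≤ 12 ∧ (12 ≤ (E ∩ S).ncard → ∃ P, IsPlane E P ∧ P ≤ S) := by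
  have h1 := hE.comap S.subtype S.subtype_injective
  have e : S.subtype '' (S.subtype ⁻¹' E) = E ∩ S := by
    rw [image_preimage_eq_inter_range]; simp
  have h2 : (E ∩ S).ncard = (S.subtype ⁻¹' E).ncard := by
    rw [← e, ncard_image_of_injective _ S.subtype_injective]
  rw [h2]
  refine ⟨rank4_le hS h1, fun h => ?_⟩
  obtain ⟨P, hP⟩ := rank4_plane hS h1 h
  refine ⟨P.map S.subtype, ⟨?_, ?_⟩, Submodule.map_subtype_le S P⟩
  · rw [← hP.1]
    exact (Submodule.equivMapOfInjective _ S.subtype_injective P).finrank_eq.symm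
  · rintro _ ⟨p, hp, rfl⟩
    exact hP.2 hp

theorem five_planes [Finite V] (hV : Module.finrank K V = 5) (hE : AGF E) {P Q : Submodule K V}
    (hP : IsPlane E P) (hQ : IsPlane E Q) (hne : P ≠ Q) : E.ncard ≤ 14 := by
  have h1 := planes_meet hE hP hQ hne
  have h2 := Submodule.finrank_sup_add_finrank_inf_eq P Q
  have h3 : Module.finrank K (P ⊔ Q : Submodule K V) ≤ Module.finrank K V := Submodule.finrank_le _
  rw [hP.1, hQ.1] at h2
  have h4 : Module.finrank K (P ⊓ Q : Submodule K V) = 1 := by omega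
  have h5 : P ⊔ Q = ⊤ := Submodule.eq_top_of_finrank_eq (by omega)
  have h6 : E ⊆ (P : Set V) ∪ Q := fun z hz =>
    planes_span hE hP hQ h4 hz (by rw [h5]; trivial)
  have h7 := ncard_union_add_ncard_inter (P : Set V) (Q : Set V)
  have h8 : ((P : Set V) ∩ Q).ncard = 2 := by
    rw [← Submodule.coe_inf, ncard_sub, h4]; rfl
  rw [hP.ncard, hQ.ncard, h8] at h7
  have := ncard_le_ncard h6 (Set.toFinite _)
  omega

theorem C1.ncard_D [Finite V] (h : C1 E x f) (h0 : (0:V) ∈ E) :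
    {e | e ∈ E ∧ e + x ∈ E}.ncard = 2 * (T E f).ncard + 2 := by
  have hU : Finite U := Finite.of_surjective f h.surj
  set D := {e | e ∈ E ∧ e + x ∈ E}
  have hx : C1 D x f := ⟨⟨h.mem, by rw [aa]; exact h0⟩, h.ne, h.surj, h.ker⟩
  have hD : ∀ e, e ∈ D → e + x ∈ D := by
    rintro e ⟨h1, h2⟩
    exact ⟨h2, by rwa [add_assoc, aa, add_zero]⟩
  have h00 : (0:V) ∈ D := ⟨h0, by rw [zero_add]; exact h.mem⟩
  have h1 := hx.count h00
  have h2 : T D f = T E f := by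
    ext u
    obtain ⟨e, rfl⟩ := h.surj u
    rw [hx.mem_T, h.mem_T]
    constructor
    · rintro ⟨a, b, c, d⟩; exact ⟨a, b, c.1, d.1⟩
    · rintro ⟨a, b, c, d⟩; exact ⟨a, b, ⟨c, d⟩, hD e ⟨c, d⟩⟩
  have h3 : f '' D = insert 0 (T E f) := by
    ext u
    obtain ⟨e, rfl⟩ := h.surj u
    rw [mem_insert_iff, h.mem_T, h.eq_zero_iff]
    constructor
    · rintro ⟨e', he', h4⟩
      rcases h.eq_iff.1 h4.symm with rfl | rfl
      · have := he'.1; have := he'.2; tauto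
      · have := (hD _ he').1; have := (hD _ he').2; tauto
    · rintro ((rfl | rfl) | ⟨_, _, h4, h5⟩)
      · exact ⟨_, h00, rfl⟩
      · exact ⟨_, hx.mem, rfl⟩
      · exact ⟨_, ⟨h4, h5⟩, rfl⟩
  have h4 : (0:U) ∉ T E f := fun h => h.1 rfl
  rw [h2, h3, ncard_insert_of_notMem h4] at h1
  omega

theorem exists_b [Finite V] (hx : C1 E x f) (hT : LinearIndependent K ((↑) : T E f → U)) {n : ℕ}
    (h : n ≤ (T E f).ncard) : ∃ b : Fin n → U, LinearIndependent K b ∧ ∀ i, b i ∈ T E f := by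
  have hU : Finite U := Finite.of_surjective f hx.surj
  have : Fintype (T E f) := Fintype.ofFinite _
  have h1 : n ≤ Fintype.card (T E f) := by
    rw [← Nat.card_eq_fintype_card]; exact h
  obtain ⟨g⟩ : Nonempty (Fin n ↪ T E f) := by
    apply Function.Embedding.nonempty_of_card_le; simpa using h1
  exact ⟨fun i => (g i : U), hT.comp g g.injective, fun i => (g i).2⟩

theorem exists_lam {v : V} (hv : v ≠ 0) : ∃ lam : V →ₗ[K] K, lam v = 1 := by
  have : LinearIndependent K (fun _ : Unit => v) := by
    rw [linearIndependent_unique_iff]; exact hv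
  obtain ⟨φ, hφ⟩ := exists_functional this (fun _ => 1)
  exact ⟨φ, hφ ()⟩

theorem rank5 [Finite V] (hV : Module.finrank K V = 5) (hE : AGF E) (h0 : (0:V) ∈ E) :
    E.ncard ≤ 16 := by
  by_contra hcon
  push Not at hcon
  obtain ⟨c, hc, hc0, hk⟩ : ∃ c ∈ E, c ≠ 0 ∧ ∀ P, IsPlane E P → c ∉ P := by
    by_cases hP : ∃ P, IsPlane E P
    · obtain ⟨P, hP⟩ := hP
      have : ¬ E ⊆ P := by
        intro h
        have := ncard_le_ncard h (Set.toFinite _)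
        rw [hP.ncard] at this; omega
      obtain ⟨c, hc, hcP⟩ := not_subset.1 this
      refine ⟨c, hc, by rintro rfl; exact hcP P.zero_mem, fun Q hQ hcQ => ?_⟩
      by_cases hne : P = Q
      · subst hne; exact hcP hcQ
      · have := five_planes hV hE hP hQ hne; omega
    · have : ¬ E ⊆ {0} := by
        intro h
        have := ncard_le_ncard h (Set.toFinite _)
        rw [ncard_singleton] at this; omega
      obtain ⟨c, hc, hc0⟩ := not_subset.1 this
      exact ⟨c, hc, hc0, fun P h => absurd ⟨P, h⟩ hP⟩
  have hx := c1_mkQ hc hc0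
  set f := (Submodule.span K {c}).mkQ
  have hU : Finite (V ⧸ Submodule.span K {c}) := Finite.of_surjective f hx.surj
  have h1 := hx.finrank
  have h2 := rank4_le (by omega) (hE.map hx.contr)
  have h3 := hx.count h0
  obtain ⟨b, hb, hbT⟩ := exists_b hx (T_LI hE hx h0 hk) (n := 4) (by omega)
  obtain ⟨lam, hlam⟩ := exists_lam hc0
  have := (mask5 hV hE h0 hx hk hb hbT lam hlam (by omega)).1
  omega

/-- standard form of a Fano minor -/
theorem FM.std [Finite V] (hs : Submodule.span K E = ⊤) (h : FM E) :
    ∃ Z : Submodule K V, ∃ C ⊆ E, Z = Submodule.span K C ∧ LinearIndependent K ((↑) : C → V) ∧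
      Module.finrank K Z + 3 = Module.finrank K V ∧ ∀ v, ∃ e ∈ E, v + e ∈ Z := by
  obtain ⟨U, _, _, f, hf, P, hP⟩ := h
  have key : ∀ n, ∀ W Z : Submodule K V, Module.finrank K V = Module.finrank K W + n →
      Module.finrank K W = Module.finrank K Z + 3 → Z ≤ W → (∃ C ⊆ E, Z = Submodule.span K C) →
      (∀ w ∈ W, ∃ e ∈ E, w + e ∈ Z) →
      ∃ Z : Submodule K V, (∃ C ⊆ E, Z = Submodule.span K C) ∧
      Module.finrank K Z + 3 = Module.finrank K V ∧ ∀ v, ∃ e ∈ E, v + e ∈ Z := by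
    intro n
    induction n with
    | zero =>
      intro W Z h1 h2 h3 h4 h5
      have : W = ⊤ := Submodule.eq_top_of_finrank_eq (by omega)
      subst this
      exact ⟨Z, h4, by omega, fun v => h5 v trivial⟩
    | succ n ih =>
      intro W Z h1 h2 h3 h4 h5
      have : ¬ E ⊆ W := by
        intro h
        rw [← Submodule.span_le, hs, top_le_iff] at h
        subst h; simp at h1
      obtain ⟨e, he, heW⟩ := not_subset.1 this
      have hr : ∀ Y : Submodule K V, Y ≤ W →
          Module.finrank K (Y ⊔ Submodule.span K {e} : Submodule K V) = Module.finrank K Y + 1 := by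
        intro Y hY
        have h6 := Submodule.finrank_sup_add_finrank_inf_eq Y (Submodule.span K {e})
        have h7 : Y ⊓ Submodule.span K {e} = ⊥ := by
          rw [eq_bot_iff]
          rintro v ⟨hv1, hv2⟩
          rcases span_single_mem hv2 with rfl | rfl
          · exact Submodule.zero_mem _
          · exact absurd (hY hv1) heW
        rw [h7, finrank_bot, finrank_span_singleton (by rintro rfl; exact heW W.zero_mem)] at h6
        omega
      refine ih (W ⊔ Submodule.span K {e}) (Z ⊔ Submodule.span K {e}) ?_ ?_ ?_ ?_ ?_
      · rw [hr W le_rfl]; omega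
      · rw [hr W le_rfl, hr Z h3]; omega
      · exact sup_le_sup_right h3 _
      · obtain ⟨C, hC, rfl⟩ := h4
        exact ⟨C ∪ {e}, union_subset hC (by simpa using he), by rw [Submodule.span_union]⟩
      · intro w hw
        obtain ⟨w', hw', s, hs, rfl⟩ := Submodule.mem_sup.1 hw
        obtain ⟨e', he', h8⟩ := h5 w' hw'
        refine ⟨e', he', ?_⟩
        rw [add_right_comm]
        exact Submodule.add_mem _ (Submodule.mem_sup_left h8) (Submodule.mem_sup_right hs)
  obtain ⟨C, hC, hk⟩ := hf.ker
  have hfin : Module.finrank K (P.comap f) = 3 + Module.finrank K (LinearMap.ker f) := by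
    have h1 := finrank_map_ker f (P.comap f)
    rw [Submodule.map_comap_eq_of_surjective hf.surj, inf_eq_right.2 (LinearMap.ker_le_comap f),
      hP.1] at h1
    exact h1.symm
  obtain ⟨n, hn⟩ := Nat.exists_eq_add_of_le (Submodule.finrank_le (P.comap f))
  obtain ⟨Z, ⟨C', hC', hZ⟩, h2, h3⟩ := key n (P.comap f) (LinearMap.ker f) hn (by omega)
    (LinearMap.ker_le_comap f) ⟨C, hC, hk⟩ (by
      intro w hw
      obtain ⟨e, he, h⟩ := hP.2 hw
      exact ⟨e, he, by rw [LinearMap.mem_ker, map_add, h, aa]⟩)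
  obtain ⟨B, hB, hBs, hLI⟩ := exists_linearIndependent K C'
  exact ⟨Z, B, hB.trans hC', by rw [hBs, hZ], hLI, h2, h3⟩

theorem R5 [Finite V] (hV : Module.finrank K V = 5) (hE : AGF E) (h0 : (0:V) ∈ E)
    (h16 : 16 ≤ E.ncard) (hFM : FM E) (lam : V →ₗ[K] K) (hl : lam ≠ 0) :
    ∃ d ∈ E, lam d = 1 ∧ {e | e ∈ E ∧ e + d ∈ E}.ncard ≤ 8 := by
  by_contra hcon
  push Not at hcon
  have hker : ∀ φ : V →ₗ[K] K, φ ≠ 0 → Module.finrank K (LinearMap.ker φ) = 4 := by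
    intro φ hφ
    obtain ⟨v, hv⟩ : ∃ v, φ v ≠ 0 := by
      by_contra h; push Not at h; exact hφ (LinearMap.ext h)
    have h1 := finrank_inf_ker (P := ⊤) (φ := φ) (p := v) trivial (kne hv)
    rw [top_inf_eq, finrank_top] at h1
    omega
  have hspan : Submodule.span K E = ⊤ := by
    by_contra h
    obtain ⟨φ, hφ, hle⟩ := Submodule.exists_le_ker_of_lt_top _ (lt_top_iff_ne_top.2 h)
    have h1 := (sub4 hE _ (hker φ hφ)).1
    rw [inter_eq_left.2 (Submodule.span_le.1 hle)] at h1
    omega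
  have h1 := sub4 hE _ (hker lam hl)
  have huniq : ∀ P Q, IsPlane E P → IsPlane E Q → P = Q := by
    intro P Q hP hQ
    by_contra hne
    have := five_planes hV hE hP hQ hne; omega
  obtain ⟨d, hd, hld, hk⟩ : ∃ d ∈ E, lam d = 1 ∧ ∀ P, IsPlane E P → d ∉ P := by
    by_contra hno
    push Not at hno
    have hex : ∃ d ∈ E, lam d = 1 := by
      by_contra h
      push Not at h
      have : E ⊆ LinearMap.ker lam := fun e he => kne1 (h e he)
      rw [inter_eq_left.2 this] at h1
      omega
    obtain ⟨d, hd, hld⟩ := hex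
    obtain ⟨P, hP, hdP⟩ := hno d hd hld
    have h2 : E ⊆ (E ∩ LinearMap.ker lam) ∪ ((P : Set V) \ (P ⊓ LinearMap.ker lam : Submodule K V)) := by
      intro e he
      rcases k01 (lam e) with h | h
      · exact Or.inl ⟨he, h⟩
      · obtain ⟨Q, hQ, heQ⟩ := hno e he h
        rw [huniq Q P hQ hP] at heQ
        refine Or.inr ⟨heQ, fun h' => ?_⟩
        have : e ∈ LinearMap.ker lam := h'.2
        rw [LinearMap.mem_ker, h] at this
        exact one_ne_zero this
    have h3 := ncard_le_ncard h2 (Set.toFinite _)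
    have h4 := ncard_union_le (E ∩ LinearMap.ker lam)
      ((P : Set V) \ (P ⊓ LinearMap.ker lam : Submodule K V))
    have h5 := finrank_inf_ker hdP hld
    have h6 : ((P : Set V) \ (P ⊓ LinearMap.ker lam : Submodule K V)).ncard = 4 := by
      rw [ncard_diff (by exact fun _ h => h.1) (Set.toFinite _), hP.ncard, ncard_sub]
      have : Module.finrank K (P ⊓ LinearMap.ker lam : Submodule K V) = 2 := by
        rw [hP.1] at h5; omega
      rw [this]; rfl
    obtain ⟨Q, hQ, hQk⟩ := h1.2 (by omega)
    have := huniq P Q hP hQ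
    subst this
    have := hQk hdP
    rw [LinearMap.mem_ker, hld] at this
    exact one_ne_zero this
  have hd0 : d ≠ 0 := by rintro rfl; simp at hld
  have hx := c1_mkQ hd hd0
  set f := (Submodule.span K {d}).mkQ
  have h2 := hx.ncard_D h0
  have h3 := hcon d hd hld
  obtain ⟨b, hb, hbT⟩ := exists_b hx (T_LI hE hx h0 hk) (n := 4) (by omega)
  obtain ⟨d', hd', hld', h4⟩ := (mask5 hV hE h0 hx hk hb hbT lam hld h16).2 (by
    obtain ⟨Z, C, hC, hZ, hLI, hr, hcov⟩ := hFM.std hspan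
    have hc2 : C.ncard = 2 := by rw [ncard_LI hLI, ← hZ]; omega
    obtain ⟨u, v, huv, rfl⟩ := ncard_eq_two.1 hc2
    have hne := hLI.ne_zero
    refine ⟨u, hC (by simp), v, hC (by simp), hne ⟨u, by simp⟩, hne ⟨v, by simp⟩, huv, ?_⟩
    intro z
    obtain ⟨e, he, h⟩ := hcov z
    rw [hZ] at h
    rcases span_pair_mem h with h | h | h | h
    · rw [eq_of_add h]; exact Or.inl he
    · refine Or.inr (Or.inl ?_)
      rw [← h, ← add_assoc, aa, zero_add]; exact he
    · refine Or.inr (Or.inr (Or.inl ?_))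
      rw [← h, ← add_assoc, aa, zero_add]; exact he
    · refine Or.inr (Or.inr (Or.inr ?_))
      rw [add_assoc, ← h, ← add_assoc, aa, zero_add]; exact he)
  have := hcon d' hd' hld'
  omega
end r5
end NR

namespace NR

section good
variable {V U X : Type} [AddCommGroup V] [Module K V] [AddCommGroup U] [Module K U]
variable {E : Set V} {x : V} {f : V →ₗ[K] U}

/-- the contraction of a point -/
abbrev qt (x : V) : V →ₗ[K] (V ⧸ Submodule.span K ({x} : Set V)) := (Submodule.span K {x}).mkQ

theorem sub5 [Finite V] (hE : AGF E) (h0 : (0:V) ∈ E) (S : Submodule K V)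
    (hS : Module.finrank K S = 5) : (E ∩ S).ncard ≤ 16 := by
  have h1 := hE.comap S.subtype S.subtype_injective
  have e : S.subtype '' (S.subtype ⁻¹' E) = E ∩ S := by
    rw [image_preimage_eq_inter_range]; simp
  have h2 : (E ∩ S).ncard = (S.subtype ⁻¹' E).ncard := by
    rw [← e, ncard_image_of_injective _ S.subtype_injective]
  rw [h2]
  exact rank5 hS h1 (by simpa using h0)

/-- restricting to the preimage of a subspace of a contraction -/
theorem C1.restrict (hx : C1 E x f) (S : Submodule K U) :
    C1 (E ∩ S.comap f) x f ∧ f '' (E ∩ S.comap f) = f '' E ∩ S ∧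
      T (E ∩ S.comap f) f = T E f ∩ S := by
  refine ⟨⟨⟨hx.mem, ?_⟩, hx.ne, hx.surj, hx.ker⟩, ?_, ?_⟩
  · show f x ∈ S
    rw [hx.apply]; exact S.zero_mem
  · exact image_inter_preimage f E S
  · ext u
    constructor
    · rintro ⟨h1, h2⟩
      obtain ⟨e, rfl⟩ := hx.surj u
      exact ⟨⟨h1, fun e he => (h2 e he).1⟩, (h2 e rfl).2⟩
    · rintro ⟨⟨h1, h2⟩, h3⟩
      refine ⟨h1, fun e he => ⟨h2 e he, ?_⟩⟩
      show f e ∈ S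
      rw [he]; exact h3

/-- a basis of the span of `T` inside `T` -/
theorem exists_basis_T (E : Set V) (f : V →ₗ[K] U) (S : Set U) (hS : S ⊆ T E f)
    (hLI : LinearIndepOn K id S) :
    ∃ B ⊆ T E f, S ⊆ B ∧ Submodule.span K B = Submodule.span K (T E f) ∧
      LinearIndependent K ((↑) : B → U) := by
  obtain ⟨B, hB, hSB, hT, hLI'⟩ := exists_linearIndepOn_id_extension hLI hS
  refine ⟨B, hB, hSB, le_antisymm (Submodule.span_mono hB) (Submodule.span_le.2 hT), hLI'⟩

/-- if `T` is spanning, planes lift -/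
theorem full_lift [Finite V] (hE : AGF E) (h0 : (0:V) ∈ E) (hx : C1 E x f)
    (hT : Submodule.span K (T E f) = ⊤) {P : Submodule K U} (hP : IsPlane (f '' E) P) :
    (∃ t₁ ∈ T E f, ∃ t₂ ∈ T E f, ∃ t₃ ∈ T E f, t₁ ∈ P ∧ t₂ ∈ P ∧ t₃ ∈ P ∧ t₁ ≠ t₂ ∧ t₁ ≠ t₃ ∧
      t₂ ≠ t₃) ∧ ∃ Q, IsPlane E Q ∧ Q ≤ P.comap f := by
  classical
  have hU : Finite U := Finite.of_surjective f hx.surj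
  obtain ⟨B, hB, hs, hLI, -⟩ := T_struct hE hx
  obtain ⟨i, j, k, hij, hik, hjk, hi, hj, hk⟩ := full_plane hE hx hLI (fun i => hB i.2) hP (by
    rw [Subtype.range_val, hs, hT]; exact le_top)
  have n12 : (i : U) ≠ j := fun h => hij (Subtype.ext h)
  have n13 : (i : U) ≠ k := fun h => hik (Subtype.ext h)
  have n23 : (j : U) ≠ k := fun h => hjk (Subtype.ext h)
  refine ⟨⟨i, hB i.2, j, hB j.2, k, hB k.2, hi, hj, hk, n12, n13, n23⟩, ?_⟩
  obtain ⟨h1, h2, h3⟩ := hx.restrict P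
  have h4 := h1.count ⟨h0, by show f 0 ∈ P; rw [map_zero]; exact P.zero_mem⟩
  rw [h2, inter_eq_right.2 hP.2, hP.ncard, h3] at h4
  have h5 : 3 ≤ (T E f ∩ P).ncard := by
    have : ({(i:U), (j:U), (k:U)} : Set U).ncard = 3 := ncard_eq_three.2 ⟨_, _, _, n12, n13, n23, rfl⟩
    rw [← this]
    apply ncard_le_ncard _ (Set.toFinite _)
    rintro _ (rfl | rfl | rfl)
    · exact ⟨hB i.2, hi⟩
    · exact ⟨hB j.2, hj⟩
    · exact ⟨hB k.2, hk⟩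
  refine (sub4 hE (P.comap f) (by rw [hx.finrank_comap, hP.1])).2 (by omega)

theorem C1.nemap {W : Type} [AddCommGroup W] [Module K W] {c d : V} {h : V →ₗ[K] W}
    (hc : C1 E c f) (hd : C1 E d h) (hcd : c ≠ d) :
    C1 (f '' E) (f d) (qt (f d)) := by
  refine c1_mkQ ⟨d, hd.mem, rfl⟩ ?_
  rw [Ne, hc.eq_zero_iff]
  rintro (h | h)
  · exact hd.ne h
  · exact hcd h.symm

/-- commuting contractions: the comparison map -/
theorem C1.square {W : Type} [AddCommGroup W] [Module K W] {c d : V} {h : V →ₗ[K] W}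
    (hc : C1 E c f) (hd : C1 E d h) (hcd : c ≠ d) :
    ∃ k : W →ₗ[K] (U ⧸ Submodule.span K ({f d} : Set U)),
      (∀ v, k (h v) = qt (f d) (f v)) ∧ C1 (h '' E) (h c) k ∧
      k '' (h '' E) = qt (f d) '' (f '' E) ∧
      ∀ u ∈ T E h, k u ≠ 0 → k u ∈ T (f '' E) (qt (f d)) := by
  have hfd := hc.nemap hd hcd
  have hle : LinearMap.ker h ≤ LinearMap.ker (qt (f d) ∘ₗ f) := by
    rw [hd.ker, Submodule.span_le]
    intro v hv
    rw [mem_singleton_iff.1 hv]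
    exact hfd.apply
  let k0 := (LinearMap.ker h).liftQ _ hle
  let e := h.quotKerEquivOfSurjective hd.surj
  let k : W →ₗ[K] (U ⧸ Submodule.span K ({f d} : Set U)) := k0 ∘ₗ e.symm.toLinearMap
  have hk : ∀ v, k (h v) = qt (f d) (f v) := by
    intro v
    have : e.symm (h v) = (LinearMap.ker h).mkQ v := by
      rw [LinearEquiv.symm_apply_eq]; rfl
    show k0 (e.symm (h v)) = _
    rw [this]; exact Submodule.liftQ_apply _ _ _
  have hks : Function.Surjective k := by
    intro u
    obtain ⟨u', rfl⟩ := hfd.surj u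
    obtain ⟨v, rfl⟩ := hc.surj u'
    exact ⟨h v, hk v⟩
  refine ⟨k, hk, ⟨⟨c, hc.mem, rfl⟩, ?_, hks, ?_⟩, ?_, ?_⟩
  · rw [Ne, hd.eq_zero_iff]
    rintro (h | h)
    · exact hc.ne h
    · exact hcd h
  · ext w
    obtain ⟨v, rfl⟩ := hd.surj w
    rw [LinearMap.mem_ker, hk, hfd.eq_zero_iff, hc.eq_zero_iff, hc.eq_iff]
    constructor
    · rintro ((rfl | rfl) | (rfl | rfl))
      · rw [map_zero]; exact Submodule.zero_mem _
      · exact Submodule.mem_span_singleton_self _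
      · rw [hd.apply]; exact Submodule.zero_mem _
      · rw [map_add, hd.apply, zero_add]; exact Submodule.mem_span_singleton_self _
    · intro hm
      rcases span_single_mem hm with h1 | h1
      · rcases hd.eq_zero_iff.1 h1 with rfl | rfl <;> simp
      · rcases hd.eq_iff.1 h1 with rfl | rfl
        · simp
        · rw [add_comm]; simp
  · rw [image_image, image_image]
    exact image_congr fun v _ => hk v
  · intro u hu hne
    obtain ⟨e, rfl⟩ := hd.surj u
    rw [hk] at hne ⊢
    obtain ⟨-, -, h1, h2⟩ := hd.mem_T.1 hu
    rw [hfd.mem_T]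
    refine ⟨?_, ?_, ⟨e, h1, rfl⟩, ⟨e + d, h2, by rw [map_add]⟩⟩
    · intro h; rw [h, map_zero] at hne; exact hne rfl
    · intro h; rw [h, hfd.apply] at hne; exact hne rfl

theorem span_T_le {W : Type} [AddCommGroup W] [Module K W] {A : Set U} {A' : Set W}
    {k : U →ₗ[K] W} (h : ∀ u ∈ A, k u ≠ 0 → k u ∈ A') :
    (Submodule.span K A).map k ≤ Submodule.span K A' := by
  rw [Submodule.map_span, Submodule.span_le]
  rintro _ ⟨u, hu, rfl⟩
  by_cases h0 : k u = 0
  · rw [h0]; exact Submodule.zero_mem _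
  · exact Submodule.subset_span (h u hu h0)

/-- good contraction when there are no planes -/
theorem caseII : ∀ (n : ℕ) (V : Type) [AddCommGroup V] [Module K V] [Finite V] (E : Set V),
    AGF E → (0:V) ∈ E → ∀ (U : Type) [AddCommGroup U] [Module K U] (f : V →ₗ[K] U),
    IsContr E f → Module.finrank K (LinearMap.ker f) = n → (∃ P, IsPlane (f '' E) P) →
    (∃ P, IsPlane E P) ∨ ∃ c ∈ E, c ≠ 0 ∧ Submodule.span K (T E (qt c)) ≠ ⊤ ∧ FM (qt c '' E) := by
  intro n
  induction n with
  | zero =>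
    intro V _ _ _ E hE h0 U _ _ f hf hn ⟨P, hP⟩
    left
    have hk : LinearMap.ker f = ⊥ := Submodule.finrank_eq_zero.1 hn
    have hinj := LinearMap.ker_eq_bot.1 hk
    refine ⟨P.comap f, ?_, ?_⟩
    · have h1 := finrank_map_ker f (P.comap f)
      rw [Submodule.map_comap_eq_of_surjective hf.surj, hk, inf_bot_eq, finrank_bot, hP.1] at h1
      exact h1.symm
    · intro e he
      obtain ⟨e', he', h⟩ := hP.2 he
      rwa [← hinj h]
  | succ n ih =>
    intro V _ _ _ E hE h0 U _ _ f hf hn ⟨P, hP⟩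
    obtain ⟨C, hC, hk⟩ := hf.ker
    obtain ⟨c, hcC, hc0⟩ : ∃ c ∈ C, c ≠ 0 := by
      by_contra h
      push Not at h
      have : Submodule.span K C = ⊥ := by rw [Submodule.span_eq_bot]; exact h
      rw [hk, this, finrank_bot] at hn; omega
    have hx := c1_mkQ (hC hcC) hc0
    have hU : Finite (V ⧸ Submodule.span K {c}) := Finite.of_surjective _ hx.surj
    have hle : Submodule.span K {c} ≤ LinearMap.ker f := by
      rw [Submodule.span_le, hk]; rintro _ rfl; exact Submodule.subset_span hcC
    let g := (Submodule.span K {c}).liftQ f hle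
    have hg : ∀ v, g (qt c v) = f v := fun v => Submodule.liftQ_apply _ _ _
    have hgk : LinearMap.ker g = (LinearMap.ker f).map (qt c) := by
      exact Submodule.ker_liftQ _ _ _
    have hgc : IsContr (qt c '' E) g := by
      refine ⟨?_, qt c '' C, image_mono hC, ?_⟩
      · intro u
        obtain ⟨v, rfl⟩ := hf.surj u
        exact ⟨_, hg v⟩
      · rw [hgk, hk, Submodule.map_span]
    have hi : g '' (qt c '' E) = f '' E := by rw [image_image]; exact image_congr fun v _ => hg v
    have hr : Module.finrank K (LinearMap.ker g) = n := by
      rw [hgk]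
      have : Module.finrank K ((LinearMap.ker f).map (qt c)) + 1 = Module.finrank K (LinearMap.ker f) :=
        hx.finrank_map' (P := LinearMap.ker f) (by rw [hk]; exact Submodule.subset_span hcC)
      omega
    rcases ih _ (qt c '' E) (hE.map hx.contr) ⟨0, h0, map_zero _⟩ U g hgc hr ⟨P, by rwa [hi]⟩ with
      ⟨Q, hQ⟩ | ⟨d', ⟨d, hd, rfl⟩, hd0, hns, hfm⟩
    · by_cases hT : Submodule.span K (T E (qt c)) = ⊤
      · obtain ⟨-, R, hR, -⟩ := full_lift hE h0 hx hT hQ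
        exact Or.inl ⟨R, hR⟩
      · exact Or.inr ⟨c, hC hcC, hc0, hT, FM.of_plane hQ⟩
    · right
      have hdz : d ≠ 0 := by rintro rfl; simp at hd0
      have hcd : c ≠ d := by rintro rfl; exact hd0 hx.apply
      have hdd := c1_mkQ hd hdz
      refine ⟨d, hd, hdz, fun hT => hns ?_, ?_⟩
      · obtain ⟨k, hk1, hk2, hk3, hk4⟩ := hx.square hdd hcd
        have := span_T_le hk4
        rw [hT, Submodule.map_top, LinearMap.range_eq_top.2 hk2.surj, top_le_iff] at this
        exact this
      · obtain ⟨k, hk1, hk2, hk3, hk4⟩ := hx.square hdd hcd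
        refine FM.of_map hk2.contr ?_
        rwa [hk3]

theorem pair_sums {a b c e₁ e₂ e₃ : U} {A : Set U} (hA : A ⊆ {a, b, c}) (h : ∀ e ∈ ({e₁, e₂, e₃} : Set U),
    e ≠ 0 ∧ ∃ s ∈ A, s + e ∈ A) (h12 : e₁ ≠ e₂) (h13 : e₁ ≠ e₃) (h23 : e₂ ≠ e₃)
    (hs : e₁ + e₂ + e₃ ≠ 0) : False := by
  have key : ∀ e ∈ ({e₁, e₂, e₃} : Set U), e = a + b ∨ e = a + c ∨ e = b + c := by
    intro e he
    obtain ⟨h0, s, h1, h2⟩ := h e he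
    have e1 : e = s + (s + e) := by rw [aab]
    have h3 := hA h1
    have h4 := hA h2
    generalize s + e = s' at *
    rcases h3 with rfl | rfl | rfl <;> rcases h4 with rfl | rfl | rfl <;>
      first | (exfalso; rw [aa] at e1; exact h0 e1) | (rw [e1]; clear * -; simp; done) |
        (rw [e1, add_comm]; clear * -; simp; done)
  have k1 := key e₁ (by simp)
  have k2 := key e₂ (by simp)
  have k3 := key e₃ (by simp)
  have z : ∀ p q r : U, (p + q) + (p + r) + (q + r) = 0 := by
    intro p q r
    simp only [add_assoc, add_comm, add_left_comm, aa, aab, add_zero, zero_add]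
  clear h key hA
  have z1 := z a b c
  rcases k1 with rfl | rfl | rfl <;> rcases k2 with rfl | rfl | rfl <;>
    rcases k3 with rfl | rfl | rfl <;>
    first | (exact h12 rfl) | (exact h13 rfl) | (exact h23 rfl) | (exact hs z1) | (apply hs; rw [← z1]; abel)
end good
end NR

namespace NR

section k0
variable {V U X : Type} [AddCommGroup V] [Module K V] [AddCommGroup U] [Module K U]
variable {E : Set V} {x : V} {f : V →ₗ[K] U} {ι : Type} [DecidableEq ι]

theorem plane_supp [Finite U] {b : ι → U} (hb : LinearIndependent K b) {P : Submodule K U}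
    (hP : Module.finrank K P = 3) {i j k : ι} (hij : i ≠ j) (hik : i ≠ k) (hjk : j ≠ k)
    (hi : b i ∈ P) (hj : b j ∈ P) (hk : b k ∈ P) {A : Finset ι} (hA : wd b A ∈ P) :
    A ⊆ {i, j, k} := by
  have hm : Function.Injective ![i, j, k] := by
    intro a c h
    fin_cases a <;> fin_cases c <;> simp_all
  have hLI := hb.comp _ hm
  have h1 := finrank_span_eq_card hLI
  have h2 : Submodule.span K (range (b ∘ ![i, j, k])) ≤ P := by
    rw [Submodule.span_le]
    rintro _ ⟨a, rfl⟩
    fin_cases a <;> assumption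
  have h3 := Submodule.eq_of_le_of_finrank_eq h2 (by rw [h1, hP]; rfl)
  intro l hl
  by_contra hcon
  obtain ⟨φ, hφ⟩ := coord hb l
  have h4 : P ≤ LinearMap.ker φ := by
    rw [← h3, Submodule.span_le]
    rintro _ ⟨a, rfl⟩
    simp only [Finset.mem_insert, Finset.mem_singleton, not_or] at hcon
    have : ∀ m, l ≠ m → φ (b m) = 0 := by
      intro m hm
      rw [← wd_single b m, hφ, if_neg (by simpa using hm)]
    fin_cases a
    · exact this i hcon.1
    · exact this j hcon.2.1
    · exact this k hcon.2.2
  have := h4 hA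
  rw [LinearMap.mem_ker, hφ, if_pos hl] at this
  exact one_ne_zero this

theorem exists_T_lam {y : V} {g : V →ₗ[K] U} (hy : C1 E y g)
    (hT : Submodule.span K (T E g) = ⊤) (lam : V →ₗ[K] K) (hly : lam y = 0) (hl : lam ≠ 0) :
    ∃ e ∈ E, e + y ∈ E ∧ lam e = 1 := by
  by_contra hcon
  push Not at hcon
  apply hl
  have h1 : Submodule.span K (T E g) ≤ (LinearMap.ker lam).map g := by
    rw [Submodule.span_le]
    intro u hu
    obtain ⟨e, rfl⟩ := hy.surj u
    obtain ⟨-, -, h1, h2⟩ := hy.mem_T.1 hu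
    refine ⟨e, ?_, rfl⟩
    by_contra h
    exact hcon e h1 h2 (kne h)
  ext v
  have h2 : g v ∈ (LinearMap.ker lam).map g := by
    apply h1; rw [hT]; trivial
  obtain ⟨w, hw, hwv⟩ := h2
  rcases hy.eq_iff.1 hwv with h | h
  · rw [← h]; exact hw
  · have : lam w = 0 := hw
    rw [h, map_add, hly, add_zero] at this
    exact this

theorem K0a [Finite V] (hE : AGF E) (hx : C1 E x f)
    (hnx : ∀ Q, IsPlane E Q → x ∉ Q) {b : ι → U} (hb : LinearIndependent K b)
    (hT : ∀ i, b i ∈ T E f) (hsp : Submodule.span K (range b) = ⊤) {P : Submodule K V}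
    (hP : IsPlane E P) {i j k : ι} (hij : i ≠ j) (hik : i ≠ k) (hjk : j ≠ k)
    (hi : b i ∈ P.map f) (hj : b j ∈ P.map f) (hk : b k ∈ P.map f) :
    ∃ y ∈ E, y ≠ 0 ∧ f y = b i ∧ ∀ Q, IsPlane E Q → y ∉ Q := by
  have hU : Finite U := Finite.of_surjective f hx.surj
  have hEf := hE.map hx.contr
  have hPm := hP.map hx (hnx P hP)
  obtain ⟨p, hp, hpi⟩ := hi
  have hpT := hT i
  rw [← hpi, hx.mem_T] at hpT
  obtain ⟨hp0, hpx, hpE, hpxE⟩ := hpT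
  have hfy : f (p + x) = b i := by rw [map_add, hx.apply, add_zero, hpi]
  refine ⟨p + x, hpxE, ?_, hfy, ?_⟩
  · intro h; exact hpx (eq_of_add h)
  intro Q hQ hyQ
  have hQm := hQ.map hx (hnx Q hQ)
  have hyP : p + x ∉ P := by
    intro h
    have := P.add_mem hp h
    rw [aab] at this
    exact hnx P hP this
  have hPQ : P ≠ Q := fun h => hyP (h ▸ hyQ)
  by_cases hm : P.map f = Q.map f
  · have h1 := planes_meet hE hP hQ hPQ
    have h2 := Submodule.finrank_sup_add_finrank_inf_eq P Q
    have h3 : P ⊔ Q ≤ (P.map f).comap f := by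
      rw [sup_le_iff]
      refine ⟨Submodule.le_comap_map _ _, ?_⟩
      rw [hm]; exact Submodule.le_comap_map _ _
    have h4 := Submodule.finrank_mono h3
    rw [hx.finrank_comap, hPm.1] at h4
    rw [hP.1, hQ.1] at h2
    omega
  · have hmeet := planes_meet hEf hPm hQm hm
    have htwo : ∀ a, a ≠ i → b a ∈ P.map f → b a ∈ Q.map f → False := by
      intro a ha h1 h2
      have h3 : Submodule.span K ({b a, b i} : Set U) ≤ P.map f ⊓ Q.map f := by
        rw [Submodule.span_le]
        rintro _ (rfl | rfl)
        · exact ⟨h1, h2⟩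
        · exact ⟨⟨p, hp, hpi⟩, ⟨_, hyQ, hfy⟩⟩
      have h4 := Submodule.finrank_mono h3
      rw [finrank_pair (hb.ne_zero a) (hb.ne_zero i) (hb.injective.ne ha)] at h4
      omega
    obtain ⟨i', j', k', hij', hik', hjk', hi', hj', hk'⟩ := full_plane hE hx hb hT hQm
      (by rw [hsp]; exact le_top)
    have hmem : wd b {i} ∈ Q.map f := by rw [wd_single]; exact ⟨_, hyQ, hfy⟩
    have h5 := plane_supp hb hQm.1 hij' hik' hjk' hi' hj' hk' hmem
    have hPs : b i + b j + b k ∈ f '' E :=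
      hPm.2 (add_mem (add_mem ⟨p, hp, hpi⟩ hj) hk)
    have fin : ∀ l m, i ≠ l → i ≠ m → l ≠ m → b l ∈ Q.map f → b m ∈ Q.map f → False := by
      intro l m hl hm' hlm h1 h2
      refine Meet hE hx hb hT (i₁ := i) (i₂ := j) (i₃ := k) (i₄ := l) (i₅ := m) ?_ hPs
        (hQm.2 (add_mem (add_mem ⟨_, hyQ, hfy⟩ h1) h2))
      have n1 : j ≠ l := by rintro rfl; exact htwo j hij.symm hj h1
      have n2 : j ≠ m := by rintro rfl; exact htwo j hij.symm hj h2
      have n3 : k ≠ l := by rintro rfl; exact htwo k hik.symm hk h1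
      have n4 : k ≠ m := by rintro rfl; exact htwo k hik.symm hk h2
      simp [hij, hik, hjk, hl, hm', hlm, n1, n2, n3, n4]
    have h6 := h5 (Finset.mem_singleton_self i)
    simp only [Finset.mem_insert, Finset.mem_singleton] at h6
    rcases h6 with rfl | rfl | rfl
    · exact fin _ _ hij' hik' hjk' hj' hk'
    · exact fin _ _ hij'.symm hjk' hik' hi' hk'
    · exact fin _ _ hik'.symm hjk'.symm hij' hi' hj'

theorem K0b [Finite V] (hE : AGF E) (hx : C1 E x f)
    {b : ι → U} (hb : LinearIndependent K b)
    (hT : ∀ i, b i ∈ T E f) (hsp : Submodule.span K (range b) = ⊤) {P : Submodule K U}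
    (hP : IsPlane (f '' E) P) {i j k t : ι} (hij : i ≠ j) (hik : i ≠ k) (hjk : j ≠ k)
    (hi : b i ∈ P) (hj : b j ∈ P) (hk : b k ∈ P)
    (hti : t ≠ i) (htj : t ≠ j) (htk : t ≠ k) {y : V} (hyE : y ∈ E) (hy0 : y ≠ 0)
    (hfy : f y = b i) (hTy : Submodule.span K (T E (qt y)) = ⊤) :
    ∃ s, (s ∈ f '' E ∧ s + b t ∈ P) ∧ (s + b i ∈ f '' E ∧ s + b i + b t ∈ P) := by
  obtain ⟨φ, hφ⟩ := coord hb t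
  have hφi : φ (b i) = 0 := by
    rw [← wd_single b i, hφ, if_neg (by simpa using hti)]
  have hφt : φ (b t) = 1 := by
    rw [← wd_single b t, hφ, if_pos (by simp)]
  obtain ⟨e, he, hey, hel⟩ := exists_T_lam (c1_mkQ hyE hy0) hTy (φ ∘ₗ f)
    (by simp [hfy, hφi]) (by
      intro h
      obtain ⟨v, hv⟩ := hx.surj (b t)
      have : φ (f v) = 0 := LinearMap.congr_fun h v
      rw [hv, hφt] at this
      exact one_ne_zero this)
  have hs1 : f e ∈ f '' E := ⟨e, he, rfl⟩
  have hs2 : f e + b i ∈ f '' E := ⟨e + y, hey, by rw [map_add, hfy]⟩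
  have key : ∀ A : Finset ι, i ∈ A → t ∈ A → wd b A ∈ f '' E → wd b A + b t ∈ P := by
    intro A hiA htA hA
    have hc : A.card ≤ 3 := by
      by_contra h
      exact W4 hE hx hb hT (by omega) hA
    have hins : insert t ({i} : Finset ι) ⊆ A := by
      intro a ha
      simp only [Finset.mem_insert, Finset.mem_singleton] at ha
      rcases ha with rfl | rfl <;> assumption
    have hcard : (insert t ({i} : Finset ι)).card = 2 := by
      rw [Finset.card_insert_of_notMem (by simpa using hti), Finset.card_singleton]
    by_cases h2 : A = insert t {i}
    · rw [h2, wd_insert b (by simpa using hti), wd_single, add_comm (b t), add_assoc, aa, add_zero]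
      exact hi
    · have hss := Finset.ssubset_iff_subset_ne.2 ⟨hins, Ne.symm h2⟩
      obtain ⟨z, hz, hzn⟩ := Finset.exists_of_ssubset hss
      have hzn' := hzn
      simp only [Finset.mem_insert, Finset.mem_singleton, not_or] at hzn'
      have hA3 : A = insert z (insert t {i}) := by
        symm
        apply Finset.eq_of_subset_of_card_le
        · intro a ha
          rw [Finset.mem_insert] at ha
          rcases ha with rfl | ha
          · exact hz
          · exact hins ha
        · rw [Finset.card_insert_of_notMem hzn, hcard]; exact hc
      have hw : wd b A = b z + (b t + b i) := by
        rw [hA3, wd_insert b hzn, wd_insert b (by simpa using hti), wd_single]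
      by_cases hzj : z ∈ ({j, k} : Finset ι)
      · have hzP : b z ∈ P := by
          simp only [Finset.mem_insert, Finset.mem_singleton] at hzj
          rcases hzj with rfl | rfl <;> assumption
        have : wd b A + b t = b z + b i := by
          rw [hw]; have := aa (b t); grind
        rw [this]; exact add_mem hzP hi
      · exfalso
        simp only [Finset.mem_insert, Finset.mem_singleton, not_or] at hzj
        refine Meet hE hx hb hT (i₁ := i) (i₂ := j) (i₃ := k) (i₄ := t) (i₅ := z) ?_
          (hP.2 (add_mem (add_mem hi hj) hk)) ?_
        · simp [hij, hik, hjk, hti.symm, htj.symm, htk.symm, Ne.symm hzn'.1, Ne.symm hzn'.2, Ne.symm hzj.1, Ne.symm hzj.2]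
        · rw [hw] at hA
          have : b i + b t + b z = b z + (b t + b i) := by abel
          rw [this]; exact hA
  obtain ⟨A, hA⟩ := exists_wd (b := b) (v := f e) (by rw [hsp]; trivial)
  have htA : t ∈ A := by
    by_contra h
    have h2 : φ (f e) = 1 := hel
    rw [hA, hφ, if_neg h] at h2
    exact zero_ne_one h2
  refine ⟨f e, ?_⟩
  have hfin : (f e + b t ∈ P ↔ f e + b i + b t ∈ P) := by
    have h1 : f e + b i + b t = (f e + b t) + b i := by abel
    rw [h1]
    exact (Submodule.add_mem_iff_left P hi).symm
  by_cases hiA : i ∈ A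
  · have h1 := key A hiA htA (hA ▸ hs1)
    rw [← hA] at h1
    exact ⟨⟨hs1, h1⟩, hs2, hfin.1 h1⟩
  · have hw : wd b (insert i A) = f e + b i := by
      rw [wd_insert b hiA, hA, add_comm]
    have h1 := key (insert i A) (by simp) (by simp [htA]) (hw ▸ hs2)
    rw [hw] at h1
    exact ⟨⟨hs1, hfin.2 h1⟩, hs2, h1⟩

theorem K0 [Finite V] (hV : 5 ≤ Module.finrank K V) (hE : AGF E) (h0 : (0:V) ∈ E)
    {P : Submodule K V} (hP : IsPlane E P) (hxE : x ∈ E) (hx0 : x ≠ 0)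
    (hnx : ∀ Q, IsPlane E Q → x ∉ Q) :
    ∃ y ∈ E, y ≠ 0 ∧ (∀ Q, IsPlane E Q → y ∉ Q) ∧ Submodule.span K (T E (qt y)) ≠ ⊤ := by
  classical
  by_contra hcon
  push Not at hcon
  have hx : C1 E x (qt x) := c1_mkQ hxE hx0
  have hU : Finite (V ⧸ Submodule.span K {x}) := Finite.of_surjective _ hx.surj
  have hr := hx.finrank
  have hTx := hcon x hxE hx0 hnx
  have hLI := T_LI hE hx h0 hnx
  set b : T E (qt x) → V ⧸ Submodule.span K {x} := Subtype.val with hbdef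
  have hb : LinearIndependent K b := hLI
  have hbT : ∀ i, b i ∈ T E (qt x) := fun i => i.2
  have hsp : Submodule.span K (range b) = ⊤ := by rw [hbdef, Subtype.range_val]; exact hTx
  have hPm := hP.map hx (hnx P hP)
  set Q := P.map (qt x) with hQ
  obtain ⟨i, j, k, hij, hik, hjk, hi, hj, hk⟩ := full_plane hE hx hb hbT hPm (by rw [hsp]; exact le_top)
  obtain ⟨t, htQ⟩ : ∃ t, b t ∉ Q := by
    by_contra h
    push Not at h
    have h1 : Submodule.span K (range b) ≤ Q := by
      rw [Submodule.span_le]; rintro _ ⟨t, rfl⟩; exact h t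
    rw [hsp, top_le_iff] at h1
    have h2 := hPm.1
    rw [h1, finrank_top] at h2
    omega
  have hti : t ≠ i := by rintro rfl; exact htQ hi
  have htj : t ≠ j := by rintro rfl; exact htQ hj
  have htk : t ≠ k := by rintro rfl; exact htQ hk
  have main : ∀ i j k : T E (qt x), i ≠ j → i ≠ k → j ≠ k → b i ∈ Q → b j ∈ Q → b k ∈ Q → t ≠ i →
      t ≠ j → t ≠ k → ∃ s, (s ∈ qt x '' E ∧ s + b t ∈ Q) ∧ (s + b i ∈ qt x '' E ∧ s + b i + b t ∈ Q) := by
    intro i j k hij hik hjk hi hj hk hti htj htk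
    obtain ⟨y, hyE, hy0, hfy, hny⟩ := K0a hE hx hnx hb hbT hsp hP hij hik hjk hi hj hk
    exact K0b hE hx hb hbT hsp hPm hij hik hjk hi hj hk hti htj htk hyE hy0 hfy (hcon y hyE hy0 hny)
  have m1 := main i j k hij hik hjk hi hj hk hti htj htk
  have m2 := main j i k hij.symm hjk hik hj hi hk htj hti htk
  have m3 := main k i j hik.symm hjk.symm hij hk hi hj htk hti htj
  set A : Set (V ⧸ Submodule.span K {x}) := {s | s ∈ qt x '' E ∧ s + b t ∈ Q} with hAdef
  have hA4 : 4 ≤ A.ncard := by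
    by_contra hlt
    have : ∃ a c d, A ⊆ {a, c, d} := by
      have h3 : A.ncard ≤ 3 := by omega
      have hne : A.ncard ≠ 0 := by
        intro h
        obtain ⟨s, hs, -⟩ := m1
        rw [ncard_eq_zero] at h
        have hs' : s ∈ A := hs
        rw [h] at hs'
        exact hs'
      interval_cases hn : A.ncard
      · exact absurd rfl hne
      · obtain ⟨a, ha⟩ := ncard_eq_one.1 hn
        exact ⟨a, a, a, by rw [ha]; simp⟩
      · obtain ⟨a, c, -, ha⟩ := ncard_eq_two.1 hn
        exact ⟨a, c, c, by rw [ha]; simp⟩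
      · obtain ⟨a, c, d, -, -, -, ha⟩ := ncard_eq_three.1 hn
        exact ⟨a, c, d, by rw [ha]⟩
    obtain ⟨a, c, d, hacd⟩ := this
    refine pair_sums hacd (e₁ := b i) (e₂ := b j) (e₃ := b k) ?_ (hb.injective.ne hij)
      (hb.injective.ne hik) (hb.injective.ne hjk) ?_
    · rintro _ (rfl | rfl | rfl)
      · obtain ⟨s, h1, h2⟩ := m1; exact ⟨hb.ne_zero _, s, h1, h2⟩
      · obtain ⟨s, h1, h2⟩ := m2; exact ⟨hb.ne_zero _, s, h1, h2⟩
      · obtain ⟨s, h1, h2⟩ := m3; exact ⟨hb.ne_zero _, s, h1, h2⟩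
    · have h1 : wd b {i, j, k} = b i + b j + b k := by
        rw [wd_insert b (by simp [hij, hik]), wd_insert b (by simp [hjk]), wd_single, add_assoc]
      rw [← h1]
      intro h
      have := (wd_eq_zero hb).1 h
      simp at this
  -- count
  let S := Q ⊔ Submodule.span K {b t}
  have hS : Module.finrank K S = 4 := by
    have h1 := Submodule.finrank_sup_add_finrank_inf_eq Q (Submodule.span K {b t})
    have h2 : Q ⊓ Submodule.span K {b t} = ⊥ := by
      rw [eq_bot_iff]
      rintro v ⟨hv, hv'⟩
      rcases span_single_mem hv' with h | h
      · rw [h]; exact Submodule.zero_mem _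
      · rw [h] at hv; exact absurd hv htQ
    rw [h2, finrank_bot, hPm.1, finrank_span_singleton (hb.ne_zero t)] at h1
    exact h1
  obtain ⟨r1, r2, r3⟩ := hx.restrict S
  have hcount := r1.count ⟨h0, by show qt x 0 ∈ S; rw [map_zero]; exact S.zero_mem⟩
  have h16 := sub5 hE h0 (S.comap (qt x)) (by rw [hx.finrank_comap, hS])
  rw [hcount, r2, r3] at h16
  have c1 : 12 ≤ (qt x '' E ∩ S).ncard := by
    have hsub : (Q : Set _) ∪ A ⊆ qt x '' E ∩ S := by
      rintro v (hv | ⟨hv, hv'⟩)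
      · exact ⟨hPm.2 hv, Submodule.mem_sup_left hv⟩
      · refine ⟨hv, ?_⟩
        have : v = (v + b t) + b t := by rw [add_assoc, aa, add_zero]
        rw [this]
        exact add_mem (Submodule.mem_sup_left hv')
          (Submodule.mem_sup_right (Submodule.mem_span_singleton_self _))
    have hd : Disjoint (Q : Set _) A := by
      rw [Set.disjoint_left]
      rintro v hv ⟨-, hv'⟩
      exact htQ ((Submodule.add_mem_iff_right Q hv).1 hv')
    have h1 := ncard_le_ncard hsub (Set.toFinite _)
    rw [ncard_union_eq hd (Set.toFinite _) (Set.toFinite _), hPm.ncard] at h1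
    omega
  have c2 : 4 ≤ (T E (qt x) ∩ S).ncard := by
    have hsub : b '' {t, i, j, k} ⊆ T E (qt x) ∩ S := by
      rintro _ ⟨a, ha, rfl⟩
      refine ⟨hbT a, ?_⟩
      rcases ha with rfl | rfl | rfl | rfl
      · exact Submodule.mem_sup_right (Submodule.mem_span_singleton_self _)
      · exact Submodule.mem_sup_left hi
      · exact Submodule.mem_sup_left hj
      · exact Submodule.mem_sup_left hk
    have h1 := ncard_le_ncard hsub (Set.toFinite _)
    rw [ncard_image_of_injective _ hb.injective, ncard_insert_of_notMem (by simp [hti, htj, htk]),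
      ncard_insert_of_notMem (by simp [hij, hik]), ncard_pair hjk] at h1
    omega
  omega
end k0
end NR

namespace NR

section mm
variable {V U X : Type} [AddCommGroup V] [Module K V] [AddCommGroup U] [Module K U]
variable {E : Set V} {x : V} {f : V →ₗ[K] U}

theorem inf_point [Finite V] {P Q : Submodule K V} {q z : V}
    (hPQ : Module.finrank K (P ⊓ Q : Submodule K V) ≤ 1) (hqP : q ∈ P) (hqQ : q ∈ Q) (hq : q ≠ 0)
    (hzP : z ∈ P) (hzQ : z ∈ Q) : z = 0 ∨ z = q := by
  by_contra h
  push Not at h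
  have h3 : Submodule.span K ({z, q} : Set V) ≤ P ⊓ Q := by
    rw [Submodule.span_le]
    rintro _ (rfl | rfl)
    · exact ⟨hzP, hzQ⟩
    · exact ⟨hqP, hqQ⟩
  have h4 := Submodule.finrank_mono h3
  rw [finrank_pair h.1 hq h.2] at h4
  omega

theorem mem_of_map (hx : C1 E x f) {P : Submodule K V} (hxP : x ∈ P) {z : V} (hz : f z ∈ P.map f) :
    z ∈ P := by
  obtain ⟨w, hw, h⟩ := hz
  rcases hx.eq_iff.1 h with h | h
  · rw [← h]; exact hw
  · have : z = w + x := by rw [h, add_assoc, aa, add_zero]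
    rw [this]; exact add_mem hw hxP

theorem LI4 {b : Fin 4 → U} (hb : LinearIndependent K b) :
    LinearIndependent K ![b 0 + b 1, b 1, b 2, b 3] := by
  rw [Fintype.linearIndependent_iff] at hb ⊢
  intro g hg
  have h1 := hb ![g 0, g 0 + g 1, g 2, g 3] (by
    simp [Fin.sum_univ_four] at hg ⊢
    rw [← hg, add_smul]; abel)
  have a0 := h1 0
  have a1 := h1 1
  have a2 := h1 2
  have a3 := h1 3
  simp at a0 a1 a2 a3
  rw [a0, zero_add] at a1
  intro i
  fin_cases i <;> assumption

theorem oneplane [Finite V] {y q : V} (hE : AGF E) (hy : C1 E y f) {P Q : Submodule K V}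
    (hP : IsPlane E P) (hQ : IsPlane E Q) (hPQ : Module.finrank K (P ⊓ Q : Submodule K V) = 1)
    (hqP : q ∈ P) (hqQ : q ∈ Q) (hq : q ≠ 0) (hyP : y ∈ P) (hyq : y ≠ q) :
    Submodule.span K (T E f) ⊓ Q.map f ≤ Submodule.span K {f q} := by
  classical
  have hyQ : y ∉ Q := fun h => by
    rcases inf_point hPQ.le hqP hqQ hq hyP h with h | h
    · exact hy.ne h
    · exact hyq h
  have hTP : ∀ z ∈ P, f z ≠ 0 → f z ∈ T E f := by
    intro z hz hne
    rw [hy.mem_T]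
    refine ⟨?_, ?_, hP.2 hz, hP.2 (add_mem hz hyP)⟩
    · rintro rfl; simp at hne
    · rintro rfl; exact hne hy.apply
  have hu0 : f q ≠ 0 := by
    rw [Ne, hy.eq_zero_iff]; rintro (h | h)
    · exact hq h
    · exact hyq h.symm
  obtain ⟨p', hp'P, hp'⟩ : ∃ p' ∈ P, p' ∉ Submodule.span K ({y, q} : Set V) := by
    by_contra h
    push Not at h
    have h1 : P ≤ Submodule.span K ({y, q} : Set V) := h
    have h2 := Submodule.finrank_mono h1
    rw [hP.1, finrank_pair hy.ne hq hyq] at h2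
    omega
  have hu'0 : f p' ≠ 0 := by
    rw [Ne, hy.eq_zero_iff]; rintro (rfl | rfl)
    · exact hp' (Submodule.zero_mem _)
    · exact hp' (Submodule.subset_span (by simp))
  have huu : f p' ≠ f q := by
    rw [Ne, hy.eq_iff]; rintro (h | h)
    · exact hp' (h ▸ Submodule.subset_span (by simp))
    · exact hp' (h ▸ add_mem (Submodule.subset_span (by simp)) (Submodule.subset_span (by simp)))
  have huT := hTP q hqP hu0
  have hu'T := hTP p' hp'P hu'0
  have hupT : f q + f p' ∈ T E f := by
    rw [← map_add]
    apply hTP _ (add_mem hqP hp'P)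
    rw [map_add]; intro h; exact huu (eq_of_add h).symm
  have hLI2 : LinearIndepOn K id ({f q, f p'} : Set U) := by
    rw [LinearIndepOn.pair_iff _ (Ne.symm huu)]
    intro c d hc
    rcases k01 c with rfl | rfl <;> rcases k01 d with rfl | rfl
    · exact ⟨rfl, rfl⟩
    · simp at hc; exact absurd hc hu'0
    · simp at hc; exact absurd hc hu0
    · simp at hc; exact absurd (eq_of_add hc).symm huu
  obtain ⟨B, hB, hsub, hsp, hLI⟩ := exists_basis_T E f {f q, f p'} (by
    rintro _ (rfl | rfl) <;> assumption) hLI2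
  let b : B → U := Subtype.val
  have hb : LinearIndependent K b := hLI
  have hbT : ∀ i, b i ∈ T E f := fun i => hB i.2
  let u : B := ⟨f q, hsub (by simp)⟩
  let u' : B := ⟨f p', hsub (by simp)⟩
  have hu : b u = f q := rfl
  have hu' : b u' = f p' := rfl
  have hne : u ≠ u' := fun h => huu (congrArg Subtype.val h).symm
  -- main claim for words containing `u`
  have key : ∀ A : Finset B, u ∈ A → wd b A ∈ Q.map f → wd b A ∈ P.map f := by
    intro A huA hA
    have hAE : wd b A ∈ f '' E := by
      obtain ⟨z, hz, h⟩ := hA; exact ⟨z, hQ.2 hz, h⟩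
    have hS := Finset.sdiff_union_inter A {u, u'}
    set S0 := A \ {u, u'} with hS0
    have hcA : A.card ≤ 3 := by
      by_contra h
      exact W4 hE hy hb hbT (by omega) hAE
    by_cases hc : 2 ≤ S0.card
    · exfalso
      obtain ⟨s₁, hs₁, s₂, hs₂, h12⟩ := Finset.one_lt_card.1 hc
      rw [hS0, Finset.mem_sdiff] at hs₁ hs₂
      simp only [Finset.mem_insert, Finset.mem_singleton, not_or] at hs₁ hs₂
      have hA3 : A = insert u (insert s₁ {s₂}) := by
        symm
        apply Finset.eq_of_subset_of_card_le
        · intro a ha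
          simp only [Finset.mem_insert, Finset.mem_singleton] at ha
          rcases ha with rfl | rfl | rfl
          · exact huA
          · exact hs₁.1
          · exact hs₂.1
        · rw [Finset.card_insert_of_notMem, Finset.card_insert_of_notMem, Finset.card_singleton]
          · exact hcA
          · simpa using h12
          · simp [Ne.symm hs₁.2.1, Ne.symm hs₂.2.1]
      have hw : wd b A = b u + (b s₁ + b s₂) := by
        rw [hA3, wd_insert, wd_insert, wd_single]
        · simpa using h12
        · simp [Ne.symm hs₁.2.1, Ne.symm hs₂.2.1]
      have hm : Function.Injective ![u, u', s₁, s₂] := by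
        have h1 := hs₁.2.1
        have h2 := hs₁.2.2
        have h3 := hs₂.2.1
        have h4 := hs₂.2.2
        have := Ne.symm h1
        have := Ne.symm h2
        have := Ne.symm h3
        have := Ne.symm h4
        have := Ne.symm hne
        have := Ne.symm h12
        intro a c h
        clear hw hA3 hcA hS hS0 hAE hA huA
        fin_cases a <;> fin_cases c <;> first | rfl | (exfalso; simp at h; contradiction)
      have h4 := LI4 (hb.comp _ hm)
      refine W4 hE hy h4 ?_ (A := Finset.univ) (by simp) ?_
      · intro i
        fin_cases i
        · exact hupT
        · exact hu'T
        · exact hbT s₁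
        · exact hbT s₂
      · have : wd ![(b ∘ ![u, u', s₁, s₂]) 0 + (b ∘ ![u, u', s₁, s₂]) 1, (b ∘ ![u, u', s₁, s₂]) 1,
            (b ∘ ![u, u', s₁, s₂]) 2, (b ∘ ![u, u', s₁, s₂]) 3] Finset.univ = wd b A := by
          rw [hw]
          unfold wd
          rw [Fin.sum_univ_four]
          show (b u + b u') + b u' + b s₁ + b s₂ = _
          have := aa (b u')
          rw [add_assoc (b u), aa, add_zero, add_assoc]
        rw [this]; exact hAE
    · have hAin : ∀ C : Finset B, C ⊆ {u, u'} → wd b C ∈ P.map f := by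
        intro C hC
        refine Submodule.sum_mem _ fun i hi => ?_
        have := hC hi
        simp only [Finset.mem_insert, Finset.mem_singleton] at this
        rcases this with rfl | rfl
        · exact ⟨q, hqP, rfl⟩
        · exact ⟨p', hp'P, rfl⟩
      have hsplit : wd b A = wd b S0 + wd b (A ∩ {u, u'}) := by
        have hd : Disjoint S0 (A ∩ {u, u'}) := by
          rw [hS0]; exact Finset.disjoint_sdiff_inter A {u, u'}
        unfold wd
        rw [← Finset.sum_union hd, hS]
      have hin := hAin (A ∩ {u, u'}) Finset.inter_subset_right
      rcases Nat.lt_or_ge S0.card 1 with h0 | h1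
      · have : S0 = ∅ := by rw [← Finset.card_eq_zero]; omega
        rw [hsplit, this, wd_empty, zero_add]; exact hin
      · obtain ⟨s, hs⟩ := Finset.card_eq_one.1 (show S0.card = 1 by omega)
        rw [hs, wd_single] at hsplit
        obtain ⟨z, hz, hzA⟩ := hA
        obtain ⟨w, hw, hwA⟩ := hin
        have hsT := hbT s
        by_contra hnP
        have hbs : b s = f (z + w) := by
          rw [map_add, hzA, hwA, hsplit, add_assoc, aa, add_zero]
        rw [hbs, hy.mem_T] at hsT
        obtain ⟨-, -, h3, h4⟩ := hsT
        have hnot : ∀ e, f e = b s → e ∉ P := by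
          intro e he heP
          apply hnP
          rw [hsplit, ← he, ← hwA, ← map_add]
          exact ⟨_, add_mem heP hw, rfl⟩
        have hPQ1 : z + w ∈ P ⊔ Q := add_mem (Submodule.mem_sup_right hz) (Submodule.mem_sup_left hw)
        have h5 : z + w ∈ Q := (planes_span hE hP hQ hPQ h3 hPQ1).resolve_left (hnot _ hbs.symm)
        have h6 : z + w + y ∈ Q := (planes_span hE hP hQ hPQ h4
          (add_mem hPQ1 (Submodule.mem_sup_left hyP))).resolve_left
            (hnot _ (by rw [map_add _ (z + w), hy.apply, add_zero, hbs]))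
        exact hyQ ((Submodule.add_mem_iff_right Q h5).1 h6)
  have key2 : ∀ p, p ∈ Q.map f → p ∈ P.map f → p ∈ Submodule.span K {f q} := by
    rintro _ ⟨z, hz, rfl⟩ hp
    have := mem_of_map hy hyP hp
    rcases inf_point hPQ.le hqP hqQ hq this hz with rfl | rfl
    · rw [map_zero]; exact Submodule.zero_mem _
    · exact Submodule.mem_span_singleton_self _
  rintro p ⟨hpT, hpQ⟩
  have hpT : p ∈ Submodule.span K (T E f) := hpT
  rw [← hsp] at hpT
  obtain ⟨A, rfl⟩ := exists_wd (b := b) (v := p) (by rw [Subtype.range_val]; exact hpT)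
  by_cases huA : u ∈ A
  · exact key2 _ hpQ (key A huA hpQ)
  · have hw : wd b (insert u A) = f q + wd b A := by rw [wd_insert b huA, hu]
    have hqm : f q ∈ Q.map f := ⟨q, hqQ, rfl⟩
    have h1 : wd b (insert u A) ∈ Q.map f := by rw [hw]; exact add_mem hqm hpQ
    have h2 := key2 _ h1 (key _ (by simp) h1)
    rw [hw] at h2
    exact (Submodule.add_mem_iff_right _ (Submodule.mem_span_singleton_self _)).1 h2
end mm
end NR

namespace NR

section mm
variable {V U X : Type} [AddCommGroup V] [Module K V] [AddCommGroup U] [Module K U]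
variable {E : Set V} {x : V} {f : V →ₗ[K] U}

theorem c1_qt (hx : x ∈ E) (h0 : x ≠ 0) : C1 E x (qt x) := c1_mkQ hx h0

/-- rank of the set of lines through `y` -/
noncomputable abbrev rho (E : Set V) (y : V) : ℕ := Module.finrank K (Submodule.span K (T E (qt y)))

theorem contr_sub {L : Submodule K V} (hL : (L : Set V) ⊆ E) : IsContr E L.mkQ :=
  ⟨Submodule.mkQ_surjective _, L, hL, by rw [Submodule.ker_mkQ, Submodule.span_eq]⟩

theorem mkQ_eq_iff {L : Submodule K V} {a b : V} : L.mkQ a = L.mkQ b ↔ a + b ∈ L := by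
  rw [← sub_eq a b]
  exact Submodule.Quotient.eq L

theorem mkQ_eq_zero {L : Submodule K V} {a : V} : L.mkQ a = 0 ↔ a ∈ L := by
  rw [Submodule.mkQ_apply, Submodule.Quotient.mk_eq_zero]

theorem rho_le [Finite V] {L : Submodule K V} {y : V} (hy : y ∈ E) (hyL : y ∉ L) :
    rho E y ≤ rho (L.mkQ '' E) (L.mkQ y) +
      Module.finrank K (Submodule.span K (T E (qt y)) ⊓ L.map (qt y) : Submodule K _) := by
  have hy0 : y ≠ 0 := by rintro rfl; exact hyL L.zero_mem
  have hyc := c1_qt hy hy0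
  have hU : Finite (V ⧸ Submodule.span K {y}) := Finite.of_surjective _ hyc.surj
  have hW : Finite (V ⧸ L) := Finite.of_surjective _ L.mkQ_surjective
  have hgy : C1 (L.mkQ '' E) (L.mkQ y) (qt (L.mkQ y)) := c1_qt ⟨y, hy, rfl⟩ (by
    rw [Ne, mkQ_eq_zero]; exact hyL)
  have hle : Submodule.span K {y} ≤ LinearMap.ker (qt (L.mkQ y) ∘ₗ L.mkQ) := by
    rw [Submodule.span_le]
    intro v hv
    rw [mem_singleton_iff.1 hv]
    exact hgy.apply
  let k := (Submodule.span K {y}).liftQ _ hle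
  have hk : ∀ v, k (qt y v) = qt (L.mkQ y) (L.mkQ v) := fun v => Submodule.liftQ_apply _ _ _
  have hT : ∀ u ∈ T E (qt y), k u ≠ 0 → k u ∈ T (L.mkQ '' E) (qt (L.mkQ y)) := by
    intro u hu hne
    obtain ⟨e, rfl⟩ := hyc.surj u
    rw [hk] at hne ⊢
    obtain ⟨-, -, h1, h2⟩ := hyc.mem_T.1 hu
    rw [hgy.mem_T]
    refine ⟨?_, ?_, ⟨e, h1, rfl⟩, ⟨e + y, h2, by rw [map_add]⟩⟩
    · intro h; rw [h, map_zero] at hne; exact hne rfl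
    · intro h; rw [h, hgy.apply] at hne; exact hne rfl
  have h1 := Submodule.finrank_mono (span_T_le hT)
  have h2 := finrank_map_ker k (Submodule.span K (T E (qt y)))
  have h3 : LinearMap.ker k ≤ L.map (qt y) := by
    intro u hu
    obtain ⟨v, rfl⟩ := hyc.surj u
    rw [LinearMap.mem_ker, hk, hgy.eq_zero_iff, mkQ_eq_zero, mkQ_eq_iff] at hu
    rcases hu with hu | hu
    · exact ⟨v, hu, rfl⟩
    · refine ⟨v + y, hu, ?_⟩
      rw [map_add, hyc.apply, add_zero]
  have h4 := Submodule.finrank_mono (inf_le_inf_left (Submodule.span K (T E (qt y))) h3)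
  show Module.finrank K _ ≤ Module.finrank K _ + _
  omega

theorem inf_one [Finite V] (hE : AGF E) {P Q : Submodule K V} (hP : IsPlane E P) (hQ : IsPlane E Q)
    (hne : P ≠ Q) (hqP : x ∈ P) (hqQ : x ∈ Q) (hq : x ≠ 0) :
    Module.finrank K (P ⊓ Q : Submodule K V) = 1 := by
  have h1 := planes_meet hE hP hQ hne
  have h2 : Submodule.span K {x} ≤ P ⊓ Q := by
    rw [Submodule.span_le]; rintro _ rfl; exact ⟨hqP, hqQ⟩
  have h3 := Submodule.finrank_mono h2
  rw [finrank_span_singleton hq] at h3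
  omega

theorem third_plane [Finite V] (hE : AGF E) {P Q R : Submodule K V} (hP : IsPlane E P)
    (hQ : IsPlane E Q) (hR : IsPlane E R) (hPQ : Module.finrank K (P ⊓ Q : Submodule K V) = 1)
    (hRP : R ≠ P) (hRQ : R ≠ Q) : ¬ R ≤ P ⊔ Q := by
  intro hle
  have h1 := planes_meet hE hR hP hRP
  have h2 := planes_meet hE hR hQ hRQ
  have h3 : (R : Set V) ⊆ ((R ⊓ P : Submodule K V) : Set V) ∪ ((R ⊓ Q : Submodule K V) : Set V) := by
    intro z hz
    rcases planes_span hE hP hQ hPQ (hR.2 hz) (hle hz) with h | h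
    · exact Or.inl ⟨hz, h⟩
    · exact Or.inr ⟨hz, h⟩
  have h4 := ncard_le_ncard h3 (Set.toFinite _)
  have h5 := ncard_union_le ((R ⊓ P : Submodule K V) : Set V) ((R ⊓ Q : Submodule K V) : Set V)
  rw [hR.ncard] at h4
  rw [ncard_sub, ncard_sub] at h5
  have h6 := Nat.pow_le_pow_right (show 0 < 2 by norm_num) h1
  have h7 := Nat.pow_le_pow_right (show 0 < 2 by norm_num) h2
  omega

theorem plane_mkQ [Finite V] {L P : Submodule K V} (hP : IsPlane E P) (h : P ⊓ L = ⊥) :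
    IsPlane (L.mkQ '' E) (P.map L.mkQ) := by
  have h1 := finrank_map_ker L.mkQ P
  rw [Submodule.ker_mkQ, h, finrank_bot, hP.1] at h1
  refine ⟨by omega, ?_⟩
  rintro _ ⟨z, hz, rfl⟩
  exact ⟨z, hP.2 hz, rfl⟩

theorem le_of_map_eq {L P R : Submodule K V} (h : R.map L.mkQ = P.map L.mkQ) : R ≤ P ⊔ L := by
  intro z hz
  have : L.mkQ z ∈ P.map L.mkQ := h ▸ ⟨z, hz, rfl⟩
  obtain ⟨w, hw, hwz⟩ := this
  have h1 := mkQ_eq_iff.1 hwz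
  have : z = w + (w + z) := by rw [aab]
  rw [this]
  exact add_mem (Submodule.mem_sup_left hw) (Submodule.mem_sup_right h1)

/-- facts about the contraction of the line `Q ⊓ ker lam` -/
theorem M_step [Finite V] (hE : AGF E) {P Q : Submodule K V} {q y : V}
    (hP : IsPlane E P) (hQ : IsPlane E Q) (hne : P ≠ Q)
    (hqP : q ∈ P) (hqQ : q ∈ Q) (hq : q ≠ 0) (hyP : y ∈ P) (hyq : y ≠ q) (hy0 : y ≠ 0)
    (lam : V →ₗ[K] K) (hlam : lam q = 1) {L : Submodule K V} (hL : L = Q ⊓ LinearMap.ker lam) :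
    (L : Set V) ⊆ E ∧ Module.finrank K (V ⧸ L) + 2 = Module.finrank K V ∧ y ∉ L ∧
      rho E y ≤ rho (L.mkQ '' E) (L.mkQ y) := by
  have hPQ := inf_one hE hP hQ hne hqP hqQ hq
  have hL2 : Module.finrank K L = 2 := by
    have := finrank_inf_ker hqQ hlam
    rw [← hL, hQ.1] at this
    omega
  have hyQ : y ∉ Q := fun h => by
    rcases inf_point hPQ.le hqP hqQ hq hyP h with h | h
    · exact hy0 h
    · exact hyq h
  have hyL : y ∉ L := by rw [hL]; exact fun h => hyQ h.1
  refine ⟨?_, ?_, hyL, ?_⟩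
  · rw [hL]; exact fun z hz => hQ.2 hz.1
  · have := Submodule.finrank_quotient_add_finrank L
    omega
  · have h1 := rho_le (L := L) (hP.2 hyP) hyL
    have hyc := c1_qt (hP.2 hyP) hy0
    have h2 : Submodule.span K (T E (qt y)) ⊓ L.map (qt y) = ⊥ := by
      rw [eq_bot_iff]
      rintro u ⟨h3, z, hz, rfl⟩
      rw [hL] at hz
      have h4 := oneplane hE hyc hP hQ hPQ hqP hqQ hq hyP hyq ⟨h3, z, hz.1, rfl⟩
      rcases span_single_mem h4 with h5 | h5
      · rw [h5]; exact Submodule.zero_mem _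
      · exfalso
        rcases hyc.eq_iff.1 h5 with h6 | h6
        · have : lam z = 0 := hz.2
          rw [h6, hlam] at this
          exact one_ne_zero this
        · have h7 : z ∈ Q := hz.1
          rw [h6] at h7
          exact hyQ ((Submodule.add_mem_iff_right Q hqQ).1 h7)
    rw [h2, finrank_bot] at h1
    exact h1

theorem inf_L {P Q L : Submodule K V} {q : V} [Finite V]
    (hPQ : Module.finrank K (P ⊓ Q : Submodule K V) ≤ 1)
    (hqP : q ∈ P) (hqQ : q ∈ Q) (hq : q ≠ 0) {lam : V →ₗ[K] K} (hlam : lam q = 1)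
    (hL : L = Q ⊓ LinearMap.ker lam) : P ⊓ L = ⊥ := by
  rw [eq_bot_iff]
  rintro z ⟨h1, h2⟩
  rw [hL] at h2
  rcases inf_point hPQ hqP hqQ hq h1 h2.1 with h | h
  · rw [h]; exact Submodule.zero_mem _
  · have : lam z = 0 := h2.2
    rw [h, hlam] at this
    exact absurd this one_ne_zero

theorem rho_lt [Finite V] {y : V} (hy : y ∈ E) (hy0 : y ≠ 0) : rho E y + 1 ≤ Module.finrank K V := by
  have hyc := c1_qt hy hy0
  have hU : Finite (V ⧸ Submodule.span K {y}) := Finite.of_surjective _ hyc.surj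
  have := hyc.finrank
  have h2 := Submodule.finrank_le (Submodule.span K (T E (qt y)))
  show Module.finrank K _ + 1 ≤ _
  omega

theorem M_all : ∀ (m : ℕ) (V : Type) [AddCommGroup V] [Module K V] [Finite V] (E : Set V),
    AGF E → ∀ (P : Submodule K V) (x y : V), IsPlane E P → x ≠ 0 → x ∈ P → y ∈ P → y ≠ 0 → y ≠ x →
    ∀ S : Set (Submodule K V), (∀ Q ∈ S, IsPlane E Q ∧ x ∈ Q ∧ Q ≠ P) → S.ncard = m →
    rho E y + 1 + 2 * m ≤ Module.finrank K V := by
  intro m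
  induction m with
  | zero =>
    intro V _ _ _ E hE P x y hP hx hxP hyP hy0 hyx S hS hm
    simpa using rho_lt (hP.2 hyP) hy0
  | succ m ih =>
    intro V _ _ _ E hE P x y hP hx hxP hyP hy0 hyx S hS hm
    obtain ⟨Q, hQS⟩ : S.Nonempty := by
      rw [← Set.ncard_pos (Set.toFinite _)]; omega
    obtain ⟨hQ, hxQ, hQP⟩ := hS Q hQS
    obtain ⟨lam, hlam⟩ := exists_lam hx
    obtain ⟨L, hL⟩ : ∃ L, L = Q ⊓ LinearMap.ker lam := ⟨_, rfl⟩
    obtain ⟨h1, h2, h3, h4⟩ := M_step hE hP hQ hQP.symm hxP hxQ hx hyP hyx hy0 lam hlam hL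
    have hLQ : L ≤ Q := by rw [hL]; exact inf_le_left
    have hW : Finite (V ⧸ L) := Finite.of_surjective _ L.mkQ_surjective
    have hinf : ∀ R, IsPlane E R → x ∈ R → R ≠ Q → R ⊓ L = ⊥ := by
      intro R hR hxR hRQ
      exact inf_L (planes_meet hE hR hQ hRQ) hxR hxQ hx hlam hL
    have hxL : x ∉ L := by
      rw [hL]; intro h
      have : lam x = 0 := h.2
      rw [hlam] at this; exact one_ne_zero this
    have hinj : ∀ R R', IsPlane E R → x ∈ R → R ≠ Q → IsPlane E R' → x ∈ R' → R' ≠ Q →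
        R.map L.mkQ = R'.map L.mkQ → R = R' := by
      intro R R' hR hxR hRQ hR' hxR' hRQ' h
      by_contra hne
      exact third_plane hE hR' hQ hR (inf_one hE hR' hQ hRQ' hxR' hxQ hx) hne hRQ
        ((le_of_map_eq h).trans (sup_le_sup_left hLQ _))
    have hS' : (S \ {Q}).ncard = m := by
      rw [ncard_diff_singleton_of_mem hQS]; omega
    have h5 := ih (V ⧸ L) (L.mkQ '' E) (hE.map (contr_sub h1)) (P.map L.mkQ) (L.mkQ x) (L.mkQ y)
      (plane_mkQ hP (hinf P hP hxP hQP.symm)) (by rw [Ne, mkQ_eq_zero]; exact hxL) ⟨x, hxP, rfl⟩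
      ⟨y, hyP, rfl⟩ (by rw [Ne, mkQ_eq_zero]; exact h3) (by
        rw [Ne, mkQ_eq_iff]
        intro h
        have : y + x ∈ P ⊓ L := ⟨add_mem hyP hxP, h⟩
        rw [hinf P hP hxP hQP.symm, Submodule.mem_bot] at this
        exact hyx (eq_of_add this))
      ((fun R => R.map L.mkQ) '' (S \ {Q})) (by
        rintro _ ⟨R, ⟨hRS, hRQ⟩, rfl⟩
        obtain ⟨hR, hxR, hRP⟩ := hS R hRS
        refine ⟨plane_mkQ hR (hinf R hR hxR hRQ), ⟨x, hxR, rfl⟩, fun h => hRP ?_⟩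
        exact hinj R P hR hxR hRQ hP hxP hQP.symm h) (by
        rw [ncard_image_of_injOn, hS']
        rintro R ⟨hRS, hRQ⟩ R' ⟨hRS', hRQ'⟩ h
        obtain ⟨hR, hxR, hRP⟩ := hS R hRS
        obtain ⟨hR', hxR', hRP'⟩ := hS R' hRS'
        exact hinj R R' hR hxR hRQ hR' hxR' hRQ' h)
    omega

theorem M_1 [Finite V] (hE : AGF E) {P Q : Submodule K V} {q y : V}
    (hP : IsPlane E P) (hQ : IsPlane E Q) (hne : P ≠ Q)
    (hqP : q ∈ P) (hqQ : q ∈ Q) (hq : q ≠ 0) (hyP : y ∈ P) (hyq : y ≠ q) (hy0 : y ≠ 0) :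
    rho E y + 3 ≤ Module.finrank K V := by
  have := M_all 1 V E hE P q y hP hq hqP hyP hy0 hyq {Q} (by
    rintro _ rfl; exact ⟨hQ, hqQ, hne.symm⟩) (ncard_singleton _)
  omega

theorem M_2 [Finite V] (hE : AGF E) {P Q₁ Q₂ : Submodule K V} {q₁ q₂ y : V}
    (hP : IsPlane E P) (hQ₁ : IsPlane E Q₁) (hQ₂ : IsPlane E Q₂) (hne₁ : P ≠ Q₁) (hne₂ : P ≠ Q₂)
    (hqP₁ : q₁ ∈ P) (hqQ₁ : q₁ ∈ Q₁) (hq₁ : q₁ ≠ 0)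
    (hqP₂ : q₂ ∈ P) (hqQ₂ : q₂ ∈ Q₂) (hq₂ : q₂ ≠ 0) (hq : q₁ ≠ q₂)
    (hyP : y ∈ P) (hy₁ : y ≠ q₁) (hy₂ : y ≠ q₂) (hy0 : y ≠ 0) :
    rho E y + 5 ≤ Module.finrank K V := by
  have hPQ₁ := inf_one hE hP hQ₁ hne₁ hqP₁ hqQ₁ hq₁
  have hPQ₂ := inf_one hE hP hQ₂ hne₂ hqP₂ hqQ₂ hq₂
  have hnq : q₁ ∉ Q₂ := by
    intro h
    rcases inf_point hPQ₂.le hqP₂ hqQ₂ hq₂ hqP₁ h with h | h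
    · exact hq₁ h
    · exact hq h
  have hnq' : q₂ ∉ Q₁ := by
    intro h
    rcases inf_point hPQ₁.le hqP₁ hqQ₁ hq₁ hqP₂ h with h | h
    · exact hq₂ h
    · exact hq h.symm
  have hQQ : Q₁ ≠ Q₂ := by rintro rfl; exact hnq hqQ₁
  have hlamx : ∃ lam : V →ₗ[K] K, lam q₂ = 1 ∧ ∀ z ∈ Q₁, z ∈ Q₂ → lam z = 0 → z = 0 := by
    by_cases hz : ∃ z ∈ Q₁, z ∈ Q₂ ∧ z ≠ 0
    · obtain ⟨z, hz1, hz2, hz0⟩ := hz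
      have hzq : z ≠ q₂ := by rintro rfl; exact hnq' hz1
      have hLI : LinearIndependent K ![z, q₂] := by
        rw [LinearIndependent.pair_iff]
        intro c d hc
        rcases k01 c with rfl | rfl <;> rcases k01 d with rfl | rfl
        · exact ⟨rfl, rfl⟩
        · simp at hc; exact absurd hc hq₂
        · simp at hc; exact absurd hc hz0
        · simp at hc; exact absurd (eq_of_add hc) hzq
      obtain ⟨lam, hlam⟩ := exists_functional hLI (fun _ => 1)
      refine ⟨lam, hlam 1, ?_⟩
      intro w hw1 hw2 hw
      rcases inf_point (planes_meet hE hQ₁ hQ₂ hQQ) hz1 hz2 hz0 hw1 hw2 with h | h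
      · exact h
      · have h0 : lam z = 1 := hlam 0
        rw [h, h0] at hw
        exact absurd hw one_ne_zero
    · push Not at hz
      obtain ⟨lam, hlam⟩ := exists_lam hq₂
      exact ⟨lam, hlam, fun z h1 h2 _ => hz z h1 h2⟩
  obtain ⟨lam, hlam, hlz⟩ := hlamx
  obtain ⟨L, hL⟩ : ∃ L, L = Q₂ ⊓ LinearMap.ker lam := ⟨_, rfl⟩
  obtain ⟨h1, h2, h3, h4⟩ := M_step hE hP hQ₂ hne₂ hqP₂ hqQ₂ hq₂ hyP hy₂ hy0 lam hlam hL
  have hLQ : L ≤ Q₂ := by rw [hL]; exact inf_le_left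
  have hW : Finite (V ⧸ L) := Finite.of_surjective _ L.mkQ_surjective
  have hPL : P ⊓ L = ⊥ := inf_L hPQ₂.le hqP₂ hqQ₂ hq₂ hlam hL
  have hQL : Q₁ ⊓ L = ⊥ := by
    rw [eq_bot_iff]
    rintro z ⟨hz1, hz2⟩
    rw [hL] at hz2
    exact hlz z hz1 hz2.1 hz2.2
  have h5 := M_1 (hE.map (contr_sub h1)) (plane_mkQ hP hPL) (plane_mkQ hQ₁ hQL)
    (q := L.mkQ q₁) (y := L.mkQ y) (by
      intro h
      exact third_plane hE hP hQ₂ hQ₁ hPQ₂ hne₁.symm hQQ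
        ((le_of_map_eq h.symm).trans (sup_le_sup_left hLQ _)))
    ⟨q₁, hqP₁, rfl⟩ ⟨q₁, hqQ₁, rfl⟩ (by rw [Ne, mkQ_eq_zero]; exact fun h => hnq (hLQ h))
    ⟨y, hyP, rfl⟩ (by
      rw [Ne, mkQ_eq_iff]
      intro h
      have : y + q₁ ∈ P ⊓ L := ⟨add_mem hyP hqP₁, h⟩
      rw [hPL, Submodule.mem_bot] at this
      exact hy₁ (eq_of_add this)) (by rw [Ne, mkQ_eq_zero]; exact h3)
  omega
end mm
end NR

namespace NR

section beta
variable {V U X : Type} [AddCommGroup V] [Module K V] [AddCommGroup U] [Module K U]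
variable {E : Set V} {x : V} {f : V →ₗ[K] U}

theorem exists_out {P : Submodule K V} [Finite V] (hP : Module.finrank K P = 3) {a b : V} :
    ∃ y ∈ P, y ≠ 0 ∧ y ≠ a ∧ y ≠ b := by
  by_contra h
  push Not at h
  have h1 : (P : Set V) ⊆ {0, a, b} := by
    intro y hy
    by_cases h0 : y = 0
    · simp [h0]
    by_cases h2 : y = a
    · simp [h2]
    · simp [h y hy h0 h2]
  have h2 := ncard_le_ncard h1 (Set.toFinite _)
  have h3 := ncard_insert_le (0:V) {a, b}
  have h4 := ncard_insert_le a {b}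
  rw [ncard_singleton] at h4
  rw [ncard_sub, hP] at h2
  omega

theorem FM_con [Finite V] {y : V} (hyE : y ∈ E) (hy0 : y ≠ 0) {Q : Submodule K V} (hQ : IsPlane E Q)
    (hyQ : y ∉ Q) : FM (qt y '' E) := FM.of_plane (hQ.map (c1_qt hyE hy0) hyQ)

theorem caseA [Finite V] (hE : AGF E) (h0 : (0:V) ∈ E) {P Q : Submodule K V} (hP : IsPlane E P)
    (hQ : IsPlane E Q) (hne : P ≠ Q) (hx0 : x ≠ 0) (hxP : x ∈ P) (hxQ : x ∈ Q) :
    ∃ y ∈ E, y ≠ 0 ∧ FM (qt y '' E) ∧ (T E (qt y)).ncard + 2 ≤ Module.finrank K V := by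
  obtain ⟨z, hz0, hz⟩ := Set.exists_max_image {v : V | v ≠ 0}
    (fun v => {P | IsPlane E P ∧ v ∈ P}.ncard) (Set.toFinite _) ⟨x, hx0⟩
  have h2 : 2 ≤ {P | IsPlane E P ∧ z ∈ P}.ncard := by
    refine le_trans ?_ (hz x hx0)
    have hc2 := ncard_pair hne
    refine hc2.symm.le.trans ?_
    apply ncard_le_ncard _ (Set.toFinite _)
    rintro _ (rfl | rfl)
    · exact ⟨hP, hxP⟩
    · exact ⟨hQ, hxQ⟩
  clear hP hQ hne hxP hxQ P Q
  have hlb : ∀ y ∈ E, y ≠ 0 → (T E (qt y)).ncard ≤ rho E y + {P | IsPlane E P ∧ y ∈ P}.ncard :=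
    fun y hy hy0 => lines_bound hE (c1_qt hy hy0) h0
  obtain ⟨P, hP, hzP⟩ : {P | IsPlane E P ∧ z ∈ P}.Nonempty := by
    rw [← Set.ncard_pos (Set.toFinite _)]; omega
  set S : Set (Submodule K V) := {P | IsPlane E P ∧ z ∈ P} \ {P} with hSdef
  have hS : S.ncard + 1 = {P | IsPlane E P ∧ z ∈ P}.ncard :=
    ncard_diff_singleton_add_one ⟨hP, hzP⟩ (Set.toFinite _)
  obtain ⟨Q, ⟨hQ, hzQ⟩, hQP⟩ : S.Nonempty := by
    rw [← Set.ncard_pos (Set.toFinite _)]; omega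
  have hQP : Q ≠ P := hQP
  have hout : ∀ y ∈ P, y ≠ 0 → y ≠ z → y ∉ Q := by
    intro y hy hy0 hyz hyQ
    rcases inf_point (planes_meet hE hP hQ hQP.symm) hzP hzQ hz0 hy hyQ with h | h
    · exact hy0 h
    · exact hyz h
  by_cases h3 : 3 ≤ {P | IsPlane E P ∧ z ∈ P}.ncard
  · obtain ⟨y, hyP, hy0, hyz, -⟩ := exists_out hP.1 (a := z) (b := z)
    refine ⟨y, hP.2 hyP, hy0, FM_con (hP.2 hyP) hy0 hQ (hout y hyP hy0 hyz), ?_⟩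
    have h4 := M_all S.ncard V E hE P z y hP hz0 hzP hyP hy0 hyz S (by
      rintro R ⟨⟨h1, h2⟩, h3⟩; exact ⟨h1, h2, h3⟩) rfl
    have h5 := hlb y (hP.2 hyP) hy0
    have h6 := hz y hy0
    omega
  · obtain ⟨q, hqP, hq0, hqz, -⟩ := exists_out hP.1 (a := z) (b := z)
    by_cases h4 : {P | IsPlane E P ∧ q ∈ P}.ncard ≤ 1
    · refine ⟨q, hP.2 hqP, hq0, FM_con (hP.2 hqP) hq0 hQ (hout q hqP hq0 hqz), ?_⟩
      have h5 := hlb q (hP.2 hqP) hq0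
      have h6 := M_1 hE hP hQ hQP.symm hzP hzQ hz0 hqP hqz hq0
      omega
    · obtain ⟨R, ⟨hR, hqR⟩, hRP⟩ := exists_ne_of_one_lt_ncard (not_le.1 h4) P
      obtain ⟨y, hyP, hy0, hyz, hyq⟩ := exists_out hP.1 (a := z) (b := q)
      refine ⟨y, hP.2 hyP, hy0, FM_con (hP.2 hyP) hy0 hQ (hout y hyP hy0 hyz), ?_⟩
      have h5 := hlb y (hP.2 hyP) hy0
      have h6 := M_2 hE hP hQ hR hQP.symm hRP.symm hzP hzQ hz0 hqP hqR hq0 hqz.symm hyP hyz hyq hy0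
      have h7 := hz y hy0
      omega

theorem caseA6 [Finite V] (hV : Module.finrank K V = 6) (hE : AGF E) (hs : Submodule.span K E = ⊤)
    (hall : ∀ e ∈ E, e ≠ 0 → ∃ R, IsPlane E R ∧ e ∈ R)
    {P Q : Submodule K V} (hP : IsPlane E P)
    (hQ : IsPlane E Q) (hne : P ≠ Q) (hx0 : x ≠ 0) (hxP : x ∈ P) (hxQ : x ∈ Q) : False := by
  have hPQ := inf_one hE hP hQ hne hxP hxQ hx0
  have h5 : Module.finrank K (P ⊔ Q : Submodule K V) = 5 := by
    have := Submodule.finrank_sup_add_finrank_inf_eq P Q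
    rw [hP.1, hQ.1] at this
    omega
  obtain ⟨z, hzE, hz⟩ : ∃ z ∈ E, z ∉ P ⊔ Q := by
    by_contra h
    push Not at h
    have h1 : Submodule.span K E ≤ P ⊔ Q := Submodule.span_le.2 h
    rw [hs, top_le_iff] at h1
    rw [h1, finrank_top] at h5
    omega
  obtain ⟨R, hR, hzR⟩ := hall z hzE (by rintro rfl; exact hz (Submodule.zero_mem _))
  have hRP : R ≠ P := by rintro rfl; exact hz (Submodule.mem_sup_left hzR)
  have hRQ : R ≠ Q := by rintro rfl; exact hz (Submodule.mem_sup_right hzR)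
  have h1 := planes_meet hE hR hP hRP
  have h2 := planes_meet hE hR hQ hRQ
  have hd := Submodule.finrank_sup_add_finrank_inf_eq R (P ⊔ Q)
  have hd2 := Submodule.finrank_le (R ⊔ (P ⊔ Q))
  rw [hR.1, h5] at hd
  have h3 : ((R ⊓ (P ⊔ Q) : Submodule K V) : Set V) \ {0} ⊆
      ((R ⊓ P : Submodule K V) : Set V) \ {0} ∪ ((R ⊓ Q : Submodule K V) : Set V) \ {0} := by
    rintro z ⟨⟨hz, hz'⟩, hz0⟩
    rcases planes_span hE hP hQ hPQ (hR.2 hz) hz' with h | h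
    · exact Or.inl ⟨⟨hz, h⟩, hz0⟩
    · exact Or.inr ⟨⟨hz, h⟩, hz0⟩
  have h4 := ncard_le_ncard h3 (Set.toFinite _)
  have h6 := ncard_union_le (((R ⊓ P : Submodule K V) : Set V) \ {0}) (((R ⊓ Q : Submodule K V) : Set V) \ {0})
  have c : ∀ S : Submodule K V, ((S : Set V) \ {0}).ncard + 1 = 2 ^ Module.finrank K S := by
    intro S
    rw [← ncard_sub S]
    exact ncard_diff_singleton_add_one S.zero_mem (Set.toFinite _)
  have c1 := c (R ⊓ (P ⊔ Q))
  have c2 := c (R ⊓ P)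
  have c3 := c (R ⊓ Q)
  have h7 := Nat.pow_le_pow_right (show 0 < 2 by norm_num) h1
  have h8 := Nat.pow_le_pow_right (show 0 < 2 by norm_num) h2
  have h9 := Nat.pow_le_pow_right (show 0 < 2 by norm_num)
    (show 2 ≤ Module.finrank K (R ⊓ (P ⊔ Q) : Submodule K V) by omega)
  omega

theorem map_ne [Finite V] (hE : AGF E) {y : V} (hy : C1 E y f) {P Q : Submodule K V} (hP : IsPlane E P)
    (hQ : IsPlane E Q) (hne : P ≠ Q) (hyP : y ∉ P) : P.map f ≠ Q.map f := by
  intro h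
  have h1 := planes_meet hE hP hQ hne
  have h2 := Submodule.finrank_sup_add_finrank_inf_eq P Q
  have h3 : P ⊔ Q ≤ (P.map f).comap f := by
    rw [sup_le_iff]
    refine ⟨Submodule.le_comap_map _ _, ?_⟩
    rw [h]; exact Submodule.le_comap_map _ _
  have h4 := Submodule.finrank_mono h3
  rw [hy.finrank_comap, hy.finrank_map hyP, hP.1] at h4
  rw [hP.1, hQ.1] at h2
  omega

theorem caseB [Finite V] (hV : 6 ≤ Module.finrank K V) (hE : AGF E) (h0 : (0:V) ∈ E)
    (hs : Submodule.span K E = ⊤)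
    (hall : ∀ e ∈ E, e ≠ 0 → ∃ R, IsPlane E R ∧ e ∈ R)
    (hdis : ∀ P Q, IsPlane E P → IsPlane E Q → ∀ z, z ≠ 0 → z ∈ P → z ∈ Q → P = Q) :
    ∃ y ∈ E, y ≠ 0 ∧ FM (qt y '' E) ∧ (T E (qt y)).ncard + 2 ≤ Module.finrank K V ∧
      (Module.finrank K V = 6 → E.ncard ≤ 20) := by
  have hout : ∀ P : Submodule K V, Module.finrank K P ≠ Module.finrank K V → ∃ e ∈ E, e ∉ P := by
    intro P hP
    by_contra h
    push Not at h
    have h1 : Submodule.span K E ≤ P := Submodule.span_le.2 h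
    rw [hs, top_le_iff] at h1
    rw [h1, finrank_top] at hP
    exact hP rfl
  obtain ⟨x, hxE, hx⟩ := hout ⊥ (by rw [finrank_bot]; omega)
  have hx0 : x ≠ 0 := by simpa using hx
  obtain ⟨P, hP, hxP⟩ := hall x hxE hx0
  have hc := c1_qt hxE hx0
  by_cases hopt : ∀ e ∈ E, e + x ∈ E → e ∈ P
  · have hU : Finite (V ⧸ Submodule.span K {x}) := Finite.of_surjective _ hc.surj
    have hT3 : (T E (qt x)).ncard ≤ 3 := by
      have h1 : T E (qt x) ⊆ (P.map (qt x) : Set _) \ {0} := by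
        intro u hu
        obtain ⟨e, rfl⟩ := hc.surj u
        refine ⟨⟨e, ?_, rfl⟩, hu.1⟩
        obtain ⟨-, -, h1, h2⟩ := hc.mem_T.1 hu
        exact hopt e h1 h2
      have h2 := ncard_le_ncard h1 (Set.toFinite _)
      have h3 := ncard_diff_singleton_add_one (s := ((P.map (qt x) : Submodule K _) : Set (V ⧸ Submodule.span K {x}))) (a := 0)
        (Submodule.zero_mem _) (Set.toFinite _)
      have h4 := hc.finrank_map' hxP
      rw [hP.1] at h4
      have h5 : Module.finrank K (P.map (qt x)) = 2 := by omega
      rw [ncard_sub, h5] at h3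
      omega
    obtain ⟨e, heE, heP⟩ := hout P (by rw [hP.1]; omega)
    obtain ⟨R, hR, heR⟩ := hall e heE (by rintro rfl; exact heP P.zero_mem)
    have hxR : x ∉ R := by
      intro h
      have := hdis P R hP hR x hx0 hxP h
      rw [this] at heP
      exact heP heR
    refine ⟨x, hxE, hx0, FM_con hxE hx0 hR hxR, by omega, ?_⟩
    intro h6
    have h1 := hc.count h0
    have h2 := hc.finrank
    have h3 := rank5 (by omega) (hE.map hc.contr) ⟨0, h0, map_zero _⟩
    omega
  · push Not at hopt
    obtain ⟨e, heE, hexE, heP⟩ := hopt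
    have he0 : e ≠ 0 := by rintro rfl; exact heP P.zero_mem
    obtain ⟨P₁, hP₁, heP₁⟩ := hall e heE he0
    have hdP : e + x ∉ P := by
      intro h; exact heP ((Submodule.add_mem_iff_left P hxP).1 h)
    have hd0 : e + x ≠ 0 := by intro h; rw [h] at hdP; exact hdP P.zero_mem
    obtain ⟨P₂, hP₂, hdP₂⟩ := hall (e + x) hexE hd0
    have hPP₁ : P ≠ P₁ := by rintro rfl; exact heP heP₁
    have hxP₁ : x ∉ P₁ := by
      intro h; exact hPP₁ (hdis P P₁ hP hP₁ x hx0 hxP h)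
    have hdP₁ : e + x ∉ P₁ := by
      intro h; exact hxP₁ ((Submodule.add_mem_iff_right P₁ heP₁).1 h)
    have hP₁₂ : P₁ ≠ P₂ := by rintro rfl; exact hdP₁ hdP₂
    have hPP₂ : P ≠ P₂ := by rintro rfl; exact hdP hdP₂
    obtain ⟨y, hyP, hy0, hyx, -⟩ := exists_out hP.1 (a := x) (b := x)
    have hyE := hP.2 hyP
    have hyP₁ : y ∉ P₁ := fun h => hPP₁ (hdis P P₁ hP hP₁ y hy0 hyP h)
    have hyP₂ : y ∉ P₂ := fun h => hPP₂ (hdis P P₂ hP hP₂ y hy0 hyP h)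
    have hyc := c1_qt hyE hy0
    have hU : Finite (V ⧸ Submodule.span K {y}) := Finite.of_surjective _ hyc.surj
    have hdc := c1_qt hexE hd0
    have hW : Finite (V ⧸ Submodule.span K {e + x}) := Finite.of_surjective _ hdc.surj
    have hT : (T E (qt y)).ncard + 2 ≤ Module.finrank K V := by
      have h1 := lines_bound hE hyc h0
      have h2 : {R | IsPlane E R ∧ y ∈ R}.ncard ≤ 1 := by
        rw [ncard_le_one (Set.toFinite _)]
        rintro R ⟨hR, hyR⟩ R' ⟨hR', hyR'⟩
        exact hdis R R' hR hR' y hy0 hyR hyR'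
      have hgx : qt (e + x) x ≠ 0 := by
        rw [Ne, hdc.eq_zero_iff]
        rintro (h | h)
        · exact hx0 h
        · apply hdP; rw [← h]; exact hxP
      have h3 := M_1 (hE.map hdc.contr) (hP.map hdc hdP) (hP₁.map hdc hdP₁)
        (map_ne hE hdc hP hP₁ hPP₁ hdP) (q := qt (e + x) x) (y := qt (e + x) y) ⟨x, hxP, rfl⟩
        ⟨e, heP₁, by rw [hdc.eq_iff]; right; have := aa x; grind⟩ hgx ⟨y, hyP, rfl⟩ (by
          rw [Ne, hdc.eq_iff]
          rintro (h | h)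
          · exact hyx h
          · apply hdP
            have : e + x = x + y := by rw [h, aab]
            rw [this]; exact add_mem hxP hyP) (by
          rw [Ne, hdc.eq_zero_iff]
          rintro (h | h)
          · exact hy0 h
          · apply hdP; rw [← h]; exact hyP)
      have hyL : y ∉ Submodule.span K {e + x} := by
        intro h
        rcases span_single_mem h with h | h
        · exact hy0 h
        · apply hdP; rw [← h]; exact hyP
      have h4 : rho E y ≤ rho (qt (e + x) '' E) (qt (e + x) y) + Module.finrank K
        (Submodule.span K (T E (qt y)) ⊓
          (Submodule.span K {e + x}).map (qt y) : Submodule K _) :=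
        rho_le (L := Submodule.span K {e + x}) hyE hyL
      have h5 := hdc.finrank
      have h6 : Module.finrank K (Submodule.span K (T E (qt y)) ⊓
          (Submodule.span K {e + x}).map (qt y) : Submodule K _) ≤ 1 := by
        refine (Submodule.finrank_mono inf_le_right).trans ?_
        rw [Submodule.map_span, image_singleton]
        by_cases hz : qt y (e + x) = 0
        · rw [hz, Submodule.span_zero_singleton, finrank_bot]; omega
        · rw [finrank_span_singleton hz]
      have h1' : (T E (qt y)).ncard ≤ rho E y + {R | IsPlane E R ∧ y ∈ R}.ncard := h1
      omega
    refine ⟨y, hyE, hy0, FM_con hyE hy0 hP₁ hyP₁, hT, ?_⟩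
    intro h6
    have h1 := hyc.count h0
    have h2 := hyc.finrank
    have h3 := five_planes (by omega) (hE.map hyc.contr) (hP₁.map hyc hyP₁) (hP₂.map hyc hyP₂)
      (map_ne hE hyc hP₁ hP₂ hP₁₂ hyP₁)
    omega

theorem alpha6 [Finite V] (hV : Module.finrank K V = 6) (hE : AGF E) (h0 : (0:V) ∈ E)
    {c : V} (hc : c ∈ E) (hc0 : c ≠ 0) (hT : (T E (qt c)).ncard + 2 ≤ Module.finrank K V)
    (hns : Submodule.span K (T E (qt c)) ≠ ⊤) (hFM : FM (qt c '' E)) : E.ncard ≤ 20 := by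
  have hcc := c1_qt hc hc0
  have hU : Finite (V ⧸ Submodule.span K {c}) := Finite.of_surjective _ hcc.surj
  have h1 := hcc.count h0
  have h2 := hcc.finrank
  by_cases h16 : 16 ≤ (qt c '' E).ncard
  · obtain ⟨lam, hlam, hker⟩ := Submodule.exists_le_ker_of_lt_top _ (lt_top_iff_ne_top.2 hns)
    obtain ⟨_, ⟨d, hdE, rfl⟩, hd1, hd8⟩ := R5 (by omega) (hE.map hcc.contr) ⟨0, h0, map_zero _⟩ h16 hFM lam hlam
    have hd0 : d ≠ 0 := by rintro rfl; simp at hd1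
    have hdc := c1_qt hdE hd0
    have hW : Finite (V ⧸ Submodule.span K {d}) := Finite.of_surjective _ hdc.surj
    have hk : ∀ e ∈ E, e + c ∈ E → lam (qt c e) = 0 := by
      intro e he hec
      by_cases hz : qt c e = 0
      · rw [hz, map_zero]
      · apply hker
        apply Submodule.subset_span
        rw [hcc.mem_T]
        refine ⟨?_, ?_, he, hec⟩
        · rintro rfl; simp at hz
        · rintro rfl; exact hz hcc.apply
    have hD : {e | e ∈ E ∧ e + d ∈ E}.ncard ≤ 8 := by
      refine le_trans ?_ hd8
      refine ncard_le_ncard_of_injOn (qt c) ?_ ?_ (Set.toFinite _)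
      · rintro e ⟨h1, h2⟩
        exact ⟨⟨e, h1, rfl⟩, ⟨e + d, h2, by rw [map_add]⟩⟩
      · rintro e ⟨h1, h2⟩ e' ⟨h3, h4⟩ h
        rcases hcc.eq_iff.1 h with h5 | h5
        · exact h5
        · exfalso
          have k1 := hk e' h3 (h5 ▸ h1)
          have k2 := hk (e' + d) h4 (by
            have : e' + d + c = e + d := by rw [h5]; abel
            rw [this]; exact h2)
          rw [map_add, map_add, k1, hd1, zero_add] at k2
          exact one_ne_zero k2
    have h3 := hdc.ncard_D h0
    have h4 := hdc.count h0
    have h5 := hdc.finrank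
    have h6 := rank5 (by omega) (hE.map hdc.contr) ⟨0, h0, map_zero _⟩
    omega
  · omega

theorem Tle [Finite V] (hE : AGF E) (h0 : (0:V) ∈ E)
    {c : V} (hc : c ∈ E) (hc0 : c ≠ 0) (hnp : ∀ Q, IsPlane E Q → c ∉ Q)
    (hns : Submodule.span K (T E (qt c)) ≠ ⊤) : (T E (qt c)).ncard + 2 ≤ Module.finrank K V := by
  have hcc := c1_qt hc hc0
  have hU : Finite (V ⧸ Submodule.span K {c}) := Finite.of_surjective _ hcc.surj
  have h1 := ncard_LI (T_LI hE hcc h0 hnp)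
  have h2 := hcc.finrank
  have h3 := Submodule.finrank_lt (lt_top_iff_ne_top.2 hns).ne
  omega

theorem good [Finite V] (hV : 6 ≤ Module.finrank K V) (hE : AGF E) (h0 : (0:V) ∈ E)
    (hs : Submodule.span K E = ⊤) (hFM : FM E) :
    ∃ y ∈ E, y ≠ 0 ∧ FM (qt y '' E) ∧ (T E (qt y)).ncard + 2 ≤ Module.finrank K V ∧
      (Module.finrank K V = 6 → E.ncard ≤ 20) := by
  by_cases hpl : ∃ P, IsPlane E P
  · obtain ⟨P, hP⟩ := hpl
    by_cases hall : ∀ e ∈ E, e ≠ 0 → ∃ R, IsPlane E R ∧ e ∈ R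
    · by_cases hdis : ∀ P Q, IsPlane E P → IsPlane E Q → ∀ z, z ≠ 0 → z ∈ P → z ∈ Q → P = Q
      · exact caseB hV hE h0 hs hall hdis
      · push Not at hdis
        obtain ⟨P, Q, hP, hQ, z, hz0, hzP, hzQ, hne⟩ := hdis
        obtain ⟨y, h1, h2, h3, h4⟩ := caseA hE h0 hP hQ hne hz0 hzP hzQ
        exact ⟨y, h1, h2, h3, h4, fun h6 => (caseA6 h6 hE hs hall hP hQ hne hz0 hzP hzQ).elim⟩
    · push Not at hall
      obtain ⟨x, hxE, hx0, hx⟩ := hall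
      obtain ⟨y, hyE, hy0, hyn, hns⟩ := K0 (by omega) hE h0 hP hxE hx0 hx
      have hFMy := FM_con hyE hy0 hP (hyn P hP)
      have hT := Tle hE h0 hyE hy0 hyn hns
      exact ⟨y, hyE, hy0, hFMy, hT, fun h6 => alpha6 h6 hE h0 hyE hy0 hT hns hFMy⟩
  · obtain ⟨U, _, _, f, hf, P, hP⟩ := hFM
    rcases caseII _ V E hE h0 U f hf rfl ⟨P, hP⟩ with h | ⟨c, hcE, hc0, hns, hFMc⟩
    · exact absurd h hpl
    · have hT := Tle hE h0 hcE hc0 (fun Q hQ => (hpl ⟨Q, hQ⟩).elim) hns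
      exact ⟨c, hcE, hc0, hFMc, hT, fun h6 => alpha6 h6 hE h0 hcE hc0 hT hns hFMc⟩

theorem thmA : ∀ (n : ℕ), 6 ≤ n → ∀ (V : Type) [AddCommGroup V] [Module K V] [Finite V] (E : Set V),
    Module.finrank K V = n → AGF E → (0:V) ∈ E → Submodule.span K E = ⊤ → FM E →
    E.ncard ≤ n.choose 2 + 5 := by
  intro n hn
  induction n, hn using Nat.le_induction with
  | base =>
    intro V _ _ _ E hV hE h0 hs hFM
    obtain ⟨y, h1, h2, h3, h4, h5⟩ := good hV.ge hE h0 hs hFM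
    exact h5 hV
  | succ n hn ih =>
    intro V _ _ _ E hV hE h0 hs hFM
    obtain ⟨y, h1, h2, h3, h4, h5⟩ := good (by omega) hE h0 hs hFM
    have hyc := c1_qt h1 h2
    have hU : Finite (V ⧸ Submodule.span K {y}) := Finite.of_surjective _ hyc.surj
    have h6 := hyc.finrank
    have h7 := ih (V ⧸ Submodule.span K {y}) (qt y '' E) (by omega) (hE.map hyc.contr) ⟨0, h0, map_zero _⟩
      (by rw [← Submodule.map_span, hs, Submodule.map_top, LinearMap.range_eq_top.2 hyc.surj]) h3
    have h8 := hyc.count h0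
    have h9 : (n + 1).choose 2 = n + n.choose 2 := by
      rw [Nat.choose_succ_succ' n 1, Nat.choose_one_right]
    omega
end beta
end NR

namespace NR

section fd
variable {V U X : Type} [AddCommGroup V] [Module K V] [AddCommGroup U] [Module K U]
variable {E : Set V} {x : V} {f : V →ₗ[K] U}

/-- `E` has a minor that is the dual of the Fano plane -/
def FD (E : Set V) : Prop :=
  ∃ (U : Type) (_ : AddCommGroup U) (_ : Module K U) (f : V →ₗ[K] U),
    IsContr E f ∧ Module.finrank K U = 4 ∧ ∃ g : (Fin 4 → K) →ₗ[K] U, Function.Injective g ∧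
      ∀ x, x 0 = 1 → x ≠ Pi.single 0 1 → g x ∈ f '' E

theorem W3F [Finite V] {ι : Type} [DecidableEq ι] (h0 : (0:V) ∈ E) (hx : C1 E x f) {b : ι → U}
    (hb : LinearIndependent K b) (hT : ∀ i, b i ∈ T E f) {i j k : ι} (hij : i ≠ j) (hik : i ≠ k)
    (hjk : j ≠ k) (h : b i + b j + b k ∈ f '' E) : FM E := by
  obtain ⟨z, hzE, hz⟩ := h
  have hU : Finite U := Finite.of_surjective f hx.surj
  have hzS : f z ∉ Submodule.span K ({b i, b j} : Set U) := by
    intro hm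
    obtain ⟨φ, hφ⟩ := coord hb k
    have h1 : φ (b i) = 0 := by rw [← wd_single b i, hφ, if_neg (by simpa using hik.symm)]
    have h2 : φ (b j) = 0 := by rw [← wd_single b j, hφ, if_neg (by simpa using hjk.symm)]
    have h3 : φ (b k) = 1 := by rw [← wd_single b k, hφ, if_pos (by simp)]
    have h4 : Submodule.span K ({b i, b j} : Set U) ≤ LinearMap.ker φ := by
      rw [Submodule.span_le]
      rintro _ (rfl | rfl)
      · exact h1
      · exact h2
    have h5 : φ (f z) = 0 := h4 hm
    rw [hz, map_add, map_add, h1, h2, h3] at h5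
    simp at h5
  have hz0 : z ≠ 0 := by rintro rfl; apply hzS; rw [map_zero]; exact Submodule.zero_mem _
  have hzc := c1_qt hzE hz0
  set S := (Submodule.span K ({b i, b j} : Set U)).comap f with hS
  have hS3 : Module.finrank K S = 3 := by
    rw [hS, hx.finrank_comap, finrank_pair (hb.ne_zero i) (hb.ne_zero j) (hb.injective.ne hij)]
  refine FM.of_map hzc.contr (FM.of_plane (P := S.map (qt z)) ⟨?_, ?_⟩)
  · rw [hzc.finrank_map (show z ∉ S from hzS), hS3]
  · rintro _ ⟨v, hv, rfl⟩
    have hv : f v ∈ Submodule.span K ({b i, b j} : Set U) := hv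
    rcases span_pair_mem hv with h1 | h1 | h1 | h1
    · rcases hx.eq_zero_iff.1 h1 with rfl | rfl
      · exact ⟨0, h0, rfl⟩
      · exact ⟨v, hx.mem, rfl⟩
    · exact ⟨v, (hT i).2 v h1, rfl⟩
    · exact ⟨v, (hT j).2 v h1, rfl⟩
    · refine ⟨v + z, (hT k).2 _ ?_, ?_⟩
      · rw [map_add, h1, hz, ← add_assoc, aa, zero_add]
      · rw [map_add, hzc.apply, add_zero]

theorem mask4 : ∀ p : Fin 4 → K, p ≠ 0 → ∃ A B : Finset (Fin 4), A ≠ B ∧ 3 ≤ A.card ∧ 3 ≤ B.card ∧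
    ∑ i ∈ A, p i = 1 ∧ ∑ i ∈ B, p i = 1 := by
  decide +kernel

theorem fd4 [Finite V] (hE : AGF E) (h0 : (0:V) ∈ E) (hF : ¬ FM E) (hx : C1 E x f)
    (hU : Module.finrank K U = 4) (hT : Submodule.span K (T E f) = ⊤)
    (hg : ∃ g : (Fin 4 → K) →ₗ[K] U, Function.Injective g ∧
      ∀ x, x 0 = 1 → x ≠ Pi.single 0 1 → g x ∈ f '' E) : False := by
  obtain ⟨g, hgi, hg⟩ := hg
  have hUf : Finite U := Finite.of_surjective f hx.surj
  have hLI := T_LI hE hx h0 (fun P hP _ => hF (FM.of_plane hP))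
  have hc := ncard_LI hLI
  rw [hT, finrank_top, hU] at hc
  obtain ⟨b, hb, hbT⟩ := exists_b hx hLI hc.ge
  have hgs : Function.Surjective g := by
    rw [← LinearMap.injective_iff_surjective_of_finrank_eq_finrank]
    · exact hgi
    · rw [hU]; simp
  let ge := LinearEquiv.ofBijective g ⟨hgi, hgs⟩
  let φ : U →ₗ[K] K := LinearMap.proj 0 ∘ₗ ge.symm.toLinearMap
  have hφ : ∀ w, φ (g w) = w 0 := by
    intro w
    have : ge.symm (g w) = w := ge.symm_apply_apply w
    show (ge.symm (g w)) 0 = w 0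
    rw [this]
  have hspan : Submodule.span K (range b) = ⊤ := by
    apply Submodule.eq_top_of_finrank_eq
    rw [finrank_span_eq_card hb, hU]; rfl
  have hp : (fun i => φ (b i)) ≠ 0 := by
    intro h
    have h1 : Submodule.span K (range b) ≤ LinearMap.ker φ := by
      rw [Submodule.span_le]
      rintro _ ⟨i, rfl⟩
      exact congrFun h i
    rw [hspan] at h1
    have h2 : φ (g (Pi.single 0 1)) = 0 := h1 trivial
    rw [hφ] at h2
    simp at h2
  obtain ⟨A, B, hAB, hA, hB, hA1, hB1⟩ := mask4 _ hp
  have key : ∀ A : Finset (Fin 4), 3 ≤ A.card → ∑ i ∈ A, φ (b i) = 1 →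
      wd b A = g (Pi.single 0 1) := by
    intro A hA hA1
    obtain ⟨w, hw⟩ := hgs (wd b A)
    have h1 : w 0 = 1 := by
      rw [← hφ w, hw, ← hA1]; unfold wd; rw [map_sum]
    by_contra hne
    have h2 := hg w h1 (by rintro rfl; exact hne hw.symm)
    rw [hw] at h2
    rcases Nat.lt_or_ge 3 A.card with h4 | h4
    · exact W4 hE hx hb hbT h4 h2
    · obtain ⟨i, j, k, hij, hik, hjk, rfl⟩ := Finset.card_eq_three.1 (le_antisymm h4 hA)
      rw [wd_insert b (by simp [hij, hik]), wd_insert b (by simp [hjk]), wd_single, ← add_assoc] at h2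
      exact hF (W3F h0 hx hb hbT hij hik hjk h2)
  exact hAB (wd_inj hb ((key A hA hA1).trans (key B hB hB1).symm))

/-- a contraction factored through a point of the kernel -/
theorem factor {c : V} {C : Set V} (hC : C ⊆ E) (hf : Function.Surjective f)
    (hk : LinearMap.ker f = Submodule.span K C) (hc : c ∈ C) :
    ∃ g : (V ⧸ Submodule.span K {c}) →ₗ[K] U, (∀ v, g (qt c v) = f v) ∧ IsContr (qt c '' E) g ∧
      g '' (qt c '' E) = f '' E := by
  have hle : Submodule.span K {c} ≤ LinearMap.ker f := by
    rw [Submodule.span_le, hk]; rintro _ rfl; exact Submodule.subset_span hc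
  let g := (Submodule.span K {c}).liftQ f hle
  have hg : ∀ v, g (qt c v) = f v := fun v => Submodule.liftQ_apply _ _ _
  have hgk : LinearMap.ker g = (LinearMap.ker f).map (qt c) := Submodule.ker_liftQ _ _ _
  refine ⟨g, hg, ⟨?_, qt c '' C, image_mono hC, ?_⟩, ?_⟩
  · intro u
    obtain ⟨v, rfl⟩ := hf u
    exact ⟨_, hg v⟩
  · rw [hgk, hk, Submodule.map_span]
  · rw [image_image]; exact image_congr fun v _ => hg v

theorem goodB [Finite V] (hV : 5 ≤ Module.finrank K V) (hE : AGF E) (h0 : (0:V) ∈ E)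
    (hF : ¬ FM E) (hD : FD E) : ∃ c ∈ E, c ≠ 0 ∧ FD (qt c '' E) ∧
      Submodule.span K (T E (qt c)) ≠ ⊤ := by
  obtain ⟨U, _, _, f, hf, hU, hg⟩ := hD
  obtain ⟨C0, hC0, hk0⟩ := hf.ker
  obtain ⟨C, hCC, hspan, hLI⟩ := exists_linearIndependent K C0
  have hC : C ⊆ E := hCC.trans hC0
  have hk : LinearMap.ker f = Submodule.span K C := by rw [hk0, hspan]
  have hrk := LinearMap.finrank_range_add_finrank_ker f
  rw [LinearMap.range_eq_top.2 hf.surj, finrank_top, hU] at hrk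
  obtain ⟨c, hcC⟩ : C.Nonempty := by
    by_contra h
    rw [not_nonempty_iff_eq_empty] at h
    rw [hk, h, Submodule.span_empty, finrank_bot] at hrk
    omega
  have hc0 : c ≠ 0 := hLI.ne_zero (⟨c, hcC⟩ : C)
  have hcc := c1_qt (hC hcC) hc0
  obtain ⟨h, hh, hhc, hhi⟩ := factor hC hf.surj hk hcC
  refine ⟨c, hC hcC, hc0, ⟨U, _, _, h, hhc, hU, by rwa [hhi]⟩, fun hT => ?_⟩
  let Z := Submodule.span K (C \ {c})
  have hcZ : c ∉ Z := by
    have h1 := hLI.notMem_span_image (s := {i : C | (i:V) ≠ c}) (x := ⟨c, hcC⟩) (by simp)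
    have h2 : ((↑) : C → V) '' {i : C | (i:V) ≠ c} = C \ {c} := by
      ext v; constructor
      · rintro ⟨i, hi, rfl⟩; exact ⟨i.2, hi⟩
      · rintro ⟨h1, h2⟩; exact ⟨⟨v, h1⟩, h2, rfl⟩
    rw [h2] at h1
    exact h1
  have hZk : Z ≤ LinearMap.ker f := by rw [hk]; exact Submodule.span_mono diff_subset
  have hZc : IsContr E Z.mkQ := isContr_mkQ (diff_subset.trans hC)
  have hW : Finite (V ⧸ Z) := Finite.of_surjective _ Z.mkQ_surjective
  let k := Z.liftQ f hZk
  have hkv : ∀ v, k (Z.mkQ v) = f v := fun v => Submodule.liftQ_apply _ _ _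
  have hkC : C1 (Z.mkQ '' E) (Z.mkQ c) k := by
    refine ⟨⟨c, hC hcC, rfl⟩, ?_, ?_, ?_⟩
    · rw [Ne, mkQ_eq_zero]; exact hcZ
    · intro u; obtain ⟨v, rfl⟩ := hf.surj u; exact ⟨_, hkv v⟩
    · have h1 : LinearMap.ker k = (LinearMap.ker f).map Z.mkQ := Submodule.ker_liftQ _ _ _
      rw [h1, hk, Submodule.map_span]
      apply le_antisymm
      · rw [Submodule.span_le]
        rintro _ ⟨v, hv, rfl⟩
        by_cases hvc : v = c
        · rw [hvc]; exact Submodule.mem_span_singleton_self _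
        · have : Z.mkQ v = 0 := mkQ_eq_zero.2 (Submodule.subset_span ⟨hv, hvc⟩)
          rw [this]; exact Submodule.zero_mem _
      · apply Submodule.span_mono
        rintro _ rfl
        exact ⟨c, hcC, rfl⟩
  have hki : k '' (Z.mkQ '' E) = f '' E := by rw [image_image]; exact image_congr fun v _ => hkv v
  refine fd4 (hE.map hZc) ⟨0, h0, map_zero _⟩ (fun h => hF (FM.of_map hZc h)) hkC hU ?_ (by rwa [hki])
  have h1 : ∀ u ∈ T E (qt c), h u ≠ 0 → h u ∈ T (Z.mkQ '' E) k := by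
    intro u hu hne
    obtain ⟨e, rfl⟩ := hcc.surj u
    obtain ⟨-, -, h1, h2⟩ := hcc.mem_T.1 hu
    rw [hh, ← hkv] at hne ⊢
    rw [hkC.mem_T]
    refine ⟨?_, ?_, ⟨e, h1, rfl⟩, ⟨e + c, h2, by rw [map_add]⟩⟩
    · intro h; rw [h, map_zero] at hne; exact hne rfl
    · intro h; rw [h, hkC.apply] at hne; exact hne rfl
  have h2 := span_T_le h1
  rw [hT, Submodule.map_top, LinearMap.range_eq_top.2 hhc.surj, top_le_iff] at h2
  exact h2

theorem thmB : ∀ (n : ℕ), 4 ≤ n → ∀ (V : Type) [AddCommGroup V] [Module K V] [Finite V] (E : Set V),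
    Module.finrank K V = n → AGF E → (0:V) ∈ E → ¬ FM E → FD E →
    E.ncard ≤ n.choose 2 + 5 := by
  intro n hn
  induction n, hn using Nat.le_induction with
  | base =>
    intro V _ _ _ E hV hE h0 hF hD
    by_contra h
    have h12 : 12 ≤ E.ncard := by
      have : Nat.choose 4 2 = 6 := rfl
      omega
    obtain ⟨P, hP⟩ := rank4_plane hV hE h12
    exact hF (FM.of_plane hP)
  | succ n hn ih =>
    intro V _ _ _ E hV hE h0 hF hD
    obtain ⟨y, h1, h2, h3, h4⟩ := goodB (by omega) hE h0 hF hD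
    have hyc := c1_qt h1 h2
    have hU : Finite (V ⧸ Submodule.span K {y}) := Finite.of_surjective _ hyc.surj
    have h6 := hyc.finrank
    have h7 := ih (V ⧸ Submodule.span K {y}) (qt y '' E) (by omega) (hE.map hyc.contr) ⟨0, h0, map_zero _⟩
      (fun h => hF (FM.of_map hyc.contr h)) h3
    have h8 := hyc.count h0
    have h10 := Tle hE h0 h1 h2 (fun P hP _ => hF (FM.of_plane hP)) h4
    have h9 : (n + 1).choose 2 = n + n.choose 2 := by
      rw [Nat.choose_succ_succ' n 1, Nat.choose_one_right]
    omega
end fd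
end NR

namespace NR
open Classical

/-- value at `t` of the vector of the graph of `A` determined by `v` -/
noncomputable def gr {k : Type} [Field k] {R S : Type} [Fintype S] (A : R → S → k) (v : S → k) : R ⊕ S → k :=
  Sum.elim (fun r => ∑ s, A r s * v s) v

/-- no nonzero vector of the graph of `A` vanishes on `T` -/
def Bs {k : Type} [Field k] {R S : Type} [Fintype S] (A : R → S → k) (T : Set (R ⊕ S)) : Prop :=
  ∀ v : S → k, (∀ t ∈ T, gr A v t = 0) → v = 0

/-- `B` represents the matroid of `A` restricted to the columns in `Q` -/
def RepQ {k F : Type} [Field k] [Field F] {R S : Type} [Fintype S] (Q : Set S)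
    (A : R → S → k) (B : R → S → F) : Prop :=
  ∀ T : Set (R ⊕ S), (∀ s, s ∉ Q → Sum.inr s ∈ T) → (Bs A T ↔ Bs B T)

/-- `B` represents the matroid of `A` -/
def Rep {k F : Type} [Field k] [Field F] {R S : Type} [Fintype S]
    (A : R → S → k) (B : R → S → F) : Prop :=
  ∀ T : Set (R ⊕ S), (Bs A T ↔ Bs B T)

/-- principal pivot transform -/
noncomputable def piv {k : Type} [Field k] {R S : Type} (A : R → S → k) (r0 : R) (s0 : S) : R → S → k :=
  fun r s => if r = r0 then (if s = s0 then (A r0 s0)⁻¹ else - (A r0 s0)⁻¹ * A r0 s)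
    else (if s = s0 then A r s0 * (A r0 s0)⁻¹ else A r s - A r s0 * (A r0 s0)⁻¹ * A r0 s)

section
variable {k F : Type} [Field k] [Field F] {R S : Type} [Fintype S]
  {A : R → S → k} {B : R → S → F}

theorem gr_inl (v : S → k) (r : R) : gr A v (Sum.inl r) = ∑ s, A r s * v s := rfl
theorem gr_inr (v : S → k) (s : S) : gr A v (Sum.inr s) = v s := rfl

theorem Bs.mono {T T' : Set (R ⊕ S)} (h : T ⊆ T') (hA : Bs A T) : Bs A T' :=
  fun v hv => hA v fun t ht => hv t (h ht)

theorem Rep.repQ (h : Rep A B) (Q : Set S) : RepQ Q A B := fun T _ => h T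
theorem repQ_univ (h : RepQ univ A B) : Rep A B := fun T => h T fun s hs => (hs trivial).elim

theorem sum_single' (A : R → S → k) (r : R) (s : S) (c : k) :
    ∑ t, A r t * (Pi.single s c : S → k) t = A r s * c := by
  rw [Finset.sum_eq_single s]
  · simp
  · intro b _ hb; simp [hb]
  · simp

/-- the set testing the entry `(r,s)` -/
theorem bs_entry (r : R) (s : S) :
    Bs A ({Sum.inl r} ∪ Sum.inr '' {s}ᶜ) ↔ A r s ≠ 0 := by
  constructor
  · intro h h0
    have := h (Pi.single s 1) (by
      rintro t (rfl | ⟨s', hs', rfl⟩)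
      · rw [gr_inl, sum_single', h0, zero_mul]
      · rw [gr_inr]; exact Pi.single_eq_of_ne hs' _)
    have := congrFun this s
    simp at this
  · intro h v hv
    have h1 : ∀ t, t ≠ s → v t = 0 := fun t ht => hv (Sum.inr t) (Or.inr ⟨t, ht, rfl⟩)
    have h2 : v = Pi.single s (v s) := by
      ext t
      by_cases ht : t = s
      · subst ht; simp
      · rw [h1 t ht, Pi.single_eq_of_ne ht]
    have h3 := hv (Sum.inl r) (Or.inl rfl)
    rw [gr_inl, h2, sum_single'] at h3
    rcases mul_eq_zero.1 h3 with h3 | h3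
    · exact (h h3).elim
    · rw [h2, h3]; simp

theorem RepQ.entry {Q : Set S} (h : RepQ Q A B) (r : R) {s : S} (hs : s ∈ Q) :
    A r s ≠ 0 ↔ B r s ≠ 0 := by
  rw [← bs_entry, ← bs_entry]
  exact h _ fun t ht => Or.inr ⟨t, by rintro rfl; exact ht hs, rfl⟩

/-- the set testing a two by two determinant -/
theorem bs_det {r r' : R} {s s' : S} (hss : s ≠ s') :
    Bs A ({Sum.inl r, Sum.inl r'} ∪ Sum.inr '' {s, s'}ᶜ) ↔ A r s * A r' s' - A r s' * A r' s ≠ 0 := by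
  have hsum : ∀ (q : R) (a b : k), ∑ t, A q t * (Pi.single s a + Pi.single s' b : S → k) t
      = A q s * a + A q s' * b := by
    intro q a b
    simp only [Pi.add_apply, mul_add, Finset.sum_add_distrib, sum_single']
  constructor
  · intro h h0
    have key : ∀ a b : k, A r s * a + A r s' * b = 0 → A r' s * a + A r' s' * b = 0 → a = 0 ∧ b = 0 := by
      intro a b h1 h2
      have := h (Pi.single s a + Pi.single s' b) (by
        rintro t ((rfl | rfl) | ⟨t, ht, rfl⟩)
        · rw [gr_inl, hsum, h1]
        · rw [gr_inl, hsum, h2]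
        · rw [gr_inr]
          simp only [mem_compl_iff, mem_insert_iff, mem_singleton_iff, not_or] at ht
          simp [Pi.single_eq_of_ne ht.1, Pi.single_eq_of_ne ht.2])
      have h3 := congrFun this s
      have h4 := congrFun this s'
      simp [hss, hss.symm] at h3 h4
      exact ⟨h3, h4⟩
    have h1 := key (A r' s') (-A r' s) (by linear_combination h0) (by ring)
    have h2 := key (A r s') (-A r s) (by ring) (by linear_combination -h0)
    have h3 := key 1 0 (by rw [neg_eq_zero.1 h2.2]; ring) (by rw [neg_eq_zero.1 h1.2]; ring)
    exact one_ne_zero h3.1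
  · intro h v hv
    have h1 : ∀ t, t ≠ s → t ≠ s' → v t = 0 := fun t ht ht' =>
      hv (Sum.inr t) (Or.inr ⟨t, by simp [ht, ht'], rfl⟩)
    have h2 : v = Pi.single s (v s) + Pi.single s' (v s') := by
      ext t
      by_cases ht : t = s
      · subst ht; simp [hss]
      · by_cases ht' : t = s'
        · subst ht'; simp [hss.symm]
        · rw [h1 t ht ht']; simp [ht, ht']
    have h3 := hv (Sum.inl r) (Or.inl (by simp))
    have h4 := hv (Sum.inl r') (Or.inl (by simp))
    rw [gr_inl, h2, hsum] at h3 h4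
    have h5 : (A r s * A r' s' - A r s' * A r' s) * v s = 0 := by
      linear_combination A r' s' * h3 - A r s' * h4
    have h6 : (A r s * A r' s' - A r s' * A r' s) * v s' = 0 := by
      linear_combination A r s * h4 - A r' s * h3
    rw [h2, (mul_eq_zero.1 h5).resolve_left h, (mul_eq_zero.1 h6).resolve_left h]
    simp

theorem RepQ.det {Q : Set S} (h : RepQ Q A B) (r r' : R) {s s' : S} (hss : s ≠ s') (hs : s ∈ Q) (hs' : s' ∈ Q) :
    A r s * A r' s' - A r s' * A r' s ≠ 0 ↔ B r s * B r' s' - B r s' * B r' s ≠ 0 := by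
  rw [← bs_det hss, ← bs_det hss]
  exact h _ fun t ht => Or.inr ⟨t, by rintro (rfl | rfl); exacts [ht hs, ht hs'], rfl⟩

/-! ### pivots -/

theorem piv_apply_ne {r0 r : R} {s0 s : S} (hr : r ≠ r0) (hs : s ≠ s0) :
    piv A r0 s0 r s = A r s - A r s0 * (A r0 s0)⁻¹ * A r0 s := by simp [piv, hr, hs]

theorem piv_row {r0 : R} {s0 s : S} (hs : s ≠ s0) :
    piv A r0 s0 r0 s = - (A r0 s0)⁻¹ * A r0 s := by simp [piv, hs]

theorem piv_col {r0 r : R} {s0 : S} (hr : r ≠ r0) :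
    piv A r0 s0 r s0 = A r s0 * (A r0 s0)⁻¹ := by simp [piv, hr]

theorem piv_self {r0 : R} {s0 : S} : piv A r0 s0 r0 s0 = (A r0 s0)⁻¹ := by simp [piv]

theorem piv_piv {r0 : R} {s0 : S} (h : A r0 s0 ≠ 0) : piv (piv A r0 s0) r0 s0 = A := by
  ext r s
  by_cases hr : r = r0 <;> by_cases hs : s = s0 <;> simp [piv, hr, hs] <;> field_simp <;> try ring

/-- row unchanged -/
theorem piv_of_col {r0 r : R} {s0 : S} (hr : A r s0 = 0) (h : A r0 s0 ≠ 0) (s : S) :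
    piv A r0 s0 r s = A r s := by
  have : r ≠ r0 := by rintro rfl; exact h hr
  by_cases hs : s = s0
  · subst hs; rw [piv_col this, hr, zero_mul]
  · rw [piv_apply_ne this hs, hr]; ring

/-- column unchanged -/
theorem piv_of_row {r0 : R} {s0 s : S} (hs : A r0 s = 0) (h : A r0 s0 ≠ 0) (r : R) :
    piv A r0 s0 r s = A r s := by
  have : s ≠ s0 := by rintro rfl; exact h hs
  by_cases hr : r = r0
  · subst hr; rw [piv_row this, hs, mul_zero]
  · rw [piv_apply_ne hr this, hs]; ring

/-- exchange of a row index and a column index -/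
noncomputable def xsw (r0 : R) (s0 : S) : Equiv.Perm (R ⊕ S) := Equiv.swap (Sum.inl r0) (Sum.inr s0)

theorem gr_piv {r0 : R} {s0 : S} (h : A r0 s0 ≠ 0) (v : S → k) :
    gr (piv A r0 s0) (Function.update v s0 (∑ s, A r0 s * v s)) = gr A v ∘ xsw r0 s0 := by
  have hsplit : ∀ f : S → k, ∑ s, f s = f s0 + ∑ s ∈ Finset.univ.erase s0, f s := fun f =>
    (Finset.add_sum_erase _ f (Finset.mem_univ s0)).symm
  ext t
  rcases t with r | s
  · rw [gr_inl, Function.comp]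
    by_cases hr : r = r0
    · subst hr
      rw [xsw, Equiv.swap_apply_left, gr_inr, hsplit, Function.update_self, piv_self]
      have : ∑ s ∈ Finset.univ.erase s0, piv A r s0 r s * Function.update v s0 (∑ s, A r s * v s) s
          = - (A r s0)⁻¹ * ∑ s ∈ Finset.univ.erase s0, A r s * v s := by
        rw [Finset.mul_sum]
        refine Finset.sum_congr rfl fun s hs => ?_
        have hs : s ≠ s0 := Finset.ne_of_mem_erase hs
        rw [piv_row hs, Function.update_of_ne hs]; ring
      rw [this, hsplit (fun s => A r s * v s)]
      field_simp; ring
    · rw [xsw, Equiv.swap_apply_of_ne_of_ne (by simpa using hr) (by simp), gr_inl, hsplit, Function.update_self,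
        piv_col hr]
      have : ∑ s ∈ Finset.univ.erase s0, piv A r0 s0 r s * Function.update v s0 (∑ s, A r0 s * v s) s
          = ∑ s ∈ Finset.univ.erase s0, A r s * v s
            - A r s0 * (A r0 s0)⁻¹ * ∑ s ∈ Finset.univ.erase s0, A r0 s * v s := by
        rw [Finset.mul_sum, ← Finset.sum_sub_distrib]
        refine Finset.sum_congr rfl fun s hs => ?_
        have hs : s ≠ s0 := Finset.ne_of_mem_erase hs
        rw [piv_apply_ne hr hs, Function.update_of_ne hs]; ring
      rw [this, hsplit (fun s => A r0 s * v s), hsplit (fun s => A r s * v s)]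
      field_simp; ring
  · rw [gr_inr, Function.comp]
    by_cases hs : s = s0
    · subst hs
      rw [xsw, Equiv.swap_apply_right, gr_inl, Function.update_self]
    · rw [xsw, Equiv.swap_apply_of_ne_of_ne (by simp) (by simpa using hs), gr_inr, Function.update_of_ne hs]

theorem gr_eq_zero {v : S → k} (h : gr A v = 0) : v = 0 := by
  ext s; exact congrFun h (Sum.inr s)

theorem gr_zero : gr A (0 : S → k) = 0 := by
  ext t; rcases t with r | s
  · rw [gr_inl]; simp
  · rfl

theorem bs_piv_aux {r0 : R} {s0 : S} (h : A r0 s0 ≠ 0) {T : Set (R ⊕ S)} (hT : Bs (piv A r0 s0) T) :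
    Bs A (xsw r0 s0 '' T) := by
  intro v hv
  have h1 := hT (Function.update v s0 (∑ s, A r0 s * v s)) (by
    intro t ht
    rw [gr_piv h]
    exact hv _ ⟨t, ht, rfl⟩)
  have h2 := gr_piv h v
  rw [h1, gr_zero] at h2
  apply gr_eq_zero (A := A)
  ext t
  have := congrFun h2 ((xsw r0 s0).symm t)
  simpa using this.symm

theorem xsw_sw (r0 : R) (s0 : S) (T : Set (R ⊕ S)) : xsw r0 s0 '' (xsw r0 s0 '' T) = T := by
  rw [← image_comp]
  have : (xsw r0 s0 ∘ xsw r0 s0 : R ⊕ S → R ⊕ S) = id := by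
    ext t; simp [xsw]
  rw [this, image_id]

theorem bs_piv {r0 : R} {s0 : S} (h : A r0 s0 ≠ 0) (T : Set (R ⊕ S)) :
    Bs (piv A r0 s0) T ↔ Bs A (xsw r0 s0 '' T) := by
  refine ⟨bs_piv_aux h, fun hT => ?_⟩
  have h1 : piv A r0 s0 r0 s0 ≠ 0 := by rw [piv_self]; exact inv_ne_zero h
  have := bs_piv_aux (A := piv A r0 s0) h1 (T := xsw r0 s0 '' T) (by rwa [piv_piv h])
  rwa [xsw_sw] at this

theorem RepQ.piv {Q : Set S} (h : RepQ Q A B) {r0 : R} {s0 : S} (hs : s0 ∈ Q) (h0 : A r0 s0 ≠ 0) :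
    RepQ Q (piv A r0 s0) (piv B r0 s0) := by
  intro T hT
  rw [bs_piv h0, bs_piv ((h.entry r0 hs).1 h0)]
  apply h
  intro s hsQ
  refine ⟨Sum.inr s, hT s hsQ, ?_⟩
  rw [xsw, Equiv.swap_apply_of_ne_of_ne (by simp)]
  simp only [ne_eq, Sum.inr.injEq]
  rintro rfl; exact hsQ hs

theorem Rep.piv (h : Rep A B) {r0 : R} {s0 : S} (h0 : A r0 s0 ≠ 0) :
    Rep (piv A r0 s0) (piv B r0 s0) := repQ_univ ((h.repQ univ).piv trivial h0)

theorem Rep.of_piv {r0 : R} {s0 : S} (h0 : A r0 s0 ≠ 0) (h : Rep (NR.piv A r0 s0) B) :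
    ∃ B' : R → S → F, Rep A B' := by
  refine ⟨NR.piv B r0 s0, ?_⟩
  have := h.piv (r0 := r0) (s0 := s0) (by rw [piv_self]; exact inv_ne_zero h0)
  rw [piv_piv h0] at this
  exact this

/-! ### scaling -/

theorem bs_scale {a : R → k} {b : S → k} (ha : ∀ r, a r ≠ 0) (hb : ∀ s, b s ≠ 0) (T : Set (R ⊕ S)) :
    Bs (fun r s => a r * A r s * b s) T ↔ Bs A T := by
  constructor
  · intro h v hv
    have := h (fun s => (b s)⁻¹ * v s) (by
      rintro (r | s) ht
      · rw [gr_inl]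
        have h1 := hv _ ht
        rw [gr_inl] at h1
        rw [← mul_zero (a r), ← h1, Finset.mul_sum]
        refine Finset.sum_congr rfl fun s _ => ?_
        have := hb s
        field_simp
      · rw [gr_inr]
        have h1 := hv _ ht
        rw [gr_inr] at h1; rw [h1, mul_zero])
    ext s
    have := congrFun this s
    simpa [hb s] using this
  · intro h v hv
    have := h (fun s => b s * v s) (by
      rintro (r | s) ht
      · rw [gr_inl]
        have h1 := hv _ ht
        rw [gr_inl] at h1
        have : a r * ∑ s, A r s * (b s * v s) = 0 := by
          rw [← h1, Finset.mul_sum]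
          refine Finset.sum_congr rfl fun s _ => ?_
          ring
        exact (mul_eq_zero.1 this).resolve_left (ha r)
      · rw [gr_inr]
        have h1 := hv _ ht
        rw [gr_inr] at h1; rw [h1, mul_zero])
    ext s
    have := congrFun this s
    simpa [hb s] using this

/-! ### columns -/

theorem bs_sub {S' : Type} [Fintype S'] {g : S' → S} (hg : Function.Injective g) (A : R → S → k)
    (T : Set (R ⊕ S)) (hT : ∀ s, s ∉ range g → Sum.inr s ∈ T) :
    Bs A T ↔ Bs (fun r s => A r (g s)) (Sum.map id g ⁻¹' T) := by
  have hsum : ∀ (r : R) (v : S → k), (∀ s, s ∉ range g → v s = 0) →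
      ∑ s, A r s * v s = ∑ s, A r (g s) * v (g s) := by
    intro r v hv
    rw [← Finset.sum_image (s := Finset.univ) (g := g) (f := fun s => A r s * v s) (fun a _ b _ h => hg h)]
    symm
    apply Finset.sum_subset (Finset.subset_univ _)
    intro s _ hs
    rw [hv s (by simpa using hs), mul_zero]
  constructor
  · intro h v hv
    have := h (Function.extend g v 0) (by
      rintro (r | s) ht
      · rw [gr_inl, hsum r (Function.extend g v 0) (fun s hs => Function.extend_apply' _ _ _ (by simpa using hs))]
        simp only [hg.extend_apply]
        exact hv (Sum.inl r) ht
      · rw [gr_inr]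
        by_cases hs : s ∈ range g
        · obtain ⟨s, rfl⟩ := hs
          rw [hg.extend_apply]
          exact hv (Sum.inr s) ht
        · exact Function.extend_apply' _ _ _ (by simpa using hs))
    ext s
    have := congrFun this (g s)
    rwa [hg.extend_apply] at this
  · intro h v hv
    have h0 : ∀ s, s ∉ range g → v s = 0 := fun s hs => hv _ (hT s hs)
    have := h (fun s => v (g s)) (by
      rintro (r | s) ht
      · rw [gr_inl, ← hsum r v h0]
        exact hv _ ht
      · exact hv _ ht)
    ext s
    by_cases hs : s ∈ range g
    · obtain ⟨s, rfl⟩ := hs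
      exact congrFun this s
    · exact h0 s hs

theorem repQ_range {S' : Type} [Fintype S'] {g : S' → S} (hg : Function.Injective g) :
    RepQ (range g) A B ↔ Rep (fun r s => A r (g s)) (fun r s => B r (g s)) := by
  constructor
  · intro h T
    have key : Sum.map id g ⁻¹' (Sum.map id g '' T ∪ Sum.inr '' (range g)ᶜ) = T := by
      ext t
      constructor
      · rintro (⟨t', ht', he⟩ | ⟨s, hs, he⟩)
        · have := (Sum.map_injective.2 ⟨Function.injective_id, hg⟩) he
          rwa [← this]
        · rcases t with r | t
          · cases he
          · cases he; exact (hs ⟨t, rfl⟩).elim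
      · intro ht; exact Or.inl ⟨t, ht, rfl⟩
    have h1 := h (Sum.map id g '' T ∪ Sum.inr '' (range g)ᶜ) (fun s hs => Or.inr ⟨s, hs, rfl⟩)
    rwa [bs_sub hg A _ (fun s hs => Or.inr ⟨s, hs, rfl⟩), bs_sub hg B _ (fun s hs => Or.inr ⟨s, hs, rfl⟩),
      key] at h1
  · intro h T hT
    rw [bs_sub hg A T hT, bs_sub hg B T hT]
    exact h _

end
end NR

namespace NR
open Classical

/-- `A0` is a pivot minor of the binary matrix -/
inductive PMin {R0 S0 : Type} (A0 : R0 → S0 → K) : ∀ {R S : Type}, (R → S → K) → Prop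
  | base : PMin A0 A0
  | sub {R S R' S' : Type} (f : R' → R) (g : S' → S) (hf : Function.Injective f)
      (hg : Function.Injective g) (A : R → S → K) (h : PMin A0 (fun r s => A (f r) (g s))) : PMin A0 A
  | pv {R S : Type} (A : R → S → K) (r : R) (s : S) (h0 : A r s ≠ 0) (h : PMin A0 (piv A r s)) : PMin A0 A

/-- the Fano matrix -/
def F7m : Fin 3 → Fin 4 → K := ![![1, 0, 1, 1], ![1, 1, 1, 0], ![0, 1, 1, 1]]

/-- rows joined in at most `n` steps by columns other than `x`, `y` -/
def Reach {R S : Type} (A : R → S → K) (x y : S) : ℕ → R → R → Prop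
  | 0 => fun p q => p = q
  | n + 1 => fun p q => ∃ s u, s ≠ x ∧ s ≠ y ∧ A p s ≠ 0 ∧ A u s ≠ 0 ∧ Reach A x y n u q

section
variable {F : Type} [Field F] {R S : Type} [Fintype S] {A : R → S → K} {B : R → S → F} {x y : S}

theorem reach_one {p q : R} {s : S} (hx : s ≠ x) (hy : s ≠ y) (hp : A p s ≠ 0) (hq : A q s ≠ 0) :
    Reach A x y 1 p q := ⟨s, q, hx, hy, hp, hq, rfl⟩

/-- survival of chains under a pivot -/
theorem reach_piv {p1 : R} {s2 : S} (h0 : A p1 s2 ≠ 0) {q : R} : ∀ (j : ℕ) (u : R), Reach A x y j u q →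
    Reach (piv A p1 s2) x y j u q ∨
      ∃ i u' s, i + 1 ≤ j ∧ s ≠ x ∧ s ≠ y ∧ A p1 s ≠ 0 ∧ A u' s ≠ 0 ∧ Reach A x y i u' q := by
  intro j
  induction j with
  | zero => intro u h; exact Or.inl h
  | succ j ih =>
    rintro u ⟨s, u', hx, hy, hu, hu', h⟩
    by_cases hs : A p1 s = 0
    · rcases ih u' h with h1 | ⟨i, w, s', hi, h1⟩
      · left
        refine ⟨s, u', hx, hy, ?_, ?_, h1⟩
        · rwa [piv_of_row hs h0]
        · rwa [piv_of_row hs h0]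
      · exact Or.inr ⟨i, w, s', by omega, h1⟩
    · exact Or.inr ⟨j, u', s, le_rfl, hx, hy, hs, hu', h⟩

theorem F7_of {p p1 q : R} {s1 s2 x y : S} (a1 : A p s1 ≠ 0) (a2 : A p1 s1 ≠ 0) (a3 : A q s1 = 0)
    (b1 : A p s2 = 0) (b2 : A p1 s2 ≠ 0) (b3 : A q s2 ≠ 0)
    (c1 : A p x ≠ 0) (c2 : A p1 x ≠ 0) (c3 : A q x ≠ 0)
    (d1 : A p y ≠ 0) (d2 : A p1 y = 0) (d3 : A q y ≠ 0) : PMin F7m A := by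
  refine PMin.sub ![p, p1, q] ![s1, s2, x, y] ?_ ?_ A ?_
  · intro i j h
    fin_cases i <;> fin_cases j <;> simp at h ⊢ <;> subst h <;> contradiction
  · intro i j h
    fin_cases i <;> fin_cases j <;> simp at h ⊢ <;> subst h <;> contradiction
  · have e : (fun (r : Fin 3) (s : Fin 4) => A ((![p, p1, q] : Fin 3 → R) r) ((![s1, s2, x, y] : Fin 4 → S) s)) = F7m := by
      ext r s
      congr 1
      fin_cases r <;> fin_cases s <;> simp [F7m] <;>
        first | assumption | (apply kne; assumption) | skip
    rw [e]; exact PMin.base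

theorem RepQ.zero {Q : Set S} (h : RepQ Q A B) {r : R} {s : S} (hs : s ∈ Q) : A r s = 0 ↔ B r s = 0 :=
  not_iff_not.1 (h.entry r hs)

theorem eq_cols_piv (h : ∀ r, A r x = A r y) {p1 : R} {s2 : S} (hx : s2 ≠ x) (hy : s2 ≠ y) (r : R) :
    piv A p1 s2 r x = piv A p1 s2 r y := by
  by_cases hr : r = p1
  · subst hr; rw [piv_row hx.symm, piv_row hy.symm, h]
  · rw [piv_apply_ne hr hx.symm, piv_apply_ne hr hy.symm, h, h]

theorem det_one {Q : Set S} (h : RepQ Q A B) {p q : R} {s t : S} (hst : s ≠ t) (hs : s ∈ Q) (ht : t ∈ Q)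
    (h1 : A p s ≠ 0) (h2 : A p t ≠ 0) (h3 : A q s ≠ 0) (h4 : A q t ≠ 0) :
    B p s * B q t = B p t * B q s := by
  by_contra hne
  have := (h.det p q hst hs ht).2 (sub_ne_zero.2 hne)
  rw [kne h1, kne h2, kne h3, kne h4] at this
  simp at this

theorem lemG (hxy : x ≠ y) : ∀ (k : ℕ) (A : R → S → K) (B : R → S → F), RepQ {x}ᶜ A B → RepQ {y}ᶜ A B →
    (¬ PMin F7m A ∨ ∀ r, A r x = A r y) → ∀ p q : R, A p x ≠ 0 → A p y ≠ 0 → A q x ≠ 0 → A q y ≠ 0 →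
    Reach A x y k p q → B p x * B q y = B p y * B q x := by
  intro k
  induction k using Nat.strong_induction_on with
  | _ k ih =>
  intro A B hX hY hF p q hpx hpy hqx hqy hR
  have mX : ∀ {s : S}, s ≠ x → s ∈ ({x}ᶜ : Set S) := fun h => h
  have mY : ∀ {s : S}, s ≠ y → s ∈ ({y}ᶜ : Set S) := fun h => h
  have short : ∀ j, j < k → Reach A x y j p q → B p x * B q y = B p y * B q x :=
    fun j hj h => ih j hj A B hX hY hF p q hpx hpy hqx hqy h
  have trans : ∀ (p1 : R) (s2 : S), s2 ≠ x → s2 ≠ y → A p1 s2 ≠ 0 → ∀ j, j < k →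
      Reach (piv A p1 s2) x y j p q →
      (A p s2 = 0 ∨ (A p1 x = 0 ∧ A p1 y = 0)) → (A q s2 = 0 ∨ (A p1 x = 0 ∧ A p1 y = 0)) →
      B p x * B q y = B p y * B q x := by
    intro p1 s2 hx hy h0 j hj hr h1 h2
    have h0B : B p1 s2 ≠ 0 := (hX.entry p1 (mX hx)).1 h0
    have e : ∀ p, (A p s2 = 0 ∨ (A p1 x = 0 ∧ A p1 y = 0)) →
        piv A p1 s2 p x = A p x ∧ piv A p1 s2 p y = A p y ∧
        piv B p1 s2 p x = B p x ∧ piv B p1 s2 p y = B p y := by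
      rintro p (h | ⟨h, h'⟩)
      · have hB := (hX.zero (mX hx)).1 h
        exact ⟨piv_of_col h h0 _, piv_of_col h h0 _, piv_of_col hB h0B _, piv_of_col hB h0B _⟩
      · have hB := (hY.zero (mY hxy)).1 h
        have hB' := (hX.zero (mX hxy.symm)).1 h'
        exact ⟨piv_of_row h h0 _, piv_of_row h' h0 _, piv_of_row hB h0B _, piv_of_row hB' h0B _⟩
    obtain ⟨a1, a2, a3, a4⟩ := e p h1
    obtain ⟨b1, b2, b3, b4⟩ := e q h2
    have := ih j hj (piv A p1 s2) (piv B p1 s2) (hX.piv (mX hx) h0) (hY.piv (mY hy) h0) (by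
      rcases hF with hF | hF
      · exact Or.inl fun h => hF (PMin.pv A p1 s2 h0 h)
      · exact Or.inr (eq_cols_piv hF hx hy)) p q (by rwa [a1]) (by rwa [a2]) (by rwa [b1]) (by rwa [b2]) hr
    rwa [a3, a4, b3, b4] at this
  match k, hR with
  | 0, h => 
    have h : p = q := h
    subst h; ring
  | 1, ⟨s, u, hx, hy, hp, hu, h⟩ =>
    have h : u = q := h
    subst h
    have d1 := det_one hY hx (mY hy) (mY hxy) hp hpx hu hqx
    have d2 := det_one hX hy (mX hx) (mX hxy.symm) hp hpy hu hqy
    have n1 : B p s ≠ 0 := (hX.entry p (mX hx)).1 hp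
    have n2 : B u s ≠ 0 := (hX.entry u (mX hx)).1 hu
    have : B p s * B u s * (B p x * B u y - B p y * B u x) = 0 := by
      linear_combination B u s * B p x * d2 - B u s * B p y * d1
    exact sub_eq_zero.1 ((mul_eq_zero.1 this).resolve_left (mul_ne_zero n1 n2))
  | 2, ⟨s1, p1, hx1, hy1, hp, hu, s2, u, hx2, hy2, hp1, hu2, h⟩ =>
    have h : u = q := h
    subst h
    by_cases c1 : A u s1 ≠ 0
    · exact short 1 (by omega) (reach_one hx1 hy1 hp c1)
    by_cases c2 : A p s2 ≠ 0
    · exact short 1 (by omega) (reach_one hx2 hy2 c2 hu2)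
    rw [not_not] at c1 c2
    by_cases t1 : A p1 x = 0 <;> by_cases t2 : A p1 y = 0
    · have hne : s1 ≠ s2 := by rintro rfl; exact hu2 c1
      have hup : u ≠ p1 := by rintro rfl; exact hu c1
      refine trans p1 s2 hx2 hy2 hp1 1 (by omega) (reach_one hx1 hy1 ?_ ?_) (Or.inl c2) (Or.inr ⟨t1, t2⟩)
      · rwa [piv_of_col c2 hp1]
      · rw [piv_apply_ne hup hne, c1, kne hu2, kne hp1, kne hu]
        simp
    · rcases hF with hF | hF
      · exact (hF (F7_of hp hu c1 c2 hp1 hu2 hpy t2 hqy hpx t1 hqx)).elim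
      · rw [hF] at t1; exact (t2 t1).elim
    · rcases hF with hF | hF
      · exact (hF (F7_of hp hu c1 c2 hp1 hu2 hpx t1 hqx hpy t2 hqy)).elim
      · rw [hF] at t1; exact (t1 t2).elim
    · have d1 := ih 1 (by omega) A B hX hY hF p p1 hpx hpy t1 t2 (reach_one hx1 hy1 hp hu)
      have d2 := ih 1 (by omega) A B hX hY hF p1 u t1 t2 hqx hqy (reach_one hx2 hy2 hp1 hu2)
      have n1 : B p1 x ≠ 0 := (hY.entry p1 (mY hxy)).1 t1
      have n2 : B p1 y ≠ 0 := (hX.entry p1 (mX hxy.symm)).1 t2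
      have : B p1 x * B p1 y * (B p x * B u y - B p y * B u x) = 0 := by
        linear_combination B p1 x * B u y * d1 + B p1 x * B p y * d2
      exact sub_eq_zero.1 ((mul_eq_zero.1 this).resolve_left (mul_ne_zero n1 n2))
  | k + 3, ⟨s1, p1, hx1, hy1, hp, hu, s2, p2, hx2, hy2, hp1, hp2, h⟩ =>
    by_cases c1 : A p2 s1 ≠ 0
    · exact short (k + 2) (by omega) ⟨s1, p2, hx1, hy1, hp, c1, h⟩
    by_cases c2 : A p s2 ≠ 0
    · exact short (k + 2) (by omega) ⟨s2, p2, hx2, hy2, c2, hp2, h⟩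
    by_cases c3 : A q s2 ≠ 0
    · exact short 2 (by omega) ⟨s1, p1, hx1, hy1, hp, hu, reach_one hx2 hy2 hp1 c3⟩
    rw [not_not] at c1 c2 c3
    have hne : s1 ≠ s2 := by rintro rfl; exact hp2 c1
    have hup : p2 ≠ p1 := by rintro rfl; exact hu c1
    rcases reach_piv hp1 (k + 1) p2 h with h1 | ⟨i, u', s, hi, hsx, hsy, h2, h3, h4⟩
    · refine trans p1 s2 hx2 hy2 hp1 (k + 2) (by omega) ⟨s1, p2, hx1, hy1, ?_, ?_, h1⟩ (Or.inl c2) (Or.inl c3)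
      · rwa [piv_of_col c2 hp1]
      · rw [piv_apply_ne hup hne, c1, kne hp2, kne hp1, kne hu]
        simp
    · exact short (i + 2) (by omega) ⟨s1, p1, hx1, hy1, hp, hu, s, u', hsx, hsy, h2, h3, h4⟩
end
end NR

namespace NR
open Classical

/-- the rows are connected by the columns other than `x`, `y` -/
def CXY {R S : Type} (A : R → S → K) (x y : S) : Prop :=
  ∀ (P : Set R) (Q : Set S), (∀ r s, s ≠ x → s ≠ y → A r s ≠ 0 → (r ∈ P ↔ s ∈ Q)) → P = ∅ ∨ P = univ

section
variable {F : Type} [Field F] {R S : Type} [Fintype S] {A : R → S → K} {B : R → S → F} {x y : S}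

theorem sep_piv {P : Set R} {Q : Set S} {X : Set S} {r0 : R} {s0 : S} (hs0 : s0 ∉ X) (h0 : A r0 s0 ≠ 0)
    (h : ∀ r s, s ∉ X → A r s ≠ 0 → (r ∈ P ↔ s ∈ Q)) :
    ∀ r s, s ∉ X → piv A r0 s0 r s ≠ 0 → (r ∈ P ↔ s ∈ Q) := by
  intro r s hs hne
  by_cases hr : r = r0
  · subst hr
    by_cases hss : s = s0
    · subst hss; exact h _ _ hs h0
    · rw [piv_row hss] at hne
      exact h _ _ hs (right_ne_zero_of_mul hne)
  · by_cases hss : s = s0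
    · subst hss
      rw [piv_col hr] at hne
      exact h _ _ hs (left_ne_zero_of_mul hne)
    · rw [piv_apply_ne hr hss] at hne
      by_cases h1 : A r s = 0
      · rw [h1, zero_sub, neg_ne_zero] at hne
        have a1 := h _ _ hs (right_ne_zero_of_mul hne)
        have a2 := h _ _ hs0 (left_ne_zero_of_mul (left_ne_zero_of_mul hne))
        have a3 := h _ _ hs0 h0
        tauto
      · exact h _ _ hs h1

theorem CXY.piv (h : CXY A x y) {r0 : R} {s0 : S} (hx : s0 ≠ x) (hy : s0 ≠ y) (h0 : A r0 s0 ≠ 0) :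
    CXY (piv A r0 s0) x y := by
  intro P Q hPQ
  apply h P Q
  have := sep_piv (A := NR.piv A r0 s0) (X := {x, y}) (P := P) (Q := Q) (r0 := r0) (s0 := s0)
    (by simp [hx, hy]) (by rw [piv_self]; exact inv_ne_zero h0)
    (fun r s hs => hPQ r s (by rintro rfl; simp at hs) (by rintro rfl; simp at hs))
  rw [piv_piv h0] at this
  intro r s h1 h2
  exact this r s (by simp [h1, h2])

theorem CXY.reach (h : CXY A x y) (p q : R) : ∃ k, Reach A x y k p q := by
  have := h {p | ∃ k, Reach A x y k p q} {s | ∃ r, A r s ≠ 0 ∧ ∃ k, Reach A x y k r q} (by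
    intro r s hx hy h1
    constructor
    · intro h2; exact ⟨r, h1, h2⟩
    · rintro ⟨r', h2, k, hk⟩
      exact ⟨k + 1, s, r', hx, hy, h1, h2, hk⟩)
  have hq : q ∈ {p | ∃ k, Reach A x y k p q} := ⟨0, rfl⟩
  rcases this with h | h
  · rw [h] at hq; exact hq.elim
  · have : p ∈ (univ : Set R) := trivial
    rwa [← h] at this

theorem bs_two {k : Type} [Field k] {C : R → S → k} (hxy : x ≠ y) {T : Set (R ⊕ S)}
    (hx : Sum.inr x ∉ T) (hy : Sum.inr y ∉ T) (hT : ∀ s, s ≠ x → s ≠ y → Sum.inr s ∈ T) :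
    Bs C T ↔ ∀ a b : k, (∀ r, Sum.inl r ∈ T → C r x * a + C r y * b = 0) → a = 0 ∧ b = 0 := by
  have hsum : ∀ (q : R) (a b : k), ∑ t, C q t * (Pi.single x a + Pi.single y b : S → k) t
      = C q x * a + C q y * b := by
    intro q a b
    simp only [Pi.add_apply, mul_add, Finset.sum_add_distrib, sum_single']
  constructor
  · intro h a b hab
    have := h (Pi.single x a + Pi.single y b) (by
      rintro (r | s) ht
      · rw [gr_inl, hsum, hab r ht]
      · rw [gr_inr]
        have h1 : s ≠ x := by rintro rfl; exact hx ht
        have h2 : s ≠ y := by rintro rfl; exact hy ht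
        simp [h1, h2])
    have h3 := congrFun this x
    have h4 := congrFun this y
    simp [hxy, hxy.symm] at h3 h4
    exact ⟨h3, h4⟩
  · intro h v hv
    have h2 : v = Pi.single x (v x) + Pi.single y (v y) := by
      ext t
      by_cases ht : t = x
      · subst ht; simp [hxy]
      · by_cases ht' : t = y
        · subst ht'; simp [hxy.symm]
        · have := hv _ (hT t ht ht')
          rw [gr_inr] at this
          rw [this]; simp [ht, ht']
    have := h (v x) (v y) (by
      intro r hr
      have := hv _ hr
      rw [gr_inl, h2, hsum] at this
      simpa [hxy, hxy.symm] using this)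
    rw [h2, this.1, this.2]; simp

/-- the main gluing theorem -/
theorem glue [Finite R] (hxy : x ≠ y) : ∀ (n : ℕ) (A : R → S → K) (B : R → S → F), RepQ {x}ᶜ A B → RepQ {y}ᶜ A B →
    CXY A x y → ¬ PMin F7m A → ∀ T : Set (R ⊕ S), (Sum.inl ⁻¹' T : Set R).ncard = n → (Bs A T ↔ Bs B T) := by
  intro n
  induction n using Nat.strong_induction_on with
  | _ n ih =>
  intro A B hX hY hC hF T hT
  have mX : ∀ {s : S}, s ≠ x → s ∈ ({x}ᶜ : Set S) := fun h => h
  have mY : ∀ {s : S}, s ≠ y → s ∈ ({y}ᶜ : Set S) := fun h => h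
  by_cases hx : Sum.inr x ∈ T
  · exact hX T fun s hs => by
      have : s = x := by by_contra h; exact hs h
      rwa [this]
  by_cases hy : Sum.inr y ∈ T
  · exact hY T fun s hs => by
      have : s = y := by by_contra h; exact hs h
      rwa [this]
  by_cases hp : ∃ r0 s0, Sum.inl r0 ∈ T ∧ Sum.inr s0 ∉ T ∧ s0 ≠ x ∧ s0 ≠ y ∧ A r0 s0 ≠ 0
  · obtain ⟨r0, s0, hr0, hs0, h1, h2, h0⟩ := hp
    have h0B := (hX.entry r0 (mX h1)).1 h0
    have h3 := bs_piv h0 (xsw r0 s0 '' T)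
    have h4 := bs_piv h0B (xsw r0 s0 '' T)
    rw [xsw_sw] at h3 h4
    rw [← h3, ← h4]
    refine ih _ ?_ _ _ (hX.piv (mX h1) h0) (hY.piv (mY h2) h0) (hC.piv h1 h2 h0)
      (fun h => hF (PMin.pv A r0 s0 h0 h)) _ rfl
    rw [← hT]
    apply Set.ncard_lt_ncard _ (Set.toFinite _)
    rw [Set.ssubset_iff_of_subset]
    · refine ⟨r0, hr0, ?_⟩
      rintro ⟨t, ht, he⟩
      have : t = Sum.inr s0 := by
        apply (xsw r0 s0).injective
        rw [he, xsw, Equiv.swap_apply_right]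
      rw [this] at ht
      exact hs0 ht
    · rintro r ⟨t, ht, he⟩
      by_cases hr : r = r0
      · subst hr; exact hr0
      · have : t = Sum.inl r := by
          apply (xsw r0 s0).injective
          rw [he, xsw, Equiv.swap_apply_of_ne_of_ne (by simpa using hr) (by simp)]
        rw [this] at ht
        exact ht
  push Not at hp
  by_cases hs : ∃ s, s ≠ x ∧ s ≠ y ∧ Sum.inr s ∉ T
  · obtain ⟨s, h1, h2, h3⟩ := hs
    have key : ∀ {k : Type} [Field k] (C : R → S → k), (∀ r, Sum.inl r ∈ T → C r s = 0) → ¬ Bs C T := by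
      intro k _ C hC hB
      have := hB (Pi.single s 1) (by
        rintro (r | t) ht
        · rw [gr_inl, sum_single', hC r ht, zero_mul]
        · rw [gr_inr]
          exact Pi.single_eq_of_ne (by rintro rfl; exact h3 ht) _)
      have := congrFun this s
      simp at this
    have hA : ∀ r, Sum.inl r ∈ T → A r s = 0 := fun r hr => hp r s hr h3 h1 h2
    exact iff_of_false (key A hA) (key B fun r hr => (hX.zero (mX h1)).1 (hA r hr))
  push Not at hs
  rw [bs_two hxy hx hy hs, bs_two hxy hx hy hs]
  have zx : ∀ r, A r x = 0 ↔ B r x = 0 := fun r => hY.zero (mY hxy)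
  have zy : ∀ r, A r y = 0 ↔ B r y = 0 := fun r => hX.zero (mX hxy.symm)
  by_cases c1 : ∀ r, Sum.inl r ∈ T → A r x = 0
  · refine iff_of_false (fun h => ?_) (fun h => ?_)
    · exact one_ne_zero (h 1 0 (fun r hr => by rw [c1 r hr]; ring)).1
    · exact one_ne_zero (h 1 0 (fun r hr => by rw [(zx r).1 (c1 r hr)]; ring)).1
  by_cases c2 : ∀ r, Sum.inl r ∈ T → A r y = 0
  · refine iff_of_false (fun h => ?_) (fun h => ?_)
    · exact one_ne_zero (h 0 1 (fun r hr => by rw [c2 r hr]; ring)).2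
    · exact one_ne_zero (h 0 1 (fun r hr => by rw [(zy r).1 (c2 r hr)]; ring)).2
  push Not at c1 c2
  obtain ⟨r1, hr1, h1⟩ := c1
  obtain ⟨r2, hr2, h2⟩ := c2
  have aux : ∀ {k : Type} [Field k] (c d a b : k), c ≠ 0 → d = 0 → c * a + d * b = 0 → a = 0 := by
    intro k _ c d a b hc hd h
    rw [hd, zero_mul, add_zero] at h
    exact (mul_eq_zero.1 h).resolve_left hc
  by_cases c3 : ∃ r, Sum.inl r ∈ T ∧ A r x ≠ 0 ∧ A r y = 0
  · obtain ⟨r, hr, a1, a2⟩ := c3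
    refine iff_of_true (fun a b h => ?_) (fun a b h => ?_)
    · have ha := aux _ _ a b a1 a2 (h r hr)
      have := h r2 hr2
      rw [ha, add_comm] at this
      exact ⟨ha, by simpa [h2] using this⟩
    · have ha := aux _ _ a b (mt (zx r).2 a1) ((zy r).1 a2) (h r hr)
      have := h r2 hr2
      rw [ha, add_comm] at this
      exact ⟨ha, by simpa [mt (zy r2).2 h2] using this⟩
  by_cases c4 : ∃ r, Sum.inl r ∈ T ∧ A r y ≠ 0 ∧ A r x = 0
  · obtain ⟨r, hr, a1, a2⟩ := c4
    refine iff_of_true (fun a b h => ?_) (fun a b h => ?_)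
    · have hb := aux _ _ b a a1 a2 (by rw [add_comm]; exact h r hr)
      have := h r1 hr1
      rw [hb] at this
      exact ⟨by simpa [h1] using this, hb⟩
    · have hb := aux _ _ b a (mt (zy r).2 a1) ((zx r).1 a2) (by rw [add_comm]; exact h r hr)
      have := h r1 hr1
      rw [hb] at this
      exact ⟨by simpa [mt (zx r1).2 h1] using this, hb⟩
  push Not at c3 c4
  have h1y := c3 r1 hr1 h1
  refine iff_of_false (fun h => ?_) (fun h => ?_)
  · refine one_ne_zero (h 1 1 (fun r hr => ?_)).1
    by_cases c : A r x = 0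
    · have : A r y = 0 := by
        by_contra c'; exact c4 r hr c' c
      rw [c, this]; ring
    · rw [kne c, kne (c3 r hr c)]; decide
  · refine mt (zy r1).2 h1y (h (B r1 y) (- B r1 x) (fun r hr => ?_)).1
    by_cases c : A r x = 0
    · have : A r y = 0 := by
        by_contra c'; exact c4 r hr c' c
      rw [(zx r).1 c, (zy r).1 this]; ring
    · obtain ⟨k, hk⟩ := hC.reach r r1
      have := lemG hxy k A B hX hY (Or.inl hF) r r1 c (c3 r hr c) h1 h1y hk
      linear_combination this

/-! ### uniqueness -/

theorem Rep.scale (h : Rep A B) {a : R → F} {b : S → F} (ha : ∀ r, a r ≠ 0) (hb : ∀ s, b s ≠ 0) :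
    Rep A (fun r s => a r * B r s * b s) := fun T => by rw [bs_scale ha hb]; exact h T

theorem uniq_step {S : Type} [Fintype S] (A : R → Option S → K) (B1 B2 : R → Option S → F) (h1 : Rep A B1) (h2 : Rep A B2)
    (heq : ∀ r s, B1 r (some s) = B2 r (some s)) :
    ∃ (a : R → F) (b : Option S → F), (∀ r, a r ≠ 0) ∧ (∀ s, b s ≠ 0) ∧ ∀ r s, B2 r s = a r * B1 r s * b s := by
  let A' : R → Option (Option S) → K := fun r o => A r (o.elim none id)
  let B' : R → Option (Option S) → F := fun r o => o.elim (B1 r none) (fun s => B2 r s)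
  have hX : RepQ {none}ᶜ A' B' := by
    have e : ({none}ᶜ : Set (Option (Option S))) = range some := by
      ext o; cases o <;> simp
    rw [e, repQ_range (Option.some_injective _)]
    exact h2
  have hY : RepQ {some none}ᶜ A' B' := by
    have e : ({some none}ᶜ : Set (Option (Option S))) = range (Option.map some) := by
      ext o; rcases o with _ | _ | o <;> simp
    rw [e, repQ_range (Option.map_injective (Option.some_injective _))]
    have e1 : (fun r s => A' r (Option.map some s)) = A := by
      ext r s; rcases s with _ | s <;> rfl
    have e2 : (fun r s => B' r (Option.map some s)) = B1 := by
      ext r s; rcases s with _ | s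
      · rfl
      · exact (heq r s).symm
    rw [e1, e2]; exact h1
  have key : ∀ k p q, A p none ≠ 0 → A q none ≠ 0 → Reach A' none (some none) k p q →
      B1 p none * B2 q none = B2 p none * B1 q none := by
    intro k p q hp hq hk
    exact lemG (by simp) k A' B' hX hY (Or.inr fun r => rfl) p q hp hp hq hq hk
  have z1 : ∀ r s, A r s ≠ 0 ↔ B1 r s ≠ 0 := fun r s => (h1.repQ univ).entry r trivial
  have z2 : ∀ r s, A r s ≠ 0 ↔ B2 r s ≠ 0 := fun r s => (h2.repQ univ).entry r trivial
  have htr : ∀ k p q u, Reach A' none (some none) k p q → ∀ l, Reach A' none (some none) l q u →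
      ∃ m, Reach A' none (some none) m p u := by
    intro k
    induction k with
    | zero => intro p q u h l hl; cases h; exact ⟨l, hl⟩
    | succ k ih =>
      rintro p q u ⟨s, w, a, b, c, d, h⟩ l hl
      obtain ⟨m, hm⟩ := ih w q u h l hl
      exact ⟨m + 1, s, w, a, b, c, d, hm⟩
  have hsymm : ∀ k p q, Reach A' none (some none) k p q → ∃ k, Reach A' none (some none) k q p := by
    intro k
    induction k with
    | zero => intro p q h; cases h; exact ⟨0, rfl⟩
    | succ k ih =>
      rintro p q ⟨s, w, a, b, c, d, h⟩
      obtain ⟨m, hm⟩ := ih w q h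
      exact htr m q w p hm 1 ⟨s, p, a, b, d, c, rfl⟩
  let st : Setoid R := ⟨fun p q => ∃ k, Reach A' none (some none) k p q, ⟨fun p => ⟨0, rfl⟩,
    fun ⟨k, h⟩ => hsymm k _ _ h, fun ⟨k, h⟩ ⟨l, h'⟩ => htr k _ _ _ h l h'⟩⟩
  have ex : ∀ c : Quotient st, ∃ a : F, a ≠ 0 ∧ ∀ q, Quotient.mk st q = c → A q none ≠ 0 →
      B2 q none = a * B1 q none := by
    intro c
    by_cases h : ∃ q, Quotient.mk st q = c ∧ A q none ≠ 0
    · obtain ⟨q, hq, hne⟩ := h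
      have n1 := (z1 _ _).1 hne
      have n2 := (z2 _ _).1 hne
      refine ⟨B2 q none / B1 q none, div_ne_zero n2 n1, ?_⟩
      intro q' hq' hne'
      obtain ⟨k, hk⟩ := Quotient.exact (hq'.trans hq.symm)
      have := key k q' q hne' hne hk
      field_simp
      linear_combination -this
    · refine ⟨1, one_ne_zero, fun q hq hne => (h ⟨q, hq, hne⟩).elim⟩
  choose a' ha' ha using ex
  have exb : ∀ s : S, ∃ b : F, b ≠ 0 ∧ ∀ r, A r (some s) ≠ 0 → a' (Quotient.mk st r) * b = 1 := by
    intro s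
    by_cases h : ∃ r, A r (some s) ≠ 0
    · obtain ⟨r, hr⟩ := h
      refine ⟨(a' (Quotient.mk st r))⁻¹, inv_ne_zero (ha' _), fun r' hr' => ?_⟩
      have : Quotient.mk st r' = Quotient.mk st r := Quotient.sound
        ⟨1, some (some s), r, by simp, by simp, hr', hr, rfl⟩
      rw [this]
      exact mul_inv_cancel₀ (ha' _)
    · exact ⟨1, one_ne_zero, fun r hr => (h ⟨r, hr⟩).elim⟩
  choose b hb' hb using exb
  refine ⟨fun r => a' (Quotient.mk st r), fun o => o.elim 1 b, fun r => ha' _, ?_, ?_⟩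
  · rintro (_ | s)
    · exact one_ne_zero
    · exact hb' s
  · rintro r (_ | s)
    · simp only [Option.elim, mul_one]
      by_cases h : A r none = 0
      · have e1 : B1 r none = 0 := by by_contra h'; exact (z1 _ _).2 h' h
        have e2 : B2 r none = 0 := by by_contra h'; exact (z2 _ _).2 h' h
        rw [e1, e2, mul_zero]
      · exact ha _ r rfl h
    · simp only [Option.elim]
      by_cases h : A r (some s) = 0
      · have e1 : B1 r (some s) = 0 := by by_contra h'; exact (z1 _ _).2 h' h
        rw [← heq, e1]; ring
      · rw [← heq]
        linear_combination (-B1 r (some s)) * hb s r h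

/-- a binary matroid has at most one representation up to scaling -/
def UQ (F : Type) [Field F] (R S : Type) : Prop := ∀ [Fintype S] (A : R → S → K) (B1 B2 : R → S → F), Rep A B1 → Rep A B2 →
    ∃ (a : R → F) (b : S → F), (∀ r, a r ≠ 0) ∧ (∀ s, b s ≠ 0) ∧ ∀ r s, B2 r s = a r * B1 r s * b s

theorem uniq (S : Type) [Finite S] : UQ F R S := by
  induction S using Finite.induction_empty_option with
  | @of_equiv S S' e ih =>
    intro _ A B1 B2 h1 h2
    have : Fintype S := Fintype.ofEquiv S' e.symm
    have hr : range e = univ := e.surjective.range_eq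
    have g1 : Rep (fun r s => A r (e s)) (fun r s => B1 r (e s)) :=
      (repQ_range e.injective).1 (h1.repQ _)
    have g2 : Rep (fun r s => A r (e s)) (fun r s => B2 r (e s)) :=
      (repQ_range e.injective).1 (h2.repQ _)
    obtain ⟨a, b, ha, hb, hab⟩ := ih _ _ _ g1 g2
    refine ⟨a, fun s => b (e.symm s), ha, fun s => hb _, fun r s => ?_⟩
    have := hab r (e.symm s)
    simpa using this
  | h_empty =>
    intro _ A B1 B2 h1 h2
    exact ⟨fun _ => 1, fun _ => 1, fun _ => one_ne_zero, fun _ => one_ne_zero, fun r s => s.elim⟩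
  | @h_option S _ ih =>
    intro inst A B1 B2 h1 h2
    have hi : inst = instFintypeOption := Subsingleton.elim _ _
    subst hi
    have g1 : Rep (fun r s => A r (some s)) (fun r s => B1 r (some s)) :=
      (repQ_range (Option.some_injective _)).1 (h1.repQ _)
    have g2 : Rep (fun r s => A r (some s)) (fun r s => B2 r (some s)) :=
      (repQ_range (Option.some_injective _)).1 (h2.repQ _)
    obtain ⟨a, b, ha, hb, hab⟩ := ih _ _ _ g1 g2
    have hb1 : ∀ o : Option S, (o.elim 1 b : F) ≠ 0 := by
      rintro (_ | s)
      · exact one_ne_zero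
      · exact hb s
    obtain ⟨a', b', ha', hb', hab'⟩ := uniq_step A _ B2 (h1.scale ha hb1) h2 (fun r s => (hab r s).symm)
    refine ⟨fun r => a' r * a r, fun s => b' s * s.elim 1 b, fun r => mul_ne_zero (ha' r) (ha r),
      fun s => mul_ne_zero (hb' s) (hb1 s), fun r s => ?_⟩
    rw [hab' r s]; ring

/-- two partial representations fit together -/
theorem fit (hxy : x ≠ y) {B1 B2 : R → S → F} (h1 : RepQ {x}ᶜ A B1) (h2 : RepQ {y}ᶜ A B2) :
    ∃ B : R → S → F, RepQ {x}ᶜ A B ∧ RepQ {y}ᶜ A B := by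
  let g : {s : S // s ≠ x ∧ s ≠ y} → S := Subtype.val
  have hg : Function.Injective g := Subtype.val_injective
  have hmono : ∀ {Q Q' : Set S} {B : R → S → F}, Q ⊆ Q' → RepQ Q' A B → RepQ Q A B :=
    fun hQ h T hT => h T fun s hs => hT s fun h' => hs (hQ h')
  have r1 : range g ⊆ {x}ᶜ := by rintro _ ⟨s, rfl⟩; exact s.2.1
  have r2 : range g ⊆ {y}ᶜ := by rintro _ ⟨s, rfl⟩; exact s.2.2
  obtain ⟨a, b, ha, hb, hab⟩ := uniq (R := R) (F := F) {s : S // s ≠ x ∧ s ≠ y} _ _ _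
    ((repQ_range hg).1 (hmono r1 h1)) ((repQ_range hg).1 (hmono r2 h2))
  let b' : S → F := fun s => if h : s ≠ x ∧ s ≠ y then b ⟨s, h⟩ else 1
  have hb' : ∀ s, b' s ≠ 0 := by
    intro s
    by_cases h : s ≠ x ∧ s ≠ y
    · simp only [b', dif_pos h]; exact hb _
    · simp only [b', dif_neg h]; exact one_ne_zero
  have hcol : ∀ {Q : Set S} {B B' : R → S → F}, (∀ r, ∀ s ∈ Q, B r s = B' r s) → RepQ Q A B → RepQ Q A B' := by
    intro Q B B' hBB h T hT
    rw [h T hT]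
    have : ∀ B B' : R → S → F, (∀ r, ∀ s ∈ Q, B r s = B' r s) → Bs B T → Bs B' T := by
      intro B B' hBB hB v hv
      apply hB v
      rintro (r | s) ht
      · rw [← hv _ ht, gr_inl, gr_inl]
        refine Finset.sum_congr rfl fun s _ => ?_
        by_cases hs : s ∈ Q
        · rw [hBB r s hs]
        · have := hv _ (hT s hs)
          rw [gr_inr] at this
          rw [this, mul_zero, mul_zero]
      · exact hv _ ht
    exact ⟨this _ _ hBB, this _ _ fun r s hs => (hBB r s hs).symm⟩
  refine ⟨fun r s => if s = x then B2 r s else a r * B1 r s * b' s, ?_, ?_⟩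
  · refine hcol (B := fun r s => a r * B1 r s * b' s) (fun r s hs => ?_) (fun T hT => ?_)
    · rw [if_neg (show s ≠ x from hs)]
    · rw [bs_scale ha hb']; exact h1 T hT
  · refine hcol (B := B2) (fun r s hs => ?_) h2
    by_cases h : s = x
    · rw [if_pos h]
    · rw [if_neg h]
      have := hab r ⟨s, h, hs⟩
      simp only [b', dif_pos (show s ≠ x ∧ s ≠ y from ⟨h, hs⟩)]
      exact this
end
end NR

namespace NR
open Classical

/-- the columns of `[I | A]` -/
noncomputable def cf {k : Type} [Field k] {R S : Type} (A : R → S → k) : R ⊕ S → (R → k) :=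
  Sum.elim (fun r => Pi.single r 1) (fun s r => A r s)

section
variable {k F : Type} [Field k] [Field F] {R S : Type} [Fintype R] [Fintype S] {A : R → S → k} {B : R → S → F} {x y : S}

theorem cf_sum (c : R ⊕ S → k) : ∑ t, c t • cf A t = fun r => c (Sum.inl r) + ∑ s, A r s * c (Sum.inr s) := by
  rw [Fintype.sum_sum_type]
  ext r
  simp only [cf, Pi.add_apply, Finset.sum_apply, Sum.elim_inl, Sum.elim_inr, Pi.smul_apply, smul_eq_mul]
  congr 1
  · rw [Finset.sum_eq_single r]
    · simp
    · intro b _ hb; simp [hb]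
    · simp
  · exact Finset.sum_congr rfl fun s _ => mul_comm _ _

theorem li_bs (J : Set (R ⊕ S)) : LinearIndepOn k (cf A) J ↔ Bs A Jᶜ := by
  rw [linearIndepOn_iff]
  constructor
  · intro h v hv
    let l : (R ⊕ S) →₀ k := Finsupp.equivFunOnFinite.symm (Sum.elim (fun r => - ∑ s, A r s * v s) v)
    have hl : ∀ t, l t = Sum.elim (fun r => - ∑ s, A r s * v s) v t := fun t => rfl
    have := h l (by
      rw [Finsupp.mem_supported']
      rintro (r | s) ht
      · rw [hl]; have := hv _ ht; rw [gr_inl] at this; simp [this]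
      · rw [hl]; exact hv _ ht) (by
      rw [Finsupp.linearCombination_apply, Finsupp.sum_fintype _ _ (by simp), cf_sum]
      ext r
      simp [hl])
    ext s
    have := DFunLike.congr_fun this (Sum.inr s)
    exact this
  · intro h l hl h0
    rw [Finsupp.mem_supported'] at hl
    rw [Finsupp.linearCombination_apply, Finsupp.sum_fintype _ _ (by simp), cf_sum] at h0
    have h1 : ∀ r, ∑ s, A r s * l (Sum.inr s) = - l (Sum.inl r) := fun r => by
      have := congrFun h0 r
      simp only [Pi.zero_apply] at this
      linear_combination this
    have h2 := h (fun s => l (Sum.inr s)) (by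
      rintro (r | s) ht
      · rw [gr_inl, h1, hl _ ht, neg_zero]
      · exact hl _ ht)
    ext t
    rcases t with r | s
    · have := h1 r
      have h3 : ∀ s, l (Sum.inr s) = 0 := fun s => congrFun h2 s
      simp only [h3, mul_zero, Finset.sum_const_zero] at this
      simpa using this.symm
    · exact congrFun h2 s

/-- transposed matrix -/
def mtr (A : R → S → k) : S → R → k := fun s r => A r s

theorem gr_dot (v : S → k) (t : R ⊕ S) : gr A v t = ∑ s, cf (mtr A) t.swap s * v s := by
  rcases t with r | s
  · rfl
  · rw [gr_inr]
    simp only [cf, Sum.swap_inr, Sum.elim_inl]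
    rw [Finset.sum_eq_single s]
    · simp
    · intro b _ hb; simp [hb]
    · simp

/-- `Bs` means spanning in the dual -/
theorem bs_span (T : Set (R ⊕ S)) : Bs A T ↔ Submodule.span k (cf (mtr A) '' (Sum.swap '' T)) = ⊤ := by
  constructor
  · intro h
    by_contra hne
    obtain ⟨f, hf, hf0⟩ := Submodule.exists_dual_map_eq_bot_of_lt_top (lt_top_iff_ne_top.2 hne) inferInstance
    apply hf
    have hfv : ∀ w : S → k, f w = ∑ s, w s * f (Pi.single s 1) := by
      intro w
      conv_lhs => rw [← Finset.univ_sum_single w]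
      rw [map_sum]
      refine Finset.sum_congr rfl fun s _ => ?_
      rw [← smul_eq_mul, ← map_smul]
      congr 1
      ext t
      by_cases ht : t = s
      · subst ht; simp
      · simp [ht]
    have := h (fun s => f (Pi.single s 1)) (by
      intro t ht
      rw [gr_dot, ← hfv]
      have : f (cf (mtr A) t.swap) ∈ Submodule.map f (Submodule.span k (cf (mtr A) '' (Sum.swap '' T))) :=
        Submodule.mem_map_of_mem (Submodule.subset_span ⟨_, ⟨t, ht, rfl⟩, rfl⟩)
      rw [hf0] at this
      exact (Submodule.mem_bot k).1 this)
    ext s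
    exact congrFun this s
  · intro h v hv
    have key : ∀ w ∈ Submodule.span k (cf (mtr A) '' (Sum.swap '' T)), ∑ s, w s * v s = 0 := by
      intro w hw
      induction hw using Submodule.span_induction with
      | mem w hw =>
        obtain ⟨_, ⟨t, ht, rfl⟩, rfl⟩ := hw
        rw [← gr_dot]; exact hv t ht
      | zero => simp
      | add a b _ _ ha hb => simp only [Pi.add_apply, add_mul, Finset.sum_add_distrib, ha, hb, add_zero]
      | smul c a _ ha => simp only [Pi.smul_apply, smul_eq_mul, mul_assoc, ← Finset.mul_sum, ha, mul_zero]
    ext s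
    have := key (Pi.single s 1) (by rw [h]; trivial)
    rw [Finset.sum_eq_single s] at this
    · simpa using this
    · intro b _ hb; simp [hb]
    · simp

/-- `Bs` of the transpose -/
theorem bs_tr (T : Set (S ⊕ R)) : Bs (mtr A) T ↔
    ∃ T2 : Set (R ⊕ S), Sum.swap '' Tᶜ ⊆ T2 ∧ T2.ncard = Fintype.card S ∧ Bs A T2 := by
  have h1 := li_bs (A := mtr A) Tᶜ
  rw [compl_compl] at h1
  rw [← h1]
  have inj : Function.Injective (Sum.swap : R ⊕ S → S ⊕ R) := (Equiv.sumComm R S).injective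
  have inj' : Function.Injective (Sum.swap : S ⊕ R → R ⊕ S) := (Equiv.sumComm S R).injective
  constructor
  · intro h
    have hsp : Submodule.span k (range (cf (mtr A))) = ⊤ := by
      rw [eq_top_iff]
      intro w _
      rw [← Finset.univ_sum_single w]
      refine Submodule.sum_mem _ fun s _ => ?_
      have : (Pi.single s (w s) : S → k) = w s • cf (mtr A) (Sum.inl s) := by
        ext t
        by_cases ht : t = s
        · subst ht; simp [cf]
        · simp [cf, ht]
      rw [this]
      exact Submodule.smul_mem _ _ (Submodule.subset_span ⟨_, rfl⟩)
    obtain ⟨b, hb1, hb2, hb3, hb4⟩ := exists_linearIndepOn_extension h (subset_univ _)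
    have hspan : Submodule.span k (cf (mtr A) '' b) = ⊤ := by
      rw [eq_top_iff, ← hsp, Submodule.span_le, ← image_univ]
      exact hb3
    refine ⟨Sum.swap '' b, image_mono hb2, ?_, ?_⟩
    · rw [ncard_image_of_injective _ inj']
      have : Module.finrank k (S → k) = b.ncard := by
        have hb5 : LinearIndependent k (fun t : b => cf (mtr A) t) := hb4
        let bs := Module.Basis.mk hb5 (by rw [← hspan, image_eq_range])
        have := Module.finrank_eq_nat_card_basis bs
        rw [this, Nat.card_coe_set_eq]
      rw [← this]; simp
    · have : (Sum.swap '' (Sum.swap '' b : Set (R ⊕ S)) : Set (S ⊕ R)) = b := by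
        rw [← image_comp]
        have : (Sum.swap ∘ Sum.swap : S ⊕ R → S ⊕ R) = id := by ext t; simp
        rw [this, image_id]
      rw [bs_span, this, hspan]
  · rintro ⟨T2, h2, h3, h4⟩
    rw [bs_span] at h4
    have hTs : Tᶜ ⊆ Sum.swap '' T2 := by
      intro t ht; exact ⟨t.swap, h2 ⟨t, ht, rfl⟩, by simp⟩
    refine LinearIndepOn.mono ?_ hTs
    have : LinearIndependent k (fun t : (Sum.swap '' T2 : Set (S ⊕ R)) => cf (mtr A) t) := by
      apply linearIndependent_of_top_le_span_of_card_eq_finrank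
      · rw [← h4, image_eq_range]
      · rw [← Nat.card_eq_fintype_card, Nat.card_coe_set_eq, ncard_image_of_injective _ inj, h3]; simp
    exact this

theorem Rep.mtr (h : Rep A B) : Rep (mtr A) (mtr B) := by
  intro T
  rw [bs_tr, bs_tr]
  simp only [h _]
end

end NR

namespace NR
open Classical

theorem kneg (a : K) : -a = a := by revert a; decide
theorem kinv (a : K) : a⁻¹ = a := by
  rcases k01 a with rfl | rfl <;> simp

theorem piv_mtr {R S : Type} (A : R → S → K) (r : R) (s : S) : piv (mtr A) s r = mtr (piv A r s) := by
  funext s' r'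
  by_cases hr : r' = r
  · by_cases hs : s' = s
    · subst hr hs; simp [piv, mtr]
    · subst hr; simp [piv, mtr, hs, kinv, kneg, mul_comm]
  · by_cases hs : s' = s
    · subst hs; simp [piv, mtr, hr, kinv, kneg, mul_comm]
    · simp only [piv, mtr, hr, hs, if_false, mul_assoc, mul_comm, mul_left_comm]

theorem PMin.tr {R0 S0 : Type} {A0 : R0 → S0 → K} {R S : Type} {A : R → S → K} (h : PMin A0 A) :
    PMin (mtr A0) (mtr A) := by
  induction h with
  | base => exact PMin.base
  | sub f g hf hg A h ih => exact PMin.sub g f hg hf _ ih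
  | pv A r s h0 h ih => exact PMin.pv _ s r h0 (by rw [piv_mtr]; exact ih)

section
variable {F : Type} [Field F] {R S : Type} [Fintype S] {A : R → S → K} {B : R → S → F} {x y : S}

theorem bs_ext {k : Type} [Field k] {C : R → S → k} {T : Set (R ⊕ S)} {r : R} (hx : Sum.inr x ∉ T)
    (hr : Sum.inl r ∈ T) (h : C r x ≠ 0) (h0 : ∀ r', r' ≠ r → C r' x = 0) :
    Bs C T ↔ Bs C (T \ {Sum.inl r} ∪ {Sum.inr x}) := by
  have e : ∀ (q : R) (v : S → k) (c : k), ∑ t, C q t * (v + Pi.single x c : S → k) t = ∑ t, C q t * v t + C q x * c := by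
    intro q v c
    simp only [Pi.add_apply, mul_add, Finset.sum_add_distrib, sum_single']
  constructor
  · intro hB v hv
    have h1 : v x = 0 := hv (Sum.inr x) (Or.inr rfl)
    have := hB (v + Pi.single x (- (C r x)⁻¹ * ∑ t, C r t * v t)) (by
      rintro (q | s) ht
      · rw [gr_inl, e]
        by_cases hq : q = r
        · subst hq; field_simp; ring
        · rw [h0 q hq, zero_mul, add_zero]
          exact hv _ (Or.inl ⟨ht, by simpa using hq⟩)
      · rw [gr_inr]
        have hs : s ≠ x := by rintro rfl; exact hx ht
        simp only [Pi.add_apply, Pi.single_eq_of_ne hs, add_zero]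
        exact hv _ (Or.inl ⟨ht, by simp⟩))
    ext s
    by_cases hs : s = x
    · subst hs; exact h1
    · have := congrFun this s
      simpa [hs] using this
  · intro hB v hv
    have := hB (v + Pi.single x (- v x)) (by
      rintro (q | s) ht
      · rw [gr_inl, e]
        rcases ht with ⟨ht, hq⟩ | ht
        · rw [h0 q (by simpa using hq), zero_mul, add_zero]
          exact hv _ ht
        · simp at ht
      · rw [gr_inr]
        by_cases hs : s = x
        · subst hs; simp
        · simp only [Pi.add_apply, Pi.single_eq_of_ne hs, add_zero]
          rcases ht with ht | ht
          · exact hv _ ht.1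
          · simp at ht; exact (hs ht).elim)
    have h2 : ∀ s, s ≠ x → v s = 0 := by
      intro s hs
      have := congrFun this s
      simpa [hs] using this
    have h3 := hv _ hr
    rw [gr_inl, Finset.sum_eq_single x (fun s _ hs => by rw [h2 s hs, mul_zero]) (by simp)] at h3
    ext s
    by_cases hs : s = x
    · subst hs; exact (mul_eq_zero.1 h3).resolve_left h
    · exact h2 s hs

theorem bs_ext0 {k : Type} [Field k] {C : R → S → k} {T : Set (R ⊕ S)} (hx : Sum.inr x ∉ T)
    (h : ∀ r, Sum.inl r ∈ T → C r x = 0) : ¬ Bs C T := by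
  intro hB
  have := hB (Pi.single x 1) (by
    rintro (r | t) ht
    · rw [gr_inl, sum_single', h r ht, zero_mul]
    · rw [gr_inr]
      exact Pi.single_eq_of_ne (by rintro rfl; exact hx ht) _)
  have := congrFun this x
  simp at this

theorem bs_col {k : Type} [Field k] {Q : Set S} {C C' : R → S → k} (hC : ∀ r, ∀ s ∈ Q, C r s = C' r s)
    {T : Set (R ⊕ S)} (hT : ∀ s, s ∉ Q → Sum.inr s ∈ T) : Bs C T ↔ Bs C' T := by
  have : ∀ B B' : R → S → k, (∀ r, ∀ s ∈ Q, B r s = B' r s) → Bs B T → Bs B' T := by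
    intro B B' hBB hB v hv
    apply hB v
    rintro (r | s) ht
    · rw [← hv _ ht, gr_inl, gr_inl]
      refine Finset.sum_congr rfl fun s _ => ?_
      by_cases hs : s ∈ Q
      · rw [hBB r s hs]
      · have := hv _ (hT s hs)
        rw [gr_inr] at this
        rw [this, mul_zero, mul_zero]
    · exact hv _ ht
  exact ⟨this _ _ hC, this _ _ fun r s hs => (hC r s hs).symm⟩

/-- loops, parallel and coloop extensions -/
theorem ext1 (h : RepQ {x}ᶜ A B) (hs : ∀ r r', A r x ≠ 0 → A r' x ≠ 0 → r = r') :
    ∃ B' : R → S → F, Rep A B' := by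
  let B' : R → S → F := fun r s => if s = x then (if A r x = 0 then 0 else 1) else B r s
  have hB' : ∀ r, A r x = 0 → B' r x = 0 := fun r h => by simp [B', h]
  have hB1 : ∀ r, A r x ≠ 0 → B' r x ≠ 0 := fun r h => by simp [B', h]
  have hx : ∀ T : Set (R ⊕ S), Sum.inr x ∈ T → (Bs A T ↔ Bs B' T) := by
    intro T hT
    have hT' : ∀ s, s ∉ ({x}ᶜ : Set S) → Sum.inr s ∈ T := by
      intro s hs
      have : s = x := by by_contra h; exact hs h
      rwa [this]
    rw [h T hT']
    refine bs_col (Q := {x}ᶜ) (fun r s hs => ?_) hT'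
    have : s ≠ x := hs
    simp [B', this]
  refine ⟨B', fun T => ?_⟩
  by_cases hT : Sum.inr x ∈ T
  · exact hx T hT
  by_cases hr : ∃ r, Sum.inl r ∈ T ∧ A r x ≠ 0
  · obtain ⟨r, hr, h1⟩ := hr
    have h2 : ∀ r', r' ≠ r → A r' x = 0 := by
      intro r' hr'
      by_contra h3
      exact hr' (hs _ _ h3 h1)
    rw [bs_ext hT hr h1 h2, bs_ext hT hr (hB1 r h1) (fun r' hr' => hB' r' (h2 r' hr'))]
    exact hx _ (Or.inr rfl)
  · push Not at hr
    exact iff_of_false (bs_ext0 hT hr) (bs_ext0 hT fun r h => hB' r (hr r h))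

/-- direct sums -/
theorem bs_sum {k : Type} [Field k] {C : R → S → k} {P : Set R} {Q : Set S}
    (h : ∀ r s, C r s ≠ 0 → (r ∈ P ↔ s ∈ Q)) (T : Set (R ⊕ S)) :
    Bs C T ↔ Bs C (T ∪ Sum.inr '' Qᶜ) ∧ Bs C (T ∪ Sum.inr '' Q) := by
  constructor
  · intro hB; exact ⟨hB.mono subset_union_left, hB.mono subset_union_left⟩
  · rintro ⟨h1, h2⟩ v hv
    have z : ∀ r s, ¬ (r ∈ P ↔ s ∈ Q) → C r s = 0 := fun r s hn => by
      by_contra hc; exact hn (h r s hc)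
    have a1 := h1 (fun s => if s ∈ Q then v s else 0) (by
      rintro t (ht | ⟨s, hs, rfl⟩)
      · rcases t with r | s
        · rw [gr_inl]
          by_cases hr : r ∈ P
          · rw [← hv _ ht, gr_inl]
            refine Finset.sum_congr rfl fun s _ => ?_
            by_cases hs : s ∈ Q
            · rw [if_pos hs]
            · rw [z r s (by tauto)]; ring
          · refine Finset.sum_eq_zero fun s _ => ?_
            by_cases hs : s ∈ Q
            · rw [z r s (by tauto)]; ring
            · rw [if_neg hs, mul_zero]
        · rw [gr_inr]
          have : v s = 0 := hv _ ht
          simp [this]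
      · rw [gr_inr]; exact if_neg hs)
    have a2 := h2 (fun s => if s ∈ Q then 0 else v s) (by
      rintro t (ht | ⟨s, hs, rfl⟩)
      · rcases t with r | s
        · rw [gr_inl]
          by_cases hr : r ∈ P
          · refine Finset.sum_eq_zero fun s _ => ?_
            by_cases hs : s ∈ Q
            · rw [if_pos hs, mul_zero]
            · rw [z r s (by tauto)]; ring
          · rw [← hv _ ht, gr_inl]
            refine Finset.sum_congr rfl fun s _ => ?_
            by_cases hs : s ∈ Q
            · rw [z r s (by tauto)]; ring
            · rw [if_neg hs]
        · rw [gr_inr]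
          have : v s = 0 := hv _ ht
          simp [this]
      · rw [gr_inr]; exact if_pos hs)
    ext s
    by_cases hs : s ∈ Q
    · have := congrFun a1 s
      simpa [hs] using this
    · have := congrFun a2 s
      simpa [hs] using this

theorem rep_sum {P : Set R} {Q : Set S} (h : ∀ r s, A r s ≠ 0 → (r ∈ P ↔ s ∈ Q)) {B1 B2 : R → S → F}
    (h1 : RepQ Q A B1) (h2 : RepQ Qᶜ A B2) : ∃ B : R → S → F, Rep A B := by
  let B : R → S → F := fun r s => if s ∈ Q then B1 r s else B2 r s
  refine ⟨B, fun T => ?_⟩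
  have hB : ∀ r s, B r s ≠ 0 → (r ∈ P ↔ s ∈ Q) := by
    intro r s hne
    by_cases hs : s ∈ Q
    · exact h r s ((h1.entry r hs).2 (by simpa [B, hs] using hne))
    · exact h r s ((h2.entry r hs).2 (by simpa [B, hs] using hne))
  rw [bs_sum h, bs_sum hB]
  have t1 : ∀ s, s ∉ Q → Sum.inr s ∈ T ∪ Sum.inr '' Qᶜ := fun s hs => Or.inr ⟨s, hs, rfl⟩
  have t2 : ∀ s, s ∉ Qᶜ → Sum.inr s ∈ T ∪ Sum.inr '' Q := fun s hs => Or.inr ⟨s, not_not.1 hs, rfl⟩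
  rw [h1 _ t1, h2 _ t2, bs_col (C := B1) (C' := B) (fun r s hs => by simp [B, hs]) t1,
    bs_col (C := B2) (C' := B) (fun r s hs => by
      have : s ∉ Q := hs
      simp [B, this]) t2]
end
end NR

namespace NR
open Classical

/-- induction hypothesis for the excluded minor theorem -/
def IHT (F : Type) [Field F] (n : ℕ) : Prop :=
  ∀ m, m < n → ∀ (R S : Type) [Fintype R] [Fintype S] (A : R → S → K), Fintype.card R + Fintype.card S = m →
    (∀ B : R → S → F, ¬ Rep A B) → PMin F7m A ∨ PMin (mtr F7m) A

/-- a counterexample -/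
structure CEx (F : Type) [Field F] {R S : Type} [Fintype S] (A : R → S → K) : Prop where
  nr : ∀ B : R → S → F, ¬ Rep A B
  nf : ¬ PMin F7m A
  nd : ¬ PMin (mtr F7m) A

section
variable {F : Type} [Field F] {R S : Type} [Fintype R] [Fintype S] {A : R → S → K}

theorem CEx.pivot (h : CEx F A) {r : R} {s : S} (h0 : A r s ≠ 0) : CEx F (piv A r s) :=
  ⟨fun B hB => by obtain ⟨B', h'⟩ := hB.of_piv h0; exact h.nr _ h',
   fun hp => h.nf (PMin.pv _ r s h0 hp), fun hp => h.nd (PMin.pv _ r s h0 hp)⟩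

theorem CEx.tr (h : CEx F A) : CEx F (mtr A) :=
  ⟨fun B hB => h.nr _ (Rep.mtr hB), fun hp => h.nd hp.tr, fun hp => h.nf hp.tr⟩

theorem CEx.cols {n : ℕ} (ih : IHT F n) (hn : Fintype.card R + Fintype.card S = n) (h : CEx F A)
    {Q : Set S} (hQ : Q ≠ univ) : ∃ B : R → S → F, RepQ Q A B := by
  by_contra hno
  obtain ⟨x, hx⟩ := (ne_univ_iff_exists_notMem Q).1 hQ
  have hlt : Fintype.card Q < Fintype.card S := Fintype.card_subtype_lt (x := x) hx
  have := ih (Fintype.card R + Fintype.card Q) (by omega) R Q (fun r s => A r s.1) rfl (by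
    intro B hB
    apply hno
    refine ⟨fun r s => if hs : s ∈ Q then B r ⟨s, hs⟩ else 0, ?_⟩
    have hr : Q = range (Subtype.val : Q → S) := by simp
    have key := (repQ_range (A := A) (B := fun r s => if hs : s ∈ Q then B r ⟨s, hs⟩ else 0) (Subtype.val_injective (p := fun s => s ∈ Q))).2 ?_
    · rw [← hr] at key; exact key
    convert hB using 3
    simp)
  rcases this with hp | hp
  · exact h.nf (PMin.sub id Subtype.val Function.injective_id Subtype.val_injective A hp)
  · exact h.nd (PMin.sub id Subtype.val Function.injective_id Subtype.val_injective A hp)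

theorem CEx.supp {n : ℕ} (ih : IHT F n) (hn : Fintype.card R + Fintype.card S = n) (h : CEx F A) (x : S) :
    ∃ r r', A r x ≠ 0 ∧ A r' x ≠ 0 ∧ r ≠ r' := by
  by_contra hno
  push Not at hno
  obtain ⟨B, hB⟩ := h.cols ih hn (Q := {x}ᶜ) (by
    rw [ne_univ_iff_exists_notMem]; exact ⟨x, by simp⟩)
  obtain ⟨B', hB'⟩ := ext1 hB hno
  exact h.nr _ hB'

theorem CEx.conn {n : ℕ} (ih : IHT F n) (hn : Fintype.card R + Fintype.card S = n) (h : CEx F A)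
    {P : Set R} {Q : Set S} (hs : ∀ r s, A r s ≠ 0 → (r ∈ P ↔ s ∈ Q)) :
    (P = ∅ ∧ Q = ∅) ∨ (P = univ ∧ Q = univ) := by
  have hrow : ∀ r, ∃ s, A r s ≠ 0 := by
    intro r
    obtain ⟨s, _, h1, _⟩ := h.tr.supp ih (by omega) r
    exact ⟨s, h1⟩
  by_cases h1 : Q = ∅
  · left
    refine ⟨?_, h1⟩
    rw [eq_empty_iff_forall_notMem]
    intro r hr
    obtain ⟨s, h2⟩ := hrow r
    have := (hs r s h2).1 hr
    rw [h1] at this; exact this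
  by_cases h2 : Q = univ
  · right
    refine ⟨?_, h2⟩
    rw [eq_univ_iff_forall]
    intro r
    obtain ⟨s, h3⟩ := hrow r
    exact (hs r s h3).2 (h2 ▸ trivial)
  obtain ⟨B1, hB1⟩ := h.cols ih hn h2
  obtain ⟨B2, hB2⟩ := h.cols ih hn (Q := Qᶜ) (by rwa [ne_eq, compl_univ_iff])
  obtain ⟨B, hB⟩ := rep_sum hs hB1 hB2
  exact (h.nr _ hB).elim

/-- a set of rows connected by few columns -/
structure Few (A : R → S → K) (P : Set R) (X : Set S) : Prop where
  sup : ∀ s ∈ X, ∀ r, A r s ≠ 0 → r ∈ P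
  con : ∀ P0 : Set R, (∀ s ∈ X, ∀ r r', A r s ≠ 0 → A r' s ≠ 0 → (r ∈ P0 ↔ r' ∈ P0)) → P ⊆ P0 ∨ Disjoint P P0
  card : X.ncard + 2 ≤ P.ncard

theorem Few.grow {n : ℕ} (ih : IHT F n) (hn : Fintype.card R + Fintype.card S = n) (h : CEx F A) :
    ∀ (m : ℕ) (P : Set R) (X : Set S), Pᶜ.ncard = m → Few A P X → ∃ X, Few A univ X := by
  intro m
  induction m using Nat.strong_induction_on with
  | _ m im =>
  intro P X hm hF
  by_cases hP : P = univ
  · exact ⟨X, hP ▸ hF⟩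
  have : ∃ t r1 r2, r1 ∈ P ∧ r2 ∉ P ∧ A r1 t ≠ 0 ∧ A r2 t ≠ 0 := by
    by_contra hno
    push Not at hno
    rcases h.conn ih hn (P := P) (Q := {t | ∃ r ∈ P, A r t ≠ 0}) (by
      intro r s hrs
      constructor
      · intro hr; exact ⟨r, hr, hrs⟩
      · rintro ⟨r', h1, h2⟩
        by_contra hr
        exact hrs (hno s r' r h1 hr h2)) with ⟨h1, _⟩ | ⟨h1, _⟩
    · have := hF.card
      rw [h1] at this
      simp at this
    · exact hP h1
  obtain ⟨t, r1, r2, h1, h2, h3, h4⟩ := this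
  have hlt : P.ncard < (P ∪ {r | A r t ≠ 0}).ncard := by
    apply ncard_lt_ncard _ (toFinite _)
    exact ⟨subset_union_left, fun hsub => h2 (hsub (Or.inr h4))⟩
  refine im ((P ∪ {r | A r t ≠ 0})ᶜ).ncard ?_ (P ∪ {r | A r t ≠ 0}) (insert t X) rfl ⟨?_, ?_, ?_⟩
  · rw [← hm]
    apply ncard_lt_ncard _ (toFinite _)
    exact ⟨compl_subset_compl.2 subset_union_left, fun hsub => (hsub (show r2 ∈ Pᶜ from h2)) (Or.inr h4)⟩
  · rintro s (rfl | hs) r hr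
    · exact Or.inr hr
    · exact Or.inl (hF.sup s hs r hr)
  · intro P0 h0
    rcases hF.con P0 fun s hs => h0 s (Or.inr hs) with h5 | h5
    · left
      rintro r (hr | hr)
      · exact h5 hr
      · exact (h0 t (Or.inl rfl) r1 r h3 hr).1 (h5 h1)
    · right
      rw [Set.disjoint_left] at h5 ⊢
      rintro r (hr | hr) hr0
      · exact h5 hr hr0
      · exact h5 h1 ((h0 t (Or.inl rfl) r1 r h3 hr).2 hr0)
  · have := hF.card
    have := ncard_insert_le t X
    omega

theorem CEx.big3 {n : ℕ} (ih : IHT F n) (hn : Fintype.card R + Fintype.card S = n) (h : CEx F A)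
    (hc : Fintype.card R ≤ Fintype.card S) {s : S} (hs : 3 ≤ {r | A r s ≠ 0}.ncard) : False := by
  obtain ⟨X, hX⟩ := Few.grow ih hn h _ {r | A r s ≠ 0} {s} rfl ⟨by
      rintro _ rfl r hr; exact hr, by
      intro P0 h0
      by_cases hd : Disjoint {r | A r s ≠ 0} P0
      · exact Or.inr hd
      · left
        rw [Set.not_disjoint_iff] at hd
        obtain ⟨r, h1, h2⟩ := hd
        intro r' h3
        exact (h0 s rfl r r' h1 h3).1 h2, by
      rw [ncard_singleton]; exact hs⟩
  have h1 := hX.card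
  rw [ncard_univ, Nat.card_eq_fintype_card] at h1
  have h2 := ncard_add_ncard_compl X
  rw [Nat.card_eq_fintype_card] at h2
  obtain ⟨x, y, hx, hy, hxy⟩ := (one_lt_ncard_iff (s := Xᶜ) (toFinite _)).1 (by omega)
  have hC : CXY A x y := by
    intro P0 Q0 h0
    have : ∀ s ∈ X, ∀ r r', A r s ≠ 0 → A r' s ≠ 0 → (r ∈ P0 ↔ r' ∈ P0) := by
      intro s hs r r' hr hr'
      have sx : s ≠ x := by rintro rfl; exact hx hs
      have sy : s ≠ y := by rintro rfl; exact hy hs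
      rw [h0 r s sx sy hr, h0 r' s sx sy hr']
    rcases hX.con P0 this with h5 | h5
    · right; exact univ_subset_iff.1 h5
    · left; simpa using h5
  obtain ⟨B1, hB1⟩ := h.cols ih hn (Q := {x}ᶜ) (by
    rw [ne_univ_iff_exists_notMem]; exact ⟨x, by simp⟩)
  obtain ⟨B2, hB2⟩ := h.cols ih hn (Q := {y}ᶜ) (by
    rw [ne_univ_iff_exists_notMem]; exact ⟨y, by simp⟩)
  obtain ⟨B, h3, h4⟩ := fit hxy hB1 hB2
  exact h.nr B fun T => glue hxy _ A B h3 h4 hC h.nf T rfl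

theorem CEx.big {n : ℕ} (ih : IHT F n) (hn : Fintype.card R + Fintype.card S = n) (h : CEx F A)
    (hc : Fintype.card R ≤ Fintype.card S) : False := by
  rcases isEmpty_or_nonempty S with hS | ⟨⟨s⟩⟩
  · refine h.nr (fun _ _ => 0) fun T => ⟨fun _ v _ => Subsingleton.elim _ _, fun _ v _ => Subsingleton.elim _ _⟩
  have only : ∀ (t : S) (a b : R), A a t ≠ 0 → A b t ≠ 0 → a ≠ b → ∀ c, A c t ≠ 0 → c = a ∨ c = b := by
    intro t a b ha hb hab c hc'
    by_contra hno
    push Not at hno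
    apply h.big3 ih hn hc (s := t)
    rw [← Set.ncard_eq_three.2 ⟨a, b, c, hab, hno.1.symm, hno.2.symm, rfl⟩]
    apply ncard_le_ncard _ (toFinite _)
    rintro r (rfl | rfl | rfl) <;> assumption
  obtain ⟨a, b, ha, hb, hab⟩ := h.supp ih hn s
  have hsup := only s a b ha hb hab
  have : ∃ t r, t ≠ s ∧ A r t ≠ 0 ∧ (r = a ∨ r = b) := by
    by_contra hno
    push Not at hno
    rcases h.conn ih hn (P := {a, b}) (Q := {s}) (by
      intro r t hr
      constructor
      · intro h1
        by_contra h2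
        rcases h1 with h1 | h1
        · exact (hno t r h2 hr).1 h1
        · exact (hno t r h2 hr).2 h1
      · rintro rfl
        exact hsup r hr) with ⟨h1, _⟩ | ⟨h1, h2⟩
    · exact (h1 ▸ (Or.inl rfl : a ∈ ({a, b} : Set R)) : a ∈ (∅ : Set R))
    · have e1 : Fintype.card R = 2 := by
        rw [← Nat.card_eq_fintype_card, ← ncard_univ, ← h1, ncard_pair hab]
      have e2 : Fintype.card S = 1 := by
        rw [← Nat.card_eq_fintype_card, ← ncard_univ, ← h2, ncard_singleton]
      omega
  obtain ⟨t, r, hts, hr, hrab⟩ := this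
  have hrs : A r s ≠ 0 := by rcases hrab with rfl | rfl <;> assumption
  have key : ∀ r', A r' t ≠ 0 → r' ≠ r → piv A r s r' t = 1 + A r' s := by
    intro r' h1 h2
    rw [piv_apply_ne h2 hts, kne hr, kne h1, kne hrs]
    simp [sub_eq_add_neg, kneg]
  obtain ⟨q, hq, hqs⟩ : ∃ q, A q s ≠ 0 ∧ q ≠ r := by
    rcases hrab with rfl | rfl
    · exact ⟨b, hb, hab.symm⟩
    · exact ⟨a, ha, hab⟩
  obtain ⟨c, hct, hcr⟩ : ∃ c, A c t ≠ 0 ∧ c ≠ r := by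
    obtain ⟨u, v, h1, h2, h3⟩ := h.supp ih hn t
    by_cases hu : u = r
    · exact ⟨v, h2, fun h => h3 (hu.trans h.symm)⟩
    · exact ⟨u, h1, hu⟩
  have ssup := only s r q hrs hq hqs.symm
  have tsup := only t r c hr hct hcr.symm
  have hP := h.pivot hrs
  have pr : piv A r s r t ≠ 0 := by
    rw [piv_row hts]; simp [hrs, hr]
  by_cases hcq : c = q
  · subst hcq
    have z : ∀ r', piv A r s r' t ≠ 0 → r' = r := by
      intro r' hne
      by_contra h1
      apply hne
      by_cases h2 : r' = c
      · subst h2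
        rw [key r' hct h1, kne hq]; rfl
      · rw [piv_apply_ne h1 hts]
        have e1 : A r' t = 0 := by
          by_contra h3; rcases tsup r' h3 with h4 | h4; exacts [h1 h4, h2 h4]
        have e2 : A r' s = 0 := by
          by_contra h3; rcases ssup r' h3 with h4 | h4; exacts [h1 h4, h2 h4]
        rw [e1, e2]; simp
    obtain ⟨u, v, h1, h2, h3⟩ := hP.supp ih hn t
    exact h3 ((z u h1).trans (z v h2).symm)
  · apply hP.big3 ih hn hc (s := t)
    rw [← Set.ncard_eq_three.2 ⟨r, q, c, hqs.symm, hcr.symm, fun h => hcq h.symm, rfl⟩]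
    apply ncard_le_ncard _ (toFinite _)
    rintro r' (rfl | rfl | rfl)
    · exact pr
    · show piv A r s r' t ≠ 0
      have e1 : A r' t = 0 := by
        by_contra h3; rcases tsup r' h3 with h4 | h4; exacts [hqs h4, hcq h4.symm]
      rw [piv_apply_ne hqs hts, e1, kne hq, kne hrs, kne hr]; simp
    · show piv A r s r' t ≠ 0
      have e1 : A r' s = 0 := by
        by_contra h3; rcases ssup r' h3 with h4 | h4; exacts [hcr h4, hcq h4]
      rw [key r' hct hcr, e1]; simp

end

theorem tutte (F : Type) [Field F] : ∀ n, IHT F n := by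
  intro n
  induction n with
  | zero => intro m hm; omega
  | succ n ih =>
  intro m hm R S _ _ A hc hA
  by_contra hno
  push Not at hno
  have ih' : IHT F m := fun k hk => ih k (by omega)
  have h : CEx F A := ⟨hA, hno.1, hno.2⟩
  rcases le_total (Fintype.card R) (Fintype.card S) with hle | hle
  · exact h.big ih' hc hle
  · exact h.tr.big ih' (by omega) hle

end NR

namespace NR
open Classical

/-- point set of the matrix `[I | A]` together with `0` -/
def Eset {R S : Type} (A : R → S → K) : Set (R → K) := insert 0 (range (cf A))

theorem IsContr.mono {V U : Type} [AddCommGroup V] [Module K V] [AddCommGroup U] [Module K U] {E E' : Set V}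
    {f : V →ₗ[K] U} (h : IsContr E f) (hE : E ⊆ E') : IsContr E' f := by
  obtain ⟨h1, C, hC, h2⟩ := h
  exact ⟨h1, C, hC.trans hE, h2⟩

theorem isContr_sub {R R' S : Type} [Finite R] (f : R' → R) (hf : Function.Injective f) (A : R → S → K) :
    IsContr (Eset A) (LinearMap.funLeft K K f) := by
  have := Fintype.ofFinite R
  refine ⟨LinearMap.funLeft_surjective_of_injective K K f hf, (fun r => Pi.single r 1) '' (range f)ᶜ, ?_, ?_⟩
  · rintro _ ⟨r, _, rfl⟩
    exact Or.inr ⟨Sum.inl r, rfl⟩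
  · apply le_antisymm
    · intro v hv
      rw [← Finset.univ_sum_single v]
      refine Submodule.sum_mem _ fun r _ => ?_
      by_cases hr : r ∈ range f
      · obtain ⟨r', rfl⟩ := hr
        have : v (f r') = 0 := congrFun hv r'
        rw [this]; simp
      · rcases k01 (v r) with h | h
        · rw [h]; simp
        · rw [h]; exact Submodule.subset_span ⟨r, hr, rfl⟩
    · rw [Submodule.span_le]
      rintro _ ⟨r, hr, rfl⟩
      show LinearMap.funLeft K K f _ = 0
      ext r'
      have : f r' ≠ r := fun h => hr ⟨r', h⟩
      simp [LinearMap.funLeft_apply, this]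

/-- the row operation belonging to a pivot -/
noncomputable def prow {R S : Type} (A : R → S → K) (r : R) (s : S) : (R → K) →ₗ[K] (R → K) where
  toFun v := fun q => if q = r then v r else v q + A q s * v r
  map_add' u v := by
    funext q
    by_cases h : q = r
    · simp [h]
    · simp only [h, if_false, Pi.add_apply]; ring
  map_smul' c v := by
    funext q
    by_cases h : q = r
    · simp [h]
    · simp only [h, if_false, Pi.smul_apply, smul_eq_mul, RingHom.id_apply]; ring

theorem prow_prow {R S : Type} (A : R → S → K) (r : R) (s : S) (v : R → K) : prow A r s (prow A r s v) = v := by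
  funext q
  by_cases h : q = r
  · simp [prow, h]
  · simp only [prow, LinearMap.coe_mk, AddHom.coe_mk, h, if_false, if_true]
    rw [add_assoc, aa, add_zero]

theorem prow_img {R S : Type} (A : R → S → K) (r : R) (s : S) (h0 : A r s ≠ 0) :
    Eset (piv A r s) ⊆ prow A r s '' Eset A := by
  have h1 := kne h0
  rintro _ (rfl | ⟨q | t, rfl⟩)
  · exact ⟨0, Or.inl rfl, map_zero _⟩
  · by_cases hq : q = r
    · refine ⟨_, Or.inr ⟨Sum.inr s, rfl⟩, ?_⟩
      subst hq
      funext p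
      by_cases hp : p = q
      · subst hp; simp [prow, cf, h1]
      · simp [prow, cf, h1, hp, aa]
    · refine ⟨_, Or.inr ⟨Sum.inl q, rfl⟩, ?_⟩
      funext p
      have hq' : r ≠ q := fun h => hq h.symm
      by_cases hp : p = r
      · subst hp; simp [prow, cf, hq']
      · simp [prow, cf, hp, hq']
  · by_cases ht : t = s
    · subst ht
      refine ⟨_, Or.inr ⟨Sum.inl r, rfl⟩, ?_⟩
      funext p
      by_cases hp : p = r
      · subst hp; simp [prow, cf, piv, h1]
      · simp [prow, cf, piv, h1, hp]
    · refine ⟨_, Or.inr ⟨Sum.inr t, rfl⟩, ?_⟩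
      funext p
      by_cases hp : p = r
      · subst hp; simp [prow, cf, piv, h1, ht, kneg]
      · simp [prow, cf, piv, h1, hp, ht, sub_eq_add_neg, kneg]

theorem PMin.contr {R0 S0 : Type} {A0 : R0 → S0 → K} {R S : Type} {A : R → S → K} (h : PMin A0 A) :
    Finite R → ∃ f : (R → K) →ₗ[K] (R0 → K), IsContr (Eset A) f ∧ Eset A0 ⊆ f '' Eset A := by
  induction h with
  | base => intro _; exact ⟨LinearMap.id, isContr_id _, by simp⟩
  | sub f g hf hg A h ih =>
    intro _
    obtain ⟨l, h1, h2⟩ := ih (Finite.of_injective f hf)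
    have hs : Eset (fun r s => A (f r) (g s)) ⊆ LinearMap.funLeft K K f '' Eset A := by
      rintro _ (rfl | ⟨q | t, rfl⟩)
      · exact ⟨0, Or.inl rfl, map_zero _⟩
      · refine ⟨_, Or.inr ⟨Sum.inl (f q), rfl⟩, ?_⟩
        funext p
        by_cases hp : p = q
        · subst hp; simp [cf, LinearMap.funLeft_apply]
        · have : f p ≠ f q := fun h => hp (hf h)
          simp [cf, LinearMap.funLeft_apply, hp, this]
      · exact ⟨_, Or.inr ⟨Sum.inr (g t), rfl⟩, rfl⟩
    refine ⟨l ∘ₗ LinearMap.funLeft K K f, (isContr_sub f hf A).comp (h1.mono hs), ?_⟩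
    rw [LinearMap.coe_comp, image_comp]
    exact h2.trans (image_mono hs)
  | pv A r s h0 h ih =>
    intro hR
    obtain ⟨l, h1, h2⟩ := ih hR
    have hs := prow_img A r s h0
    have hc : IsContr (Eset A) (prow A r s) := by
      refine ⟨fun v => ⟨_, prow_prow A r s v⟩, ∅, empty_subset _, ?_⟩
      rw [Submodule.span_empty, LinearMap.ker_eq_bot]
      exact Function.LeftInverse.injective (prow_prow A r s)
    refine ⟨l ∘ₗ prow A r s, hc.comp (h1.mono hs), ?_⟩
    rw [LinearMap.coe_comp, image_comp]
    exact h2.trans (image_mono hs)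

theorem f7_all : ∀ x : Fin 3 → K, x = 0 ∨ (∃ r, (Pi.single r 1 : Fin 3 → K) = x) ∨ ∃ s, (fun r => F7m r s) = x := by
  intro x
  have h : ∀ a b c : K, ![a, b, c] = 0 ∨ (∃ r, (Pi.single r 1 : Fin 3 → K) = ![a, b, c]) ∨
      ∃ s, (fun r => F7m r s) = ![a, b, c] := by decide
  have e : x = ![x 0, x 1, x 2] := by funext i; fin_cases i <;> rfl
  rw [e]; exact h _ _ _

theorem PMin.fm {R S : Type} [Finite R] {A : R → S → K} (h : PMin F7m A) : FM (Eset A) := by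
  obtain ⟨f, h1, h2⟩ := h.contr ‹_›
  refine ⟨_, _, _, f, h1, ⊤, by simp, fun x _ => h2 ?_⟩
  rcases f7_all x with rfl | ⟨r, rfl⟩ | ⟨s, rfl⟩
  · exact Or.inl rfl
  · refine Or.inr ⟨Sum.inl r, ?_⟩
    unfold cf; simp only [Sum.elim_inl]; convert rfl
  · exact Or.inr ⟨Sum.inr s, rfl⟩

/-- change of coordinates for the dual Fano matrix -/
noncomputable def dmap : (Fin 4 → K) →ₗ[K] (Fin 4 → K) :=
  Fintype.linearCombination K ![![1, 1, 0, 1], ![1, 1, 0, 0], ![0, 1, 1, 0], ![0, 0, 1, 1]]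

theorem dmap_apply (x : Fin 4 → K) : dmap x = ![x 0 + x 1, x 0 + x 1 + x 2, x 2 + x 3, x 0 + x 3] := by
  unfold dmap
  rw [Fintype.linearCombination_apply, Fin.sum_univ_four]
  funext i
  fin_cases i <;> simp

theorem dmap_inj : Function.Injective dmap := by
  rw [← LinearMap.ker_eq_bot, LinearMap.ker_eq_bot']
  intro x hx
  rw [dmap_apply] at hx
  have h : ∀ a b c d : K, ![a + b, a + b + c, c + d, a + d] = (0 : Fin 4 → K) → ![a, b, c, d] = 0 := by decide
  have e : x = ![x 0, x 1, x 2, x 3] := by funext i; fin_cases i <;> rfl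
  rw [e]; exact h _ _ _ _ hx

theorem f7d_all : ∀ x : Fin 4 → K, x 0 = 1 → x ≠ Pi.single 0 1 →
    (∃ r, (Pi.single r 1 : Fin 4 → K) = dmap x) ∨ ∃ s, (fun r => mtr F7m r s) = dmap x := by
  intro x h0 h1
  have h : ∀ b c d : K, ![1, b, c, d] ≠ (Pi.single 0 1 : Fin 4 → K) →
     (∃ r, (Pi.single r 1 : Fin 4 → K) = ![1 + b, 1 + b + c, c + d, 1 + d]) ∨
      ∃ s, (fun r => F7m s r) = ![1 + b, 1 + b + c, c + d, 1 + d] := by decide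
  have e : x = ![1, x 1, x 2, x 3] := by rw [← h0]; funext i; fin_cases i <;> rfl
  rw [dmap_apply, h0]
  refine h _ _ _ ?_
  rw [← e]
  convert h1

theorem PMin.fd {R S : Type} [Finite R] {A : R → S → K} (h : PMin (mtr F7m) A) : FD (Eset A) := by
  obtain ⟨f, h1, h2⟩ := h.contr ‹_›
  refine ⟨_, _, _, f, h1, by simp, dmap, dmap_inj, fun x hx hx' => h2 ?_⟩
  rcases f7d_all x hx (by convert hx') with ⟨r, h⟩ | ⟨s, h⟩
  · refine Or.inr ⟨Sum.inl r, ?_⟩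
    rw [← h]
    unfold cf; simp only [Sum.elim_inl]; convert rfl
  · exact Or.inr ⟨Sum.inr s, h⟩

end NR

namespace NR
open Classical

theorem lio_image {F : Type} [Field F] {ι ι' W : Type*} [AddCommGroup W] [Module F W] {e : ι → ι'} {J : Set ι}
    (he : InjOn e J) (g : ι' → W) : LinearIndepOn F g (e '' J) ↔ LinearIndepOn F (g ∘ e) J :=
  ⟨fun h => h.comp_of_image he, fun h => LinearIndepOn.image_of_comp e g h⟩

theorem lio_inj {F : Type} [Field F] {ι W W' : Type*} [AddCommGroup W] [Module F W] [AddCommGroup W'] [Module F W']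
    {J : Set ι} (v : ι → W) (L : W →ₗ[F] W') (hL : Function.Injective L) :
    LinearIndepOn F (L ∘ v) J ↔ LinearIndepOn F v J :=
  L.linearIndepOn_iff_of_injOn hL.injOn

theorem lio_contr {F : Type} [Field F] {ι W W' : Type*} [AddCommGroup W] [Module F W] [AddCommGroup W'] [Module F W']
    {I J : Set ι} (v : ι → W) (f : W →ₗ[F] W') (hI : LinearIndepOn F v I) (hIJ : Disjoint I J)
    (hk : LinearMap.ker f = Submodule.span F (v '' I)) :
    LinearIndepOn F v (I ∪ J) ↔ LinearIndepOn F (f ∘ v) J := by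
  rw [← hI.quotient_iff_union hIJ, ← hk]
  have : f ∘ v = ((LinearMap.ker f).liftQ f le_rfl) ∘ ((LinearMap.ker f).mkQ ∘ v) := by
    ext i; simp
  rw [this]
  refine (lio_inj ((LinearMap.ker f).mkQ ∘ v) _ ?_).symm
  rw [← LinearMap.ker_eq_bot]
  exact Submodule.ker_liftQ_eq_bot _ _ _ le_rfl

/-- a simple binary matroid has finite ground set -/
theorem ground_finite {α : Type*} {M : Matroid α} {n : ℕ} {φ : α → Fin n → K} (h : M.IsRepBy K φ) (hs : M.IsSimpleM) :
    M.E.Finite := by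
  apply Set.Finite.of_injOn (f := φ) (mapsTo_univ _ _) ?_ (toFinite univ)
  intro a ha b hb hab
  have h1 : LinearIndepOn K φ {a, b} := (h {a, b} (by rintro x (rfl | rfl) <;> assumption)).1 (hs a ha b hb)
  exact h1.injOn (Or.inl rfl) (Or.inr rfl) hab

/-- standard coordinates for a binary matroid -/
theorem coords {α : Type*} {M : Matroid α} {n : ℕ} {φ : α → Fin n → K} (h : M.IsRepBy K φ) (hfin : M.E.Finite) :
    ∃ (r m : ℕ) (e : Fin r ⊕ Fin m → α) (A : Fin r → Fin m → K), Function.Injective e ∧ range e = M.E ∧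
      ∀ J, M.Indep (e '' J) ↔ LinearIndepOn K (cf A) J := by
  obtain ⟨B, hB⟩ := M.exists_isBase
  have hBE := hB.subset_ground
  have hBf : Finite B := (hfin.subset hBE)
  have hCf : Finite (M.E \ B : Set α) := (hfin.subset sdiff_subset)
  obtain ⟨r, ⟨b⟩⟩ := Finite.exists_equiv_fin B
  obtain ⟨m, ⟨c⟩⟩ := Finite.exists_equiv_fin (M.E \ B : Set α)
  let b' : Fin r → α := fun i => (b.symm i).1
  let c' : Fin m → α := fun i => (c.symm i).1
  have hb' : Function.Injective b' := Subtype.val_injective.comp b.symm.injective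
  have hc' : Function.Injective c' := Subtype.val_injective.comp c.symm.injective
  have rb : range b' = B := by
    show range (Subtype.val ∘ b.symm) = B
    rw [range_comp, b.symm.surjective.range_eq, image_univ, Subtype.range_val]
  have rc : range c' = M.E \ B := by
    show range (Subtype.val ∘ c.symm) = M.E \ B
    rw [range_comp, c.symm.surjective.range_eq, image_univ, Subtype.range_val]
  have hBi : LinearIndepOn K φ B := (h B hBE).1 hB.indep
  have hli : LinearIndependent K (φ ∘ b') := by
    rw [← linearIndepOn_univ_iff, ← lio_image hb'.injOn, image_univ, rb]; exact hBi
  have hsp : ∀ s, ∃ a : Fin r → K, Fintype.linearCombination K (φ ∘ b') a = φ (c' s) := by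
    intro s
    have hs : c' s ∈ M.E \ B := rc ▸ mem_range_self s
    have h1 : ¬ LinearIndepOn K φ (insert (c' s) B) := by
      intro h2
      have := (h _ (insert_subset hs.1 hBE)).2 h2
      exact hs.2 (hB.eq_of_subset_indep this (subset_insert _ _) ▸ mem_insert _ _)
    have h2 : φ (c' s) ∈ Submodule.span K (φ '' B) := by
      by_contra h2
      exact h1 (hBi.insert h2)
    rw [← rb, ← range_comp, ← Fintype.range_linearCombination] at h2
    exact h2
  choose A hA using hsp
  refine ⟨r, m, Sum.elim b' c', fun i s => A s i, ?_, ?_, ?_⟩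
  · apply hb'.sumElim hc'
    intro i s his
    have h1 : b' i ∈ B := rb ▸ mem_range_self i
    have h2 : c' s ∈ M.E \ B := rc ▸ mem_range_self s
    exact h2.2 (his ▸ h1)
  · rw [Sum.elim_range, rb, rc, union_sdiff_cancel hBE]
  · have hinj : Function.Injective (Sum.elim b' c') := by
      apply hb'.sumElim hc'
      intro i s his
      have h1 : b' i ∈ B := rb ▸ mem_range_self i
      have h2 : c' s ∈ M.E \ B := rc ▸ mem_range_self s
      exact h2.2 (his ▸ h1)
    have hr : range (Sum.elim b' c') = M.E := by rw [Sum.elim_range, rb, rc, union_sdiff_cancel hBE]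
    intro J
    rw [h _ (hr ▸ image_subset_range _ _)]
    have e1 : φ ∘ Sum.elim b' c' = Fintype.linearCombination K (φ ∘ b') ∘ cf (fun i s => A s i) := by
      funext t
      rcases t with i | s
      · simp only [Function.comp, Sum.elim_inl, cf]
        rw [Fintype.linearCombination_apply_single]; simp
      · simp only [Function.comp_apply, Sum.elim_inr, cf]
        exact (hA s).symm
    show LinearIndepOn K φ _ ↔ _
    rw [lio_image hinj.injOn, e1, lio_inj]
    exact hli.fintypeLinearCombination_injective

theorem repOver {α : Type*} {M : Matroid α} {r m : ℕ} {e : Fin r ⊕ Fin m → α} {A : Fin r → Fin m → K}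
    (he : Function.Injective e) (hr : range e = M.E) (h : ∀ J, M.Indep (e '' J) ↔ LinearIndepOn K (cf A) J)
    {F : Type} [Field F] {B : Fin r → Fin m → F} (hB : Rep A B) : M.IsRepOver F := by
  refine ⟨r, Function.extend e (cf B) 0, ?_⟩
  intro I hI
  show _ ↔ LinearIndepOn F _ I
  have hI' : I = e '' (e ⁻¹' I) := by
    rw [image_preimage_eq_inter_range, hr, inter_eq_left.2 hI]
  have hc : Function.extend e (cf B) 0 ∘ e = cf B := by funext t; exact he.extend_apply _ _ _
  rw [hI', lio_image he.injOn, hc, h, li_bs, li_bs, hB]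

theorem agf {α : Type*} {M : Matroid α} {r m : ℕ} {e : Fin r ⊕ Fin m → α} {A : Fin r → Fin m → K}
    (he : Function.Injective e) (hr : range e = M.E) (h : ∀ J, M.Indep (e '' J) ↔ LinearIndepOn K (cf A) J)
    (hAG : ¬ M.HasAGMinor) : AGF (Eset A) := by
  intro U _ _ f hf hcube
  obtain ⟨g, hg, hgE⟩ := hcube
  obtain ⟨C, hC, hk⟩ := hf.ker
  have hx0 : ∀ x : Fin 4 → K, x 0 = 1 → g x ≠ 0 := by
    intro x hx h0
    have : x = 0 := hg (by rw [h0, map_zero])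
    rw [this] at hx
    simp at hx
  have ht : ∀ x : Fin 4 → K, x 0 = 1 → ∃ t, f (cf A t) = g x := by
    intro x hx
    obtain ⟨v, hv | ⟨t, rfl⟩, h1⟩ := hgE x hx
    · rw [hv, map_zero] at h1; exact (hx0 x hx h1.symm).elim
    · exact ⟨t, h1⟩
  obtain ⟨t0, -⟩ := ht (Pi.single 0 1) (by simp)
  let t : (Fin 4 → K) → Fin r ⊕ Fin m := fun x => if hx : x 0 = 1 then (ht x hx).choose else t0
  have htf : ∀ x ∈ agVecs, f (cf A (t x)) = g x := by
    intro x hx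
    have hx : x 0 = 1 := hx
    have : t x = (ht x hx).choose := dif_pos hx
    rw [this]; exact (ht x hx).choose_spec
  have htinj : InjOn t agVecs := by
    intro x hx y hy hxy
    apply hg
    rw [← htf x hx, ← htf y hy, hxy]
  -- a basis of the kernel
  obtain ⟨I0, hI1, -, hI2, hI3⟩ := exists_linearIndepOn_extension (K := K) (v := cf A) (linearIndepOn_empty K (cf A))
    (empty_subset {t | f (cf A t) = 0})
  have hsp : LinearMap.ker f = Submodule.span K (cf A '' I0) := by
    apply le_antisymm
    · rw [hk, Submodule.span_le]
      intro v hv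
      have hv0 : f v = 0 := by
        rw [← LinearMap.mem_ker, hk]; exact Submodule.subset_span hv
      rcases hC hv with rfl | ⟨t, rfl⟩
      · exact zero_mem _
      · exact hI2 ⟨t, hv0, rfl⟩
    · rw [Submodule.span_le]
      rintro _ ⟨t, ht, rfl⟩
      exact hI1 ht
  have hdis : ∀ X ⊆ agVecs, Disjoint I0 (t '' X) := by
    intro X hX
    rw [Set.disjoint_right]
    rintro _ ⟨x, hx, rfl⟩ h1
    exact hx0 x (hX hx) ((htf x (hX hx)).symm.trans (hI1 h1))
  have hIind : M.Indep (e '' I0) := (h I0).2 hI3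
  apply hAG
  refine ⟨(M.con (e '' I0)).del (M.E \ e '' (t '' agVecs)), ⟨_, _, rfl⟩, ?_⟩
  have hE : ((M.con (e '' I0)).del (M.E \ e '' (t '' agVecs))).E = (e ∘ t) '' agVecs := by
    show (M.E \ e '' I0) \ (M.E \ e '' (t '' agVecs)) = _
    rw [image_comp]
    ext a
    constructor
    · rintro ⟨⟨h1, h2⟩, h3⟩
      by_contra h4
      exact h3 ⟨h1, h4⟩
    · intro h1
      refine ⟨⟨hr ▸ image_subset_range _ _ h1, ?_⟩, fun h2 => h2.2 h1⟩
      rintro h2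
      exact Set.disjoint_left.1 ((disjoint_image_iff he).2 (hdis agVecs subset_rfl)) h2 h1
  have hinj : InjOn (e ∘ t) agVecs := he.comp_injOn htinj
  have hψ : ∀ x ∈ agVecs, Function.invFunOn (e ∘ t) agVecs ((e ∘ t) x) = x := fun x hx =>
    hinj.leftInvOn_invFunOn hx
  refine ⟨Function.invFunOn (e ∘ t) agVecs, ?_, ?_⟩
  · intro I hI
    rw [hE] at hI
    obtain ⟨X, hX, rfl⟩ := subset_image_iff.1 hI
    show ((M ／ (e '' I0)) ↾ _).Indep _ ↔ LinearIndepOn K _ _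
    rw [restrict_indep_iff]
    have hsub : (e ∘ t) '' X ⊆ (M.con (e '' I0)).E \ (M.E \ e '' (t '' agVecs)) := by
      have : (e ∘ t) '' X ⊆ ((M.con (e '' I0)).del (M.E \ e '' (t '' agVecs))).E := by rw [hE]; exact hI
      exact this
    rw [and_iff_left hsub, hIind.contract_indep_iff, image_comp, and_iff_right, ← image_union, h, union_comm,
      lio_contr (cf A) f hI3 (hdis X hX) hsp, lio_image (htinj.mono hX), ← image_comp,
      lio_image (hinj.mono hX)]
    · have e1 : LinearIndepOn K ((f ∘ cf A) ∘ t) X ↔ LinearIndepOn K (g ∘ id) X :=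
        linearIndepOn_congr fun x hx => htf x (hX hx)
      have e2 : LinearIndepOn K (Function.invFunOn (e ∘ t) agVecs ∘ (e ∘ t)) X ↔ LinearIndepOn K (id : (Fin 4 → K) → _) X :=
        linearIndepOn_congr fun x hx => hψ x (hX hx)
      rw [e1, e2, lio_inj _ _ hg]
    · exact ((disjoint_image_iff he).2 (hdis X hX)).symm
  · rw [hE]
    refine ⟨?_, ?_, ?_⟩
    · rintro _ ⟨x, hx, rfl⟩
      rw [hψ x hx]; exact hx
    · rintro _ ⟨x, hx, rfl⟩ _ ⟨y, hy, rfl⟩ hxy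
      rw [hψ x hx, hψ y hy] at hxy
      rw [hxy]
    · intro x hx
      exact ⟨_, ⟨x, hx, rfl⟩, hψ x hx⟩

theorem rk_eq {α : Type*} {M : Matroid α} {r m : ℕ} {e : Fin r ⊕ Fin m → α} {A : Fin r → Fin m → K}
    (he : Function.Injective e) (hr : range e = M.E) (h : ∀ J, M.Indep (e '' J) ↔ LinearIndepOn K (cf A) J) :
    M.rkM = r := by
  have hle : ∀ n ∈ {n : ℕ | ∃ I ⊆ M.E, M.Indep I ∧ I.ncard = n}, n ≤ r := by
    rintro n ⟨I, hI, hi, rfl⟩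
    have hI' : I = e '' (e ⁻¹' I) := by
      rw [image_preimage_eq_inter_range, hr, inter_eq_left.2 hI]
    rw [hI', h] at hi
    rw [hI', ncard_image_of_injective _ he]
    have h1 : LinearIndependent K (fun t : (e ⁻¹' I : Set _) => cf A t) := hi
    have := h1.fintype_card_le_finrank
    rw [← Nat.card_eq_fintype_card, Nat.card_coe_set_eq] at this
    simpa using this
  apply le_antisymm
  · exact csSup_le' hle
  · apply le_csSup ⟨r, hle⟩
    refine ⟨e '' range Sum.inl, hr ▸ image_subset_range _ _, ?_, ?_⟩
    · rw [h, ← image_univ, lio_image Sum.inl_injective.injOn, linearIndepOn_univ_iff]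
      have := (Pi.basisFun K (Fin r)).linearIndependent
      have e1 : cf A ∘ Sum.inl = ⇑(Pi.basisFun K (Fin r)) := by
        funext i j
        simp [cf, Pi.single_apply]
      rw [e1]; exact this
    · rw [ncard_image_of_injective _ he, ← image_univ, ncard_image_of_injective _ Sum.inl_injective, ncard_univ]
      simp

end NR

theorem max_size_nonregular_no_AG32 {α : Type*} (M : Matroid α) (r : ℕ) (hr : 6 ≤ r)
    (hbin : M.IsBinaryM) (hsimple : M.IsSimpleM) (hnonreg : ¬ M.IsRegularM)
    (hrank : M.rkM = r) (hAG : ¬ M.HasAGMinor) :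
    M.E.ncard ≤ r.choose 2 + 4 := by
  classical
  obtain ⟨n, φ, hφ⟩ := hbin
  obtain ⟨r', m, e, A, he, hre, h⟩ := NR.coords hφ (NR.ground_finite hφ hsimple)
  have hr' := NR.rk_eq he hre h
  rw [hrank] at hr'
  subst hr'
  have hF : ∃ (F : Type) (_ : Field F), ¬ M.IsRepOver F := by
    by_contra hno
    push Not at hno
    exact hnonreg hno
  obtain ⟨F, _, hF⟩ := hF
  have hT := NR.tutte F _ _ (Nat.lt_succ_self _) _ _ A rfl fun B hB => hF (NR.repOver he hre h hB)
  have hagf := NR.agf he hre h hAG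
  have hpair : ∀ s t, LinearIndepOn NR.K (NR.cf A) {s, t} := by
    intro s t
    rw [← h, image_pair]
    exact hsimple _ (hre ▸ mem_range_self s) _ (hre ▸ mem_range_self t)
  have hcinj : Function.Injective (NR.cf A) := fun s t hst => (hpair s t).injOn (Or.inl rfl) (Or.inr rfl) hst
  have hc0 : ∀ s, NR.cf A s ≠ 0 := fun s => (hpair s s).ne_zero (Or.inl rfl)
  have hcard : (NR.Eset A).ncard = M.E.ncard + 1 := by
    unfold NR.Eset
    rw [ncard_insert_of_notMem _ (toFinite _), ← hre, ← image_univ, ← image_univ, ncard_image_of_injective _ hcinj,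
      ncard_image_of_injective _ he]
    rintro ⟨s, hs⟩
    exact hc0 s hs
  have h0 : (0 : Fin r → NR.K) ∈ NR.Eset A := Or.inl rfl
  have hspan : Submodule.span NR.K (NR.Eset A) = ⊤ := by
    rw [eq_top_iff]
    intro v _
    rw [← Finset.univ_sum_single v]
    refine Submodule.sum_mem _ fun i _ => ?_
    rcases NR.k01 (v i) with h1 | h1
    · rw [h1]; simp
    · rw [h1]
      refine Submodule.subset_span (Or.inr ⟨Sum.inl i, ?_⟩)
      funext j
      simp [NR.cf, Pi.single_apply]
  have hfr : Module.finrank NR.K (Fin r → NR.K) = r := by simp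
  have key : (NR.Eset A).ncard ≤ r.choose 2 + 5 := by
    by_cases hfm : NR.FM (NR.Eset A)
    · exact NR.thmA r hr _ _ hfr hagf h0 hspan hfm
    · rcases hT with hT | hT
      · exact (hfm hT.fm).elim
      · exact NR.thmB r (by omega) _ _ hfr hagf h0 hfm hT.fd
  omega
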